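/- arXiv:2002.03615 — 4 statements merged into one kernel-verified Lean document; each statement's English description precedes it below -/
import Mathlib

section
/- Let α ∈ ℝ be irrational and let g : ℝ/ℤ → ℝ be a continuous function with ∫₀¹ g(x)dx = 0. Let f be the homeomorphism of 𝕋² = (ℝ/ℤ)² defined by f(x,y) = (x+α, y+g(x)). If the family of iterates {f^k : k ∈ ℤ} is equicontinuous, then: (1) there is a constant B > 0 such that |∑_{j=0}^{n-1} g(x+jα)| ≤ B for all n ≥ 0 and all x; (2) g is a coboundary: there exists a continuous function h : ℝ/ℤ → ℝ with h(x+α) − h(x) = g(x) for all x; (3) the homeomorphism (x,y) ↦ (x, y+h(x)) conjugates f to the rotation (x,y) ↦ (x+α, y); (4) f is not minimal. -/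
open Filter Topology Metric
open scoped ENNReal

variable {X : Type*}

/-- Minimal number of balls of radius `ε` for the Bowen metric
`d_n^f(x,y) = max_{0 ≤ j ≤ n-1} dist (f^[j] x) (f^[j] y)` needed to cover `X`. -/
noncomputable def covNum [PseudoMetricSpace X] (f : X → X) (ε : ℝ) (n : ℕ) : ℕ :=
  sInf {m : ℕ | ∃ S : Finset X, S.card = m ∧
    ∀ x : X, ∃ s ∈ S, ∀ j < n, dist (f^[j] x) (f^[j] s) < ε}

/-- The polynomial entropy `hpol f = lim_{ε → 0} limsup_n log (Cov_ε(n)) / log n`,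
with values in `[0,+∞]`.  Since `ε ↦ limsup_n log (Cov_ε(n)) / log n` is antitone,
the limit as `ε → 0` is the supremum over `ε > 0`. -/
noncomputable def hpol [PseudoMetricSpace X] (f : X → X) : ℝ≥0∞ :=
  ⨆ (ε : ℝ) (_ : 0 < ε),
    Filter.atTop.limsup fun n : ℕ =>
      ENNReal.ofReal (Real.log (covNum f ε n) / Real.log n)


noncomputable def bSum (g : ℝ → ℝ) (α : ℝ) (n : ℕ) (x : ℝ) : ℝ :=
  ∑ j ∈ Finset.range n, g (x + (j : ℝ) * α)

lemma bSum_cont {g : ℝ → ℝ} (hg : Continuous g) (α : ℝ) (n : ℕ) : Continuous (bSum g α n) := by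
  unfold bSum; fun_prop

lemma bSum_per {g : ℝ → ℝ} (hper : Function.Periodic g 1) (α : ℝ) (n : ℕ) :
    Function.Periodic (bSum g α n) 1 := by
  intro x
  unfold bSum
  refine Finset.sum_congr rfl fun j _ => ?_
  rw [← hper (x + j * α)]; ring_nf

lemma bSum_shift (g : ℝ → ℝ) (α : ℝ) (n : ℕ) (x : ℝ) :
    bSum g α n (x + α) = bSum g α (n + 1) x - g x := by
  unfold bSum
  rw [Finset.sum_range_succ']
  simp only [Nat.cast_zero, zero_mul, add_zero, add_sub_cancel_right]
  refine Finset.sum_congr rfl fun j _ => ?_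
  push_cast; ring_nf

lemma bSum_int {g : ℝ → ℝ} (hg : Continuous g) (hper : Function.Periodic g 1)
    (hint : (∫ x in (0 : ℝ)..1, g x) = 0) (α : ℝ) (n : ℕ) (x : ℝ) :
    ∫ t in x..(x + 1), bSum g α n t = 0 := by
  unfold bSum
  rw [intervalIntegral.integral_finsetSum]
  · refine Finset.sum_eq_zero fun j _ => ?_
    rw [intervalIntegral.integral_comp_add_right (fun t => g t)]
    have := hper.intervalIntegral_add_eq (x + j * α) 0
    rw [zero_add, hint] at this
    rw [← this]; ring_nf
  · intro j _
    apply Continuous.intervalIntegrable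
    fun_prop

lemma circ_norm_small {a : ℝ} (ha : |a| ≤ 1 / 2) : ‖(a : AddCircle (1 : ℝ))‖ = |a| := by
  exact (AddCircle.norm_coe_eq_abs_iff 1 one_ne_zero).2 (by simpa using ha)

lemma lift_small {φ : ℝ → ℝ} (hφ : Continuous φ) {x δ : ℝ}
    (h0 : φ x = 0)
    (h : ∀ t, |t - x| < δ → ‖(φ t : AddCircle (1 : ℝ))‖ < 1 / 4) :
    ∀ t, |t - x| < δ → |φ t| < 1 / 4 := by
  intro t ht
  by_contra hc
  push Not at hc
  have hpre : IsPreconnected (Metric.ball x δ) := (convex_ball x δ).isPreconnected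
  have hx : x ∈ Metric.ball x δ := by
    simp only [Metric.mem_ball, dist_self]; exact lt_of_le_of_lt (abs_nonneg _) ht
  have ht' : t ∈ Metric.ball x δ := by simpa [Real.dist_eq] using ht
  have := hpre.intermediate_value hx ht' (f := fun t => |φ t|) (by fun_prop)
  obtain ⟨s, hs, hs'⟩ := this (show (1 / 4 : ℝ) ∈ _ from ⟨by simp [h0], hc⟩)
  have hs2 : |φ s| = 1 / 4 := hs'
  have h3 := h s (by simpa [Real.dist_eq] using hs)
  rw [circ_norm_small (by rw [hs2]; norm_num), hs2] at h3
  exact lt_irrefl _ h3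

lemma bSum_bound {g : ℝ → ℝ} (hg : Continuous g) (hper : Function.Periodic g 1)
    (hint : (∫ x in (0 : ℝ)..1, g x) = 0) (α δ : ℝ) (hδ : 0 < δ)
    (H : ∀ n x t, |t - x| < δ → |bSum g α n t - bSum g α n x| < 1 / 4) :
    ∃ B : ℝ, 0 < B ∧ ∀ n : ℕ, ∀ x : ℝ, |bSum g α n x| ≤ B := by
  obtain ⟨N, hN⟩ := exists_nat_one_div_lt hδ
  have hN0 : (0 : ℝ) < N + 1 := by positivity
  refine ⟨(N + 1) * (1 / 4), by positivity, fun n x => ?_⟩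
  have key : ∀ d : ℝ, |d| < δ → ∀ k : ℕ,
      |bSum g α n (x + k * d) - bSum g α n x| ≤ k * (1 / 4) := by
    intro d hd k
    induction k with
    | zero => simp
    | succ k ih =>
      have h1 := H n (x + k * d) (x + (k + 1 : ℕ) * d) (by push_cast; ring_nf; exact hd)
      have h2 := abs_sub_le (bSum g α n (x + (k + 1 : ℕ) * d)) (bSum g α n (x + k * d))
        (bSum g α n x)
      push_cast at *
      linarith
  have key2 : ∀ t ∈ Set.uIoc x (x + 1), ‖bSum g α n t - bSum g α n x‖ ≤ (N + 1) * (1 / 4) := by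
    intro t ht
    rw [Set.uIoc_of_le (by linarith)] at ht
    have := key ((t - x) / (N + 1)) (by
      rw [abs_div, abs_of_pos hN0, abs_of_pos (by linarith [ht.1])]
      refine lt_of_le_of_lt ?_ hN
      gcongr
      linarith [ht.2]) (N + 1)
    push_cast at this
    rw [mul_div_cancel₀ _ hN0.ne'] at this
    simpa using this
  have h3 := intervalIntegral.norm_integral_le_of_norm_le_const key2
  rw [intervalIntegral.integral_sub ((bSum_cont hg α n).intervalIntegrable _ _)
    (by simp), bSum_int hg hper hint] at h3
  simpa using h3

lemma iter_formula {α : ℝ} {g : ℝ → ℝ}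
    {f : (AddCircle (1 : ℝ) × AddCircle (1 : ℝ)) ≃ₜ (AddCircle (1 : ℝ) × AddCircle (1 : ℝ))}
    (hf : ∀ x y : ℝ, f ((x : AddCircle (1 : ℝ)), (y : AddCircle (1 : ℝ)))
        = (((x + α : ℝ) : AddCircle (1 : ℝ)), ((y + g x : ℝ) : AddCircle (1 : ℝ))))
    (n : ℕ) (x y : ℝ) : (f.toEquiv ^ n) ((x : AddCircle (1 : ℝ)), (y : AddCircle (1 : ℝ)))
        = (((x + n * α : ℝ) : AddCircle (1 : ℝ)),
          ((y + bSum g α n x : ℝ) : AddCircle (1 : ℝ))) := by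
  induction n with
  | zero => simp [bSum]
  | succ n ih =>
    rw [pow_succ', Equiv.Perm.mul_apply, ih]
    refine (hf _ _).trans ?_
    unfold bSum
    rw [Finset.sum_range_succ]
    push_cast
    ring_nf

lemma exists_cob {g : ℝ → ℝ} (hper : Function.Periodic g 1) (α : ℝ)
    (H : ∀ ε : ℝ, 0 < ε → ∃ δ : ℝ, 0 < δ ∧
      ∀ n x t, |t - x| < δ → |bSum g α n t - bSum g α n x| < ε)
    (B : ℝ) (hB : ∀ n : ℕ, ∀ x : ℝ, |bSum g α n x| ≤ B) :
    ∃ h : ℝ → ℝ, Continuous h ∧ Function.Periodic h 1 ∧ ∀ x : ℝ, h (x + α) - h x = g x := by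
  have bA : ∀ x, IsBoundedUnder (· ≤ ·) atTop (fun n => bSum g α n x) := fun x =>
    isBoundedUnder_of ⟨B, fun n => (abs_le.1 (hB n x)).2⟩
  have bB : ∀ x, IsBoundedUnder (· ≥ ·) atTop (fun n => bSum g α n x) := fun x =>
    isBoundedUnder_of ⟨-B, fun n => (abs_le.1 (hB n x)).1⟩
  have tr : ∀ x c, limsup (fun n => bSum g α n x + c) atTop
      = limsup (fun n => bSum g α n x) atTop + c := fun x c =>
    limsup_add_const atTop _ c (bA x) (bB x).isCoboundedUnder_le
  have le : ∀ x y ε, (∀ n, |bSum g α n y - bSum g α n x| < ε) →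
      limsup (fun n => bSum g α n y) atTop ≤ limsup (fun n => bSum g α n x) atTop + ε := by
    intro x y ε h
    rw [← tr]
    refine limsup_le_limsup (Eventually.of_forall fun n => ?_) (bB y).isCoboundedUnder_le
      (isBoundedUnder_of ⟨B + ε, fun n => by simpa using (abs_le.1 (hB n x)).2⟩)
    have := (abs_lt.1 (h n)).2
    show bSum g α n y ≤ bSum g α n x + ε
    linarith
  refine ⟨fun x => - limsup (fun n => bSum g α n x) atTop, ?_, ?_, ?_⟩
  · refine Continuous.neg (Metric.continuous_iff.2 fun x ε hε => ?_)
    obtain ⟨δ, hδ, h⟩ := H (ε / 2) (by linarith)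
    refine ⟨δ, hδ, fun t ht => ?_⟩
    rw [Real.dist_eq] at ht ⊢
    have h1 := le x t _ fun n => h n x t ht
    have h2 := le t x _ fun n => h n t x (by rwa [abs_sub_comm])
    rw [abs_lt]; constructor <;> linarith
  · intro x
    simp only [bSum_per hper α _ x]
  · intro x
    simp only [bSum_shift, sub_eq_add_neg]
    have := limsup_nat_add (fun n => bSum g α n x + -g x) 1
    rw [this, tr]; ring

lemma not_min {α : ℝ} {g : ℝ → ℝ}
    {f : (AddCircle (1 : ℝ) × AddCircle (1 : ℝ)) ≃ₜ (AddCircle (1 : ℝ) × AddCircle (1 : ℝ))}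
    (hf : ∀ x y : ℝ, f ((x : AddCircle (1 : ℝ)), (y : AddCircle (1 : ℝ)))
        = (((x + α : ℝ) : AddCircle (1 : ℝ)), ((y + g x : ℝ) : AddCircle (1 : ℝ))))
    {h : ℝ → ℝ} (hc : Continuous h) (hp : Function.Periodic h 1)
    (hh : ∀ x : ℝ, h (x + α) - h x = g x) :
    ¬ (∀ p : AddCircle (1 : ℝ) × AddCircle (1 : ℝ),
        Dense (Set.range fun n : ℤ => (f.toEquiv ^ n) p)) := by
  intro hd
  have hl : Continuous (hp.lift : AddCircle (1 : ℝ) → ℝ) := continuous_coinduced_dom.2 hc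
  let F : AddCircle (1 : ℝ) × AddCircle (1 : ℝ) → AddCircle (1 : ℝ) :=
    fun p => p.2 - ((hp.lift p.1 : ℝ) : AddCircle (1 : ℝ))
  have hF : Continuous F :=
    continuous_snd.sub ((AddCircle.continuous_mk' 1).comp (hl.comp continuous_fst))
  have hinv : ∀ p, F (f.toEquiv p) = F p := by
    rintro ⟨x, y⟩
    induction x using QuotientAddGroup.induction_on with | _ x => ?_
    induction y using QuotientAddGroup.induction_on with | _ y => ?_
    have : f.toEquiv ((x : AddCircle (1 : ℝ)), (y : AddCircle (1 : ℝ))) = _ := hf x y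
    rw [this]
    simp only [F, Function.Periodic.lift_coe]
    rw [← AddCircle.coe_sub, ← AddCircle.coe_sub, ← hh]
    ring_nf
  have hinvz : ∀ (n : ℤ) p, F ((f.toEquiv ^ n) p) = F p := by
    intro n
    induction n using Int.induction_on with
    | zero => simp
    | succ n ih => intro p; rw [zpow_add_one, Equiv.Perm.mul_apply, ih, hinv]
    | pred n ih =>
      intro p
      rw [zpow_sub_one, Equiv.Perm.mul_apply, ih, ← hinv]
      congr 1
      exact Equiv.apply_symm_apply _ _
  have hconst : ∀ q, F q = F (0, 0) := by
    intro q
    have hcl : IsClosed {q | F q = F (0, 0)} := isClosed_eq hF continuous_const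
    have : Set.range (fun n : ℤ => (f.toEquiv ^ n) (0, 0)) ⊆ {q | F q = F (0, 0)} := by
      rintro _ ⟨n, rfl⟩
      exact hinvz n _
    exact hcl.closure_subset_iff.2 this (hd (0, 0) q)
  have := hconst (0, ((1 / 2 : ℝ) : AddCircle (1 : ℝ)))
  simp only [F, sub_left_inj] at this
  have h2 := circ_norm_small (a := 1 / 2) (by norm_num [abs_of_pos])
  rw [this] at h2
  norm_num at h2

/-- Let `α` be irrational and let `g : ℝ/ℤ → ℝ` be continuous with `∫₀¹ g = 0`
(encoded by a `1`-periodic continuous `g : ℝ → ℝ`), and let `f` be the homeomorphism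
`f(x,y) = (x+α, y+g(x))` of `𝕋² = (ℝ/ℤ)²`.  If the family of iterates `{f^k : k ∈ ℤ}`
is equicontinuous, then:
(1) the Birkhoff sums `∑_{j<n} g(x+jα)` are uniformly bounded;
(2) `g` is a coboundary: `g(x) = h(x+α) - h(x)` for a continuous (periodic) `h`;
(3) `(x,y) ↦ (x, y+h(x))` conjugates the rotation `(x,y) ↦ (x+α, y)` to `f`;
(4) `f` is not minimal. -/
theorem equicontinuous_skew_product
    (α : ℝ) (hα : Irrational α) (g : ℝ → ℝ) (hg : Continuous g)
    (hper : Function.Periodic g 1) (hint : (∫ x in (0 : ℝ)..1, g x) = 0)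
    (f : (AddCircle (1 : ℝ) × AddCircle (1 : ℝ)) ≃ₜ (AddCircle (1 : ℝ) × AddCircle (1 : ℝ)))
    (hf : ∀ x y : ℝ, f ((x : AddCircle (1 : ℝ)), (y : AddCircle (1 : ℝ)))
        = (((x + α : ℝ) : AddCircle (1 : ℝ)), ((y + g x : ℝ) : AddCircle (1 : ℝ))))
    (heq : ∀ ε : ℝ, 0 < ε → ∃ δ : ℝ, 0 < δ ∧
      ∀ p q : AddCircle (1 : ℝ) × AddCircle (1 : ℝ), dist p q < δ →
        ∀ k : ℤ, dist ((f.toEquiv ^ k) p) ((f.toEquiv ^ k) q) < ε) :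
    (∃ B : ℝ, 0 < B ∧ ∀ n : ℕ, ∀ x : ℝ, |∑ j ∈ Finset.range n, g (x + (j : ℝ) * α)| ≤ B) ∧
    (∃ h : ℝ → ℝ, Continuous h ∧ Function.Periodic h 1 ∧
      (∀ x : ℝ, h (x + α) - h x = g x) ∧
      -- the homeomorphism `Φ(x,y) = (x, y + h(x))` satisfies `Φ ∘ R_α = f ∘ Φ`
      (∀ x y : ℝ,
        f ((x : AddCircle (1 : ℝ)), ((y + h x : ℝ) : AddCircle (1 : ℝ)))
          = (((x + α : ℝ) : AddCircle (1 : ℝ)), ((y + h (x + α) : ℝ) : AddCircle (1 : ℝ))))) ∧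
    ¬ (∀ p : AddCircle (1 : ℝ) × AddCircle (1 : ℝ),
        Dense (Set.range fun n : ℤ => (f.toEquiv ^ n) p)) := by
  have H0 : ∀ ε : ℝ, 0 < ε → ∃ δ : ℝ, 0 < δ ∧ ∀ n x t, |t - x| < δ →
      ‖((bSum g α n t - bSum g α n x : ℝ) : AddCircle (1 : ℝ))‖ < ε := by
    intro ε hε
    obtain ⟨δ, hδ, h⟩ := heq ε hε
    refine ⟨δ, hδ, fun n x t ht => ?_⟩
    have h1 := h ((t : AddCircle (1 : ℝ)), ((0 : ℝ) : AddCircle (1 : ℝ)))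
      ((x : AddCircle (1 : ℝ)), ((0 : ℝ) : AddCircle (1 : ℝ))) (by
        rw [Prod.dist_eq, dist_self, max_eq_left dist_nonneg, dist_eq_norm, ← AddCircle.coe_sub]
        exact lt_of_le_of_lt QuotientAddGroup.norm_mk_le_norm ht) n
    rw [zpow_natCast, iter_formula hf, iter_formula hf, Prod.dist_eq] at h1
    have h2 := lt_of_le_of_lt (le_max_right _ _) h1
    simpa only [dist_eq_norm, ← AddCircle.coe_sub, zero_add] using h2
  have H : ∀ ε : ℝ, 0 < ε → ∃ δ : ℝ, 0 < δ ∧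
      ∀ n x t, |t - x| < δ → |bSum g α n t - bSum g α n x| < ε := by
    intro ε hε
    obtain ⟨δ, hδ, h⟩ := H0 (min ε (1 / 4)) (by positivity)
    refine ⟨δ, hδ, fun n x t ht => ?_⟩
    have h1 := lift_small (φ := fun t => bSum g α n t - bSum g α n x) (x := x) (δ := δ)
      ((bSum_cont hg α n).sub continuous_const) (by simp)
      (fun s hs => lt_of_lt_of_le (h n x s hs) (min_le_right _ _)) t ht
    have h2 := lt_of_lt_of_le (h n x t ht) (min_le_left _ _)
    rwa [circ_norm_small (by linarith)] at h2
  obtain ⟨δ, hδ, h4⟩ := H (1 / 4) (by norm_num)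
  obtain ⟨B, hB0, hB⟩ := bSum_bound hg hper hint α δ hδ h4
  obtain ⟨h, hc, hp, hh⟩ := exists_cob hper α H B hB
  refine ⟨⟨B, hB0, hB⟩, ⟨h, hc, hp, hh, fun x y => ?_⟩, not_min hf hc hp hh⟩
  rw [hf, ← hh x]
  ring_nf
end

section
/- Let f be a homeomorphism of a compact metric space (X,d). Suppose there exist points x₁, x₂ ∈ X, a real number ε > 0, and an integer L ≥ 1 such that: (i) the sets f^n(B(x₁,2ε)), n ∈ ℤ, are pairwise disjoint; (ii) the sets f^n(B(x₂,2ε)), n ∈ ℤ, are pairwise disjoint; (iii) B(x₁,2ε) ∩ B(x₂,2ε) = ∅; (iv) for every integer ℓ ≥ L there exists a point z_ℓ ∈ B(x₁,ε) with f^ℓ(z_ℓ) ∈ B(x₂,ε). Then hpol(f) ≥ 2. (This is the metric content of the statement: a homeomorphism with a wandering saddle configuration — a saddle fixed point x together with disjoint wandering open sets U₁ meeting the stable manifold of x and U₂ meeting the unstable manifold of x — has polynomial entropy at least 2.) -/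
open Filter Topology Metric
open scoped ENNReal

variable {X : Type*}

theorem wand_aux [MetricSpace X] (f : X ≃ₜ X) (B : Set X)
    (h : ∀ m n : ℤ, m ≠ n → Disjoint ((f.toEquiv ^ m) '' B) ((f.toEquiv ^ n) '' B))
    (s : X) (j k : ℕ) (hj : (⇑f)^[j] s ∈ B) (hk : (⇑f)^[k] s ∈ B) : j = k := by
  by_contra hne
  have key : ∀ i : ℕ, (⇑f)^[i] s ∈ B → s ∈ (f.toEquiv ^ (-(i : ℤ))) '' B := by
    intro i hi
    refine ⟨_, hi, ?_⟩
    have e : (⇑f)^[i] s = (f.toEquiv ^ (i : ℤ)) s := by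
      rw [zpow_natCast, Equiv.Perm.coe_pow]; rfl
    rw [e, ← Equiv.Perm.mul_apply, ← zpow_add]
    simp
  have hd := h (-(j : ℤ)) (-(k : ℤ)) (by omega)
  exact Set.disjoint_left.mp hd (key j hj) (key k hk)

theorem cov_nonempty_aux [MetricSpace X] [CompactSpace X] (f : X → X) (hf : Continuous f)
    (ε : ℝ) (hε : 0 < ε) (n : ℕ) :
    ∃ S : Finset X, ∀ x : X, ∃ s ∈ S, ∀ j < n, dist (f^[j] x) (f^[j] s) < ε := by
  let U : X → Set X := fun s => ⋂ j ∈ Finset.range n, {x | dist (f^[j] x) (f^[j] s) < ε}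
  have hU : ∀ s, IsOpen (U s) := by
    intro s
    refine isOpen_biInter_finset ?_
    intro j _
    exact isOpen_lt ((hf.iterate j).dist continuous_const) continuous_const
  obtain ⟨S, hS⟩ := isCompact_univ.elim_finite_subcover U hU (by
    intro x _
    refine Set.mem_iUnion.mpr ⟨x, ?_⟩
    simp [U, hε])
  refine ⟨S, fun x => ?_⟩
  have := hS (Set.mem_univ x)
  simpa [U] using this

theorem cov_lower_aux [MetricSpace X] [CompactSpace X]
    (f : X ≃ₜ X) (x₁ x₂ : X) (ε : ℝ) (hε : 0 < ε) (L : ℕ)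
    (h₁ : ∀ m n : ℤ, m ≠ n →
      Disjoint ((f.toEquiv ^ m) '' Metric.ball x₁ (2 * ε))
        ((f.toEquiv ^ n) '' Metric.ball x₁ (2 * ε)))
    (h₂ : ∀ m n : ℤ, m ≠ n →
      Disjoint ((f.toEquiv ^ m) '' Metric.ball x₂ (2 * ε))
        ((f.toEquiv ^ n) '' Metric.ball x₂ (2 * ε)))
    (h₄ : ∀ ℓ : ℕ, L ≤ ℓ → ∃ z ∈ Metric.ball x₁ ε, (⇑f)^[ℓ] z ∈ Metric.ball x₂ ε)
    (n M : ℕ) (hM : 2 * M + L ≤ n) : M * M ≤ covNum (⇑f) ε n := by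
  have hne : {m : ℕ | ∃ S : Finset X, S.card = m ∧
      ∀ x : X, ∃ s ∈ S, ∀ j < n, dist ((⇑f)^[j] x) ((⇑f)^[j] s) < ε}.Nonempty := by
    obtain ⟨S, hS⟩ := cov_nonempty_aux (⇑f) f.continuous ε hε n
    exact ⟨_, S, rfl, hS⟩
  obtain ⟨S, hcard, hS⟩ := Nat.sInf_mem hne
  change S.card = covNum (⇑f) ε n at hcard
  rw [← hcard]
  have hw : ∀ k i : ℕ, ∃ w : X, (⇑f)^[k] w ∈ Metric.ball x₁ ε ∧
      (⇑f)^[k + (L + i)] w ∈ Metric.ball x₂ ε := by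
    intro k i
    obtain ⟨z, hz1, hz2⟩ := h₄ (L + i) (by omega)
    obtain ⟨w, rfl⟩ := (f.surjective.iterate k) z
    refine ⟨w, hz1, ?_⟩
    rwa [add_comm, Function.iterate_add_apply]
  choose w hw1 hw2 using hw
  choose g hgS hg using hS
  have hc : (Finset.range M ×ˢ Finset.range M).card ≤ S.card := by
    apply Finset.card_le_card_of_injOn (fun p => g (w p.1 p.2)) (fun p _ => hgS _)
    have tri : ∀ (c : X) (x y : X), x ∈ Metric.ball c ε → dist x y < ε →
        y ∈ Metric.ball c (2 * ε) := by
      intro c x y hx hxy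
      rw [Metric.mem_ball] at *
      have := dist_triangle_left y c x
      linarith
    rintro ⟨k, i⟩ hp ⟨k', i'⟩ hp' heq
    simp only [Finset.coe_product, Finset.coe_range, Set.mem_prod, Set.mem_Iio] at hp hp' heq
    have a1 := tri _ _ _ (hw1 k i) (hg (w k i) k (by omega))
    have a2 := tri _ _ _ (hw1 k' i') (hg (w k' i') k' (by omega))
    have b1 := tri _ _ _ (hw2 k i) (hg (w k i) (k + (L + i)) (by omega))
    have b2 := tri _ _ _ (hw2 k' i') (hg (w k' i') (k' + (L + i')) (by omega))
    rw [← heq] at a2 b2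
    have e1 := wand_aux f _ h₁ _ _ _ a1 a2
    have e2 := wand_aux f _ h₂ _ _ _ b1 b2
    ext <;> simp <;> omega
  simpa using hc

/-- Metric content of the "wandering saddle configuration": if a homeomorphism `f` of a
compact metric space admits points `x₁, x₂`, a radius `ε > 0` and an integer `L ≥ 1` such
that the balls `B(x₁,2ε)` and `B(x₂,2ε)` are disjoint and wandering (their images under
the iterates `f^n`, `n ∈ ℤ`, are pairwise disjoint), and for every `ℓ ≥ L` some point of
`B(x₁,ε)` lands in `B(x₂,ε)` at time `ℓ`, then `hpol f ≥ 2`. -/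
theorem two_le_hpol_of_wandering_saddle_configuration [MetricSpace X] [CompactSpace X]
    (f : X ≃ₜ X) (x₁ x₂ : X) (ε : ℝ) (hε : 0 < ε) (L : ℕ) (hL : 1 ≤ L)
    (h₁ : ∀ m n : ℤ, m ≠ n →
      Disjoint ((f.toEquiv ^ m) '' Metric.ball x₁ (2 * ε))
        ((f.toEquiv ^ n) '' Metric.ball x₁ (2 * ε)))
    (h₂ : ∀ m n : ℤ, m ≠ n →
      Disjoint ((f.toEquiv ^ m) '' Metric.ball x₂ (2 * ε))
        ((f.toEquiv ^ n) '' Metric.ball x₂ (2 * ε)))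
    (h₃ : Disjoint (Metric.ball x₁ (2 * ε)) (Metric.ball x₂ (2 * ε)))
    (h₄ : ∀ ℓ : ℕ, L ≤ ℓ → ∃ z ∈ Metric.ball x₁ ε, (⇑f)^[ℓ] z ∈ Metric.ball x₂ ε) :
    2 ≤ hpol (⇑f) := by
  refine le_trans ?_ (le_iSup₂ (f := fun (ε : ℝ) (_ : 0 < ε) =>
    Filter.atTop.limsup fun n : ℕ =>
      ENNReal.ofReal (Real.log (covNum (⇑f) ε n) / Real.log n)) ε hε)
  have hlog : Tendsto (fun n : ℕ => Real.log (n : ℝ)) atTop atTop :=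
    Real.tendsto_log_atTop.comp tendsto_natCast_atTop_atTop
  have hlim : Tendsto (fun n : ℕ => ENNReal.ofReal (2 - 2 * Real.log 4 / Real.log (n : ℝ)))
      atTop (𝓝 2) := by
    have h := (tendsto_const_nhds (x := (2 : ℝ))).sub
      ((tendsto_const_nhds (x := 2 * Real.log 4)).div_atTop hlog)
    have h' := ENNReal.tendsto_ofReal h
    simpa using h'
  rw [← hlim.limsup_eq]
  refine limsup_le_limsup ?_
  filter_upwards [eventually_ge_atTop (2 * L + 2)] with n hn
  apply ENNReal.ofReal_le_ofReal
  have hc := cov_lower_aux f x₁ x₂ ε hε L h₁ h₂ h₄ n ((n - L) / 2) (by omega)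
  have hM : n ≤ 4 * ((n - L) / 2) := by omega
  have hn1 : (1 : ℝ) < n := by
    have : 1 < n := by omega
    exact_mod_cast this
  have hl : 0 < Real.log (n : ℝ) := Real.log_pos hn1
  have hc' : ((n : ℝ) / 4) ^ 2 ≤ covNum (⇑f) ε n := by
    have hMr : (n : ℝ) / 4 ≤ (((n - L) / 2 : ℕ) : ℝ) := by
      have : (n : ℝ) ≤ 4 * (((n - L) / 2 : ℕ) : ℝ) := by exact_mod_cast hM
      linarith
    calc ((n : ℝ) / 4) ^ 2 ≤ (((n - L) / 2 : ℕ) : ℝ) ^ 2 := by gcongr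
      _ ≤ (covNum (⇑f) ε n : ℝ) := by rw [sq]; exact_mod_cast hc
  have hle := Real.log_le_log (by positivity) hc'
  rw [Real.log_pow, Real.log_div (by positivity) (by norm_num)] at hle
  rw [le_div_iff₀ hl, sub_mul, div_mul_cancel₀ _ hl.ne']
  push_cast at hle
  linarith
end

section
/- Let g be an element of PGL₂(ℂ), acting on the complex projective line ℙ¹(ℂ), and let d be any metric on ℙ¹(ℂ) inducing its topology. If g is represented by a matrix of GL₂(ℂ) that is conjugate to a unitary matrix (i.e. g is conjugate in PGL₂(ℂ) to an element of PU₂(ℂ)), then hpol(g) = 0; otherwise hpol(g) = 1. In particular hpol(g) ∈ {0,1} for every g ∈ PGL₂(ℂ). -/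
open Filter Topology Metric
open scoped ENNReal

variable {X : Type*}

/-- The complex projective space `ℙ^{n-1}(ℂ) = P(ℂ^n)`, i.e. the projectivization of
`ℂ^n`, carries the quotient topology (of the subspace `ℂ^n \ {0}`). -/
noncomputable instance (n : ℕ) : TopologicalSpace (Projectivization ℂ (Fin n → ℂ)) :=
  instTopologicalSpaceQuotient

open Classical in
/-- The projective transformation of `P(ℂ^n)` induced by a matrix `A` (through the
linear map `y ↦ A.mulVec y`); it is the identity if `A` is not injective (in all uses
below, `A` is invertible). -/
noncomputable def projAction {n : ℕ} (A : Matrix (Fin n) (Fin n) ℂ) :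
    Projectivization ℂ (Fin n → ℂ) → Projectivization ℂ (Fin n → ℂ) :=
  if h : Function.Injective (Matrix.toLin' A) then Projectivization.map (Matrix.toLin' A) h
  else id

/-- An element of `PGL_n(ℂ)` represented by the invertible matrix `A` is conjugate (in
`PGL_n(ℂ)`) to an element of `PU_n(ℂ)` iff some representative `c • A` (`c ≠ 0`) of its
class is conjugate in `GL_n(ℂ)` to a unitary matrix. -/
def IsProjectivelyUnitary {n : ℕ} (A : Matrix (Fin n) (Fin n) ℂ) : Prop :=
  ∃ c : ℂ, c ≠ 0 ∧ ∃ C : Matrix (Fin n) (Fin n) ℂ, C.det ≠ 0 ∧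
    C⁻¹ * (c • A) * C ∈ Matrix.unitaryGroup (Fin n) ℂ


theorem covNum_le_of_finset [PseudoMetricSpace X] (f : X → X) (ε : ℝ) (n : ℕ) (S : Finset X)
    (hS : ∀ x : X, ∃ s ∈ S, ∀ j < n, dist (f^[j] x) (f^[j] s) < ε) : covNum f ε n ≤ S.card :=
  Nat.sInf_le ⟨S, rfl, hS⟩

theorem covNum_le_of_code [PseudoMetricSpace X] (f : X → X) (ε : ℝ) (n : ℕ) {ι : Type*} [Fintype ι]
    (c : X → ι) (hc : ∀ x y, c x = c y → ∀ j < n, dist (f^[j] x) (f^[j] y) < ε) :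
    covNum f ε n ≤ Fintype.card ι := by
  classical
  let r : Set.range c → X := fun i => i.2.choose
  have hr : ∀ i, c (r i) = i := fun i => i.2.choose_spec
  refine (covNum_le_of_finset f ε n (Finset.univ.image r) ?_).trans ?_
  · intro x
    refine ⟨r ⟨c x, x, rfl⟩, by simp, hc _ _ ?_⟩
    rw [hr]
  · refine Finset.card_image_le.trans ?_
    rw [Finset.card_univ]
    exact Fintype.card_le_of_injective _ Subtype.val_injective

theorem exists_cover [PseudoMetricSpace X] [CompactSpace X] (f : X → X) (hf : Continuous f)
    (ε : ℝ) (hε : 0 < ε) (n : ℕ) :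
    ∃ S : Finset X, ∀ x : X, ∃ s ∈ S, ∀ j < n, dist (f^[j] x) (f^[j] s) < ε := by
  obtain ⟨t, ht⟩ := CompactSpace.elim_nhds_subcover
    (fun s : X => {x : X | ∀ j < n, dist (f^[j] x) (f^[j] s) < ε}) (by
      intro s
      have : ∀ᶠ x in 𝓝 s, ∀ j ∈ Set.Iio n, dist (f^[j] x) (f^[j] s) < ε := by
        rw [Filter.eventually_all_finite (Set.finite_Iio n)]
        intro j _
        have h1 : Continuous fun x => dist (f^[j] x) (f^[j] s) :=
          (hf.iterate j).dist continuous_const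
        exact h1.continuousAt.eventually_lt continuousAt_const (by simpa using hε)
      exact this)
  refine ⟨t, fun x => ?_⟩
  have hx : x ∈ (⊤ : Set X) := trivial
  rw [← ht] at hx
  simpa using hx

theorem tendsto_aux (K : ℝ) (a : ℝ) :
    Tendsto (fun n : ℕ => ENNReal.ofReal (K / Real.log n + a)) atTop (𝓝 (ENNReal.ofReal a)) := by
  apply ENNReal.tendsto_ofReal
  have h : Tendsto (fun n : ℕ => K / Real.log n) atTop (𝓝 0) :=
    Tendsto.const_div_atTop (Real.tendsto_log_atTop.comp tendsto_natCast_atTop_atTop) K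
  simpa using h.add_const a

theorem hpol_le_one_of [PseudoMetricSpace X] (f : X → X)
    (h : ∀ ε > 0, ∃ K : ℕ, ∀ n ≥ 1, covNum f ε n ≤ K * n) : hpol f ≤ 1 := by
  refine iSup₂_le fun ε hε => ?_
  obtain ⟨K, hK⟩ := h ε hε
  have ht := tendsto_aux (Real.log K) 1
  rw [ENNReal.ofReal_one] at ht
  rw [← ht.limsup_eq]
  apply limsup_le_limsup
  · filter_upwards [eventually_ge_atTop 2] with n hn
    apply ENNReal.ofReal_le_ofReal
    have hn' : (2 : ℝ) ≤ n := by exact_mod_cast hn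
    have hl : 0 < Real.log n := Real.log_pos (by linarith)
    rw [div_add_one hl.ne']
    gcongr
    have h1 := hK n (by omega)
    rcases Nat.eq_zero_or_pos (covNum f ε n) with h0 | h0
    · rw [h0]
      have := Real.log_natCast_nonneg K
      simp; linarith
    · have hKpos : 0 < K := by
        rcases Nat.eq_zero_or_pos K with h2 | h2
        · subst h2; omega
        · exact h2
      rw [← Real.log_mul (by positivity) (by positivity)]
      apply Real.log_le_log (by exact_mod_cast h0)
      exact_mod_cast h1
  all_goals isBoundedDefault

theorem hpol_eq_zero_of [PseudoMetricSpace X] (f : X → X)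
    (h : ∀ ε > 0, ∃ K : ℕ, ∀ n, covNum f ε n ≤ K) : hpol f = 0 := by
  refine le_antisymm (iSup₂_le fun ε hε => ?_) zero_le
  obtain ⟨K, hK⟩ := h ε hε
  have ht := tendsto_aux (Real.log K) 0
  rw [ENNReal.ofReal_zero] at ht
  rw [← ht.limsup_eq]
  apply limsup_le_limsup
  · filter_upwards with n
    apply ENNReal.ofReal_le_ofReal
    have hl : 0 ≤ Real.log n := Real.log_natCast_nonneg n
    rw [add_zero]
    refine div_le_div_of_nonneg_right ?_ hl
    rcases Nat.eq_zero_or_pos (covNum f ε n) with h0 | h0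
    · rw [h0]
      have := Real.log_natCast_nonneg K
      simp; linarith
    · apply Real.log_le_log (by exact_mod_cast h0)
      exact_mod_cast hK n
  all_goals isBoundedDefault

theorem one_le_hpol_of [PseudoMetricSpace X] (f : X → X) (ε : ℝ) (hε : 0 < ε)
    (h : ∀ n, n ≤ covNum f ε n) : 1 ≤ hpol f := by
  refine le_trans ?_ (le_iSup₂ (f := fun (ε : ℝ) (_ : 0 < ε) => Filter.atTop.limsup fun n : ℕ =>
      ENNReal.ofReal (Real.log (covNum f ε n) / Real.log n)) ε hε)
  apply le_limsup_of_frequently_le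
  · apply Eventually.frequently
    filter_upwards [eventually_ge_atTop 2] with n hn
    have hn' : (2 : ℝ) ≤ n := by exact_mod_cast hn
    have hl : 0 < Real.log n := Real.log_pos (by linarith)
    rw [← ENNReal.ofReal_one]
    apply ENNReal.ofReal_le_ofReal
    rw [one_le_div hl]
    apply Real.log_le_log (by linarith)
    exact_mod_cast h n
  all_goals isBoundedDefault

/-- north-south dynamics gives the upper bound -/
theorem hpol_le_one [t : TopologicalSpace X] [CompactSpace X] (dm : MetricSpace X)
    (hdm : dm.toUniformSpace.toTopologicalSpace = t) (f : X → X) (hf : Continuous f) (p q : X)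
    (h : ∀ U ∈ 𝓝 p, ∀ V ∈ 𝓝 q, ∃ N : ℕ, ∀ j ≥ N, ∀ x ∉ V, f^[j] x ∈ U) :
    @hpol _ dm.toPseudoMetricSpace f ≤ 1 := by
  subst hdm
  apply hpol_le_one_of
  intro ε hε
  obtain ⟨N, hN⟩ := h (ball p (ε/2)) (ball_mem_nhds _ (by linarith)) (ball q (ε/2))
    (ball_mem_nhds _ (by linarith))
  obtain ⟨S, hS⟩ := exists_cover f hf (ε/2) (by linarith) N
  choose c hcS hc using hS
  refine ⟨2 * S.card, fun n hn => ?_⟩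
  classical
  have hex : ∀ x : X, ∃ k, k = n ∨ f^[k] x ∉ ball q (ε/2) := fun x => ⟨n, Or.inl rfl⟩
  let k : X → ℕ := fun x => Nat.find (hex x)
  have hk : ∀ x, k x ≤ n := fun x => Nat.find_min' _ (Or.inl rfl)
  have hk2 : ∀ x, k x < n → f^[k x] x ∉ ball q (ε/2) := fun x hx =>
    (Nat.find_spec (hex x)).resolve_left hx.ne
  have hk3 : ∀ x, ∀ j < k x, f^[j] x ∈ ball q (ε/2) := fun x j hj => by
    have := Nat.find_min (hex x) hj
    push Not at this
    exact this.2
  have key := covNum_le_of_code f ε n (ι := Fin (n+1) × S)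
    (fun x => (⟨k x, Nat.lt_succ_of_le (hk x)⟩, ⟨c (f^[k x] x), hcS _⟩)) (by
      intro x y hxy j hj
      simp only [Prod.mk.injEq, Fin.mk.injEq, Subtype.mk.injEq] at hxy
      obtain ⟨h1, h2⟩ := hxy
      rcases lt_or_ge j (k x) with hjk | hjk
      · have a := hk3 x j hjk
        have b := hk3 y j (h1 ▸ hjk)
        rw [mem_ball] at a b
        have := dist_triangle_right (f^[j] x) (f^[j] y) q
        linarith
      · obtain ⟨i, rfl⟩ := Nat.exists_eq_add_of_le' hjk
        have hkn : k x < n := by omega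
        have e : f^[i + k x] y = f^[i] (f^[k y] y) := by
          rw [Function.iterate_add_apply, h1]
        rw [e, Function.iterate_add_apply]
        rcases lt_or_ge i N with hi | hi
        · have a := hc (f^[k x] x) i hi
          have b := hc (f^[k y] y) i hi
          rw [← h2] at b
          have := dist_triangle_right (f^[i] (f^[k x] x)) (f^[i] (f^[k y] y)) (f^[i] (c (f^[k x] x)))
          linarith
        · have a := hN i hi _ (hk2 x hkn)
          have b := hN i hi _ (hk2 y (h1 ▸ hkn))
          rw [mem_ball] at a b
          have := dist_triangle_right (f^[i] (f^[k x] x)) (f^[i] (f^[k y] y)) p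
          linarith)
  simp only [Fintype.card_prod, Fintype.card_fin, Fintype.card_coe] at key
  refine key.trans ?_
  nlinarith [Nat.zero_le S.card]

theorem one_le_hpol [t : TopologicalSpace X] [CompactSpace X] (dm : MetricSpace X)
    (hdm : dm.toUniformSpace.toTopologicalSpace = t) (f : X → X) (hf : Continuous f)
    (hinj : Function.Injective f) (y : ℕ → X) (hy : ∀ k, f (y (k+1)) = y k) (p : X)
    (hp : Tendsto y atTop (𝓝 p)) (hne : y 0 ≠ p) :
    1 ≤ @hpol _ dm.toPseudoMetricSpace f := by
  subst hdm
  have hit : ∀ k l, f^[k] (y (l + k)) = y l := by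
    intro k
    induction k with
    | zero => intro l; rfl
    | succ k ih => intro l; rw [Function.iterate_succ_apply, ← add_assoc, hy, ih]
  have hit0 : ∀ k, f^[k] (y k) = y 0 := fun k => by simpa using hit k 0
  have hnot : ∀ m, y (m+1) ≠ y 0 := by
    intro m hm
    have hfix : ∀ i, y (i * (m+1)) = y 0 := by
      intro i
      apply hinj.iterate (i * (m+1))
      rw [hit0]
      have : Function.IsFixedPt f^[m+1] (y 0) := by
        have := hit0 (m+1)
        rwa [hm] at this
      have := this.iterate i
      rw [← Function.iterate_mul, mul_comm] at this
      exact this.symm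
    have h1 : Tendsto (fun i : ℕ => i * (m+1)) atTop atTop :=
      tendsto_id.atTop_mul_const' (Nat.succ_pos m)
    have h2 := hp.comp h1
    have h3 : (y ∘ fun i : ℕ => i * (m+1)) = fun _ => y 0 := funext hfix
    rw [h3] at h2
    exact hne (tendsto_nhds_unique tendsto_const_nhds h2)
  have hc : IsCompact (insert p (Set.range fun m => y (m+1))) :=
    (hp.comp (tendsto_add_atTop_nat 1)).isCompact_insert_range
  have h0 : y 0 ∈ (insert p (Set.range fun m => y (m+1)))ᶜ := by
    rintro (h | ⟨m, h⟩)
    · exact hne h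
    · exact hnot m h
  obtain ⟨ε, hε, hb⟩ := Metric.isOpen_iff.1 hc.isClosed.isOpen_compl _ h0
  have hsep : ∀ m, ε ≤ dist (y (m+1)) (y 0) := by
    intro m
    by_contra! hlt
    exact hb (mem_ball.2 hlt) (Or.inr ⟨m, rfl⟩)
  refine one_le_hpol_of f (ε/2) (by linarith) fun n => ?_
  refine le_csInf ?_ ?_
  · obtain ⟨S, hS⟩ := exists_cover f hf (ε/2) (by linarith) n
    exact ⟨_, S, rfl, hS⟩
  · rintro _ ⟨S, rfl, hS⟩
    choose c hcS hc using hS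
    have key : ∀ k l, k < l → l < n → c (y k) ≠ c (y l) := by
      intro k l hkl hl heq
      have a := hc (y k) k (by omega)
      have b := hc (y l) k (by omega)
      obtain ⟨m, rfl⟩ := Nat.exists_eq_add_of_lt hkl
      have e : k + m + 1 = (m+1) + k := by ring
      rw [← heq, e, hit] at b
      rw [hit0] at a
      have := dist_triangle_right (y (m+1)) (y 0) (f^[k] (c (y k)))
      linarith [hsep m]
    have := Finset.card_le_card_of_injOn (s := Finset.range n) (t := S) (fun k => c (y k))
      (fun k _ => hcS _) (by
        intro k hk l hl he
        simp only [Finset.coe_range, Set.mem_Iio] at hk hl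
        rcases lt_trichotomy k l with h | h | h
        · exact absurd he (key k l h hl)
        · exact h
        · exact absurd he.symm (key l k h hk))
    simpa using this

theorem hpol_eq_zero [t : TopologicalSpace X] [CompactSpace X] (dm : MetricSpace X)
    (hdm : dm.toUniformSpace.toTopologicalSpace = t) (f : X → X)
    (τ : X → X → ℝ) (hτ : Continuous (Function.uncurry τ)) (h0 : ∀ x, τ x x = 0)
    (hpos : ∀ x y, x ≠ y → 0 < τ x y) (hinv : ∀ x y, τ (f x) (f y) = τ x y) :
    @hpol _ dm.toPseudoMetricSpace f = 0 := by
  subst hdm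
  apply hpol_eq_zero_of
  intro ε hε
  have hδ : ∃ δ > 0, ∀ x y, τ x y < δ → dist x y < ε := by
    have hK : IsCompact {z : X × X | ε ≤ dist z.1 z.2} :=
      (isClosed_le continuous_const (continuous_fst.dist continuous_snd)).isCompact
    rcases Set.eq_empty_or_nonempty {z : X × X | ε ≤ dist z.1 z.2} with he | hne
    · refine ⟨1, one_pos, fun x y _ => ?_⟩
      by_contra! hh
      have : (x, y) ∈ {z : X × X | ε ≤ dist z.1 z.2} := hh
      rw [he] at this
      exact this
    · obtain ⟨z, hz, hmin⟩ := hK.exists_isMinOn hne hτ.continuousOn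
      refine ⟨τ z.1 z.2, hpos _ _ ?_, fun x y hxy => ?_⟩
      · intro h
        have : ε ≤ dist z.1 z.2 := hz
        rw [h, dist_self] at this
        linarith
      · by_contra! hh
        have : τ z.1 z.2 ≤ τ x y := hmin (a := (x, y)) hh
        linarith
  obtain ⟨δ, hδ, hd⟩ := hδ
  have hinvj : ∀ j x y, τ (f^[j] x) (f^[j] y) = τ x y := by
    intro j
    induction j with
    | zero => intro x y; rfl
    | succ j ih => intro x y; rw [Function.iterate_succ_apply, Function.iterate_succ_apply, ih, hinv]
  obtain ⟨t, ht⟩ := CompactSpace.elim_nhds_subcover (fun s : X => {x : X | τ x s < δ}) (by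
      intro s
      have h1 : Continuous fun x => τ x s := hτ.comp (continuous_id.prodMk continuous_const)
      exact h1.continuousAt.eventually_lt continuousAt_const (by simpa [h0] using hδ))
  refine ⟨t.card, fun n => covNum_le_of_finset _ _ _ t fun x => ?_⟩
  have hx : x ∈ (⊤ : Set X) := trivial
  rw [← ht] at hx
  simp only [Set.mem_iUnion, Set.mem_ofPred_eq] at hx
  obtain ⟨s, hs, hxs⟩ := hx
  exact ⟨s, hs, fun j _ => hd _ _ (by rwa [hinvj])⟩


abbrev P1 := Projectivization ℂ (Fin 2 → ℂ)

noncomputable def P1mk (v : {v : Fin 2 → ℂ // v ≠ 0}) : P1 := Projectivization.mk ℂ v.1 v.2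

noncomputable def wdg (x y : Fin 2 → ℂ) : ℂ := x 0 * y 1 - x 1 * y 0

theorem wdg_smul (a b : ℂ) (x y : Fin 2 → ℂ) : wdg (a • x) (b • y) = a * b * wdg x y := by
  simp [wdg]; ring

theorem wdg_mulVec (A : Matrix (Fin 2) (Fin 2) ℂ) (x y : Fin 2 → ℂ) :
    wdg (A.mulVec x) (A.mulVec y) = A.det * wdg x y := by
  simp [wdg, Matrix.det_fin_two, Matrix.mulVec, dotProduct, Fin.sum_univ_two]; ring

theorem P1mk_eq_iff (x y : {v : Fin 2 → ℂ // v ≠ 0}) : P1mk x = P1mk y ↔ wdg x.1 y.1 = 0 := by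
  unfold P1mk
  rw [Projectivization.mk_eq_mk_iff']
  constructor
  · rintro ⟨a, ha⟩
    rw [← ha]; simp [wdg]; ring
  · intro h
    unfold wdg at h
    obtain ⟨x, hx⟩ := x
    obtain ⟨y, hy⟩ := y
    simp only at h ⊢
    by_cases h0 : y 0 = 0
    · have h1 : y 1 ≠ 0 := by
        intro h1; apply hy; ext i; fin_cases i <;> simp [h0, h1]
      refine ⟨x 1 / y 1, ?_⟩
      ext i; fin_cases i
      · simp [h0] at h ⊢; tauto
      · simp; field_simp
    · refine ⟨x 0 / y 0, ?_⟩
      ext i; fin_cases i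
      · simp; field_simp
      · simp; field_simp; linear_combination h

theorem P1mk_surj : Function.Surjective P1mk := by
  intro x
  exact ⟨⟨x.rep, x.rep_nonzero⟩, x.mk_rep⟩

theorem P1mk_quot : IsQuotientMap P1mk := isQuotientMap_quot_mk

theorem P1mk_open : IsOpenQuotientMap P1mk := by
  refine ⟨P1mk_surj, P1mk_quot.continuous, ?_⟩
  intro W hW
  rw [← P1mk_quot.isOpen_preimage]
  have : P1mk ⁻¹' (P1mk '' W) = ⋃ c : ℂˣ,
      (fun v : {v : Fin 2 → ℂ // v ≠ 0} =>
        (⟨(c : ℂ) • v.1, smul_ne_zero c.ne_zero v.2⟩ : {v : Fin 2 → ℂ // v ≠ 0})) ⁻¹' W := by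
    ext v
    simp only [Set.mem_preimage, Set.mem_image, Set.mem_iUnion]
    constructor
    · rintro ⟨w, hw, h⟩
      unfold P1mk at h
      rw [Projectivization.mk_eq_mk_iff] at h
      obtain ⟨c, hc⟩ := h
      refine ⟨c, ?_⟩
      convert hw
      exact hc
    · rintro ⟨c, hc⟩
      refine ⟨_, hc, ?_⟩
      unfold P1mk
      rw [Projectivization.mk_eq_mk_iff]
      exact ⟨c, rfl⟩
  rw [this]
  refine isOpen_iUnion fun c => hW.preimage ?_
  exact Continuous.subtype_mk ((continuous_subtype_val (p := fun v : Fin 2 → ℂ => v ≠ 0)).const_smul (c : ℂ)) _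

instance P1_compact : CompactSpace P1 := by
  have hs : IsCompact (sphere (0 : Fin 2 → ℂ) 1) := isCompact_sphere _ _
  let g : sphere (0 : Fin 2 → ℂ) 1 → P1 := fun v => P1mk ⟨v.1, by
    intro h; have := v.2; rw [h] at this; simp at this⟩
  have hg : Continuous g := P1mk_open.continuous.comp (Continuous.subtype_mk continuous_subtype_val _)
  have hsurj : Function.Surjective g := by
    intro x
    obtain ⟨v, rfl⟩ := P1mk_surj x
    have hv : ‖v.1‖ ≠ 0 := norm_ne_zero_iff.2 v.2
    refine ⟨⟨((‖v.1‖⁻¹ : ℝ) : ℂ) • v.1, ?_⟩, ?_⟩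
    · rw [mem_sphere_zero_iff_norm, norm_smul]
      simp [hv]
    · rw [P1mk_eq_iff]
      simp [wdg]; ring
  have : CompactSpace (sphere (0 : Fin 2 → ℂ) 1) := isCompact_iff_compactSpace.1 hs
  exact hsurj.compactSpace hg

theorem mulVec_ne {A : Matrix (Fin 2) (Fin 2) ℂ} (hA : A.det ≠ 0) {v : Fin 2 → ℂ} (hv : v ≠ 0) :
    A.mulVec v ≠ 0 := fun h => hv (Matrix.eq_zero_of_mulVec_eq_zero hA h)

theorem projAction_mk {A : Matrix (Fin 2) (Fin 2) ℂ} (hA : A.det ≠ 0)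
    (v : {v : Fin 2 → ℂ // v ≠ 0}) :
    projAction A (P1mk v) = P1mk ⟨A.mulVec v.1, mulVec_ne hA v.2⟩ := by
  have hinj : Function.Injective (Matrix.toLin' A) := by
    rw [injective_iff_map_eq_zero]
    intro x hx
    exact Matrix.eq_zero_of_mulVec_eq_zero hA hx
  unfold projAction
  rw [dif_pos hinj]
  rfl

theorem det_pow_ne {A : Matrix (Fin 2) (Fin 2) ℂ} (hA : A.det ≠ 0) (j : ℕ) : (A ^ j).det ≠ 0 := by
  rw [Matrix.det_pow]; exact pow_ne_zero _ hA

theorem projAction_iter {A : Matrix (Fin 2) (Fin 2) ℂ} (hA : A.det ≠ 0) (j : ℕ)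
    (v : {v : Fin 2 → ℂ // v ≠ 0}) :
    (projAction A)^[j] (P1mk v) = P1mk ⟨(A ^ j).mulVec v.1, mulVec_ne (det_pow_ne hA j) v.2⟩ := by
  induction j with
  | zero => simp
  | succ j ih =>
    rw [Function.iterate_succ_apply', ih, projAction_mk hA]
    congr 2
    rw [pow_succ', Matrix.mulVec_mulVec]

theorem projAction_cont {A : Matrix (Fin 2) (Fin 2) ℂ} (hA : A.det ≠ 0) :
    Continuous (projAction A) := by
  rw [P1mk_quot.continuous_iff]
  have : projAction A ∘ P1mk = P1mk ∘ fun v => ⟨A.mulVec v.1, mulVec_ne hA v.2⟩ :=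
    funext (projAction_mk hA)
  rw [this]
  refine P1mk_quot.continuous.comp (Continuous.subtype_mk ?_ _)
  exact (Continuous.matrix_mulVec continuous_const continuous_subtype_val)

theorem projAction_inj {A : Matrix (Fin 2) (Fin 2) ℂ} (hA : A.det ≠ 0) :
    Function.Injective (projAction A) := by
  intro x y h
  obtain ⟨v, rfl⟩ := P1mk_surj x
  obtain ⟨w, rfl⟩ := P1mk_surj y
  rw [projAction_mk hA, projAction_mk hA, P1mk_eq_iff, wdg_mulVec] at h
  rw [P1mk_eq_iff]
  exact (mul_eq_zero.1 h).resolve_left hA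

/-- a nbhd criterion -/
theorem nhds_crit (g : P1 → ℝ) (hg : Continuous g) (p : P1) (hp : ∀ x, x ≠ p → 0 < g x)
    (U : Set P1) (hU : U ∈ 𝓝 p) : ∃ δ > 0, ∀ x, g x < δ → x ∈ U := by
  have hK : IsCompact (interior U)ᶜ := isOpen_interior.isClosed_compl.isCompact
  rcases Set.eq_empty_or_nonempty (interior U)ᶜ with he | hne
  · refine ⟨1, one_pos, fun x _ => interior_subset ?_⟩
    rw [Set.compl_empty_iff] at he
    rw [he]; trivial
  · obtain ⟨z, hz, hmin⟩ := hK.exists_isMinOn hne hg.continuousOn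
    refine ⟨g z, hp _ ?_, fun x hx => ?_⟩
    · rintro rfl
      exact hz (mem_interior_iff_mem_nhds.2 hU)
    · by_contra hh
      have : g z ≤ g x := hmin (a := x) (fun h => hh (interior_subset h))
      linarith

theorem cont_desc (g : P1 → ℝ) (G : (Fin 2 → ℂ) → ℝ) (hG : Continuous G)
    (h : ∀ v : {v : Fin 2 → ℂ // v ≠ 0}, g (P1mk v) = G v.1 / ‖v.1‖) : Continuous g := by
  rw [P1mk_quot.continuous_iff]
  have : g ∘ P1mk = fun v => G v.1 / ‖v.1‖ := funext h
  rw [this]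
  exact (hG.comp continuous_subtype_val).div continuous_subtype_val.norm
    fun v => norm_ne_zero_iff.2 v.2

theorem exists_desc (G : (Fin 2 → ℂ) → ℝ) (hG : Continuous G)
    (hh : ∀ (c : ℂ) v, G (c • v) = ‖c‖ * G v) : ∃ g : P1 → ℝ, Continuous g ∧
    ∀ v : {v : Fin 2 → ℂ // v ≠ 0}, g (P1mk v) = G v.1 / ‖v.1‖ := by
  have h : ∀ v : {v : Fin 2 → ℂ // v ≠ 0}, 
      (fun x : P1 => G x.rep / ‖x.rep‖) (P1mk v) = G v.1 / ‖v.1‖ := by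
    intro v
    obtain ⟨a, ha⟩ := Projectivization.exists_smul_eq_mk_rep ℂ v.1 v.2
    have e : (P1mk v).rep = (a : ℂ) • v.1 := ha.symm
    have hv : ‖v.1‖ ≠ 0 := norm_ne_zero_iff.2 v.2
    have ha : ‖(a : ℂ)‖ ≠ 0 := norm_ne_zero_iff.2 a.ne_zero
    simp only [e, hh, norm_smul]
    field_simp
  exact ⟨fun x : P1 => G x.rep / ‖x.rep‖, cont_desc _ G hG h, h⟩

/-- `c_j A^j` converges to a rank one matrix. -/
def RankOneLimit (A : Matrix (Fin 2) (Fin 2) ℂ) : Prop :=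
  ∃ (c : ℕ → ℂ) (R : Matrix (Fin 2) (Fin 2) ℂ), R ≠ 0 ∧ R.det = 0 ∧ (∀ᶠ j in atTop, c j ≠ 0) ∧
    Tendsto (fun j => c j • A ^ j) atTop (𝓝 R)

theorem exists_gen (R : Matrix (Fin 2) (Fin 2) ℂ) (hR : R ≠ 0) (hd : R.det = 0) :
    ∃ v : Fin 2 → ℂ, wdg (R.mulVec v) v ≠ 0 := by
  by_contra! h
  have h0 := h ![1, 0]
  have h1 := h ![0, 1]
  have h2 := h ![1, 1]
  simp [wdg, Matrix.mulVec, dotProduct, Fin.sum_univ_two] at h0 h1 h2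
  rw [Matrix.det_fin_two] at hd
  have e : R 0 0 = R 1 1 := by linear_combination h2 + h0 - h1
  have e1 : R 1 1 = 0 := by
    rw [e, h0, h1] at hd; simpa using hd
  apply hR
  ext i j; fin_cases i <;> fin_cases j <;> simp [e, e1, h0, h1]

theorem lower_bound (A : Matrix (Fin 2) (Fin 2) ℂ) (hA : A.det ≠ 0) (h : RankOneLimit A⁻¹) :
    ∃ (y : ℕ → P1) (p : P1), (∀ k, projAction A (y (k+1)) = y k) ∧ Tendsto y atTop (𝓝 p) ∧
      y 0 ≠ p := by
  obtain ⟨c, R, hR, hd, hc, hlim⟩ := h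
  obtain ⟨v, hv⟩ := exists_gen R hR hd
  have hv0 : v ≠ 0 := by rintro rfl; simp [wdg] at hv
  have hRv : R.mulVec v ≠ 0 := by intro h; rw [h] at hv; simp [wdg] at hv
  have hB : (A⁻¹).det ≠ 0 := by
    rw [Matrix.det_nonsing_inv]; simpa using hA
  have hu : IsUnit A.det := isUnit_iff_ne_zero.2 hA
  refine ⟨fun k => P1mk ⟨(A⁻¹ ^ k).mulVec v, mulVec_ne (det_pow_ne hB k) hv0⟩,
    P1mk ⟨R.mulVec v, hRv⟩, ?_, ?_, ?_⟩
  · intro k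
    rw [projAction_mk hA]
    congr 2
    simp only [Matrix.mulVec_mulVec]
    rw [pow_succ', ← mul_assoc, Matrix.mul_nonsing_inv _ hu, one_mul]
  · have hB' : ∀ j, (A⁻¹ ^ j).mulVec v ≠ 0 := fun j => mulVec_ne (det_pow_ne hB j) hv0
    let w : ℕ → {v : Fin 2 → ℂ // v ≠ 0} := fun j =>
      if h : c j ≠ 0 then ⟨c j • (A⁻¹ ^ j).mulVec v, smul_ne_zero h (hB' j)⟩ else ⟨v, hv0⟩
    have hw : Tendsto w atTop (𝓝 ⟨R.mulVec v, hRv⟩) := by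
      rw [tendsto_subtype_rng]
      have h1 : Tendsto (fun j => (c j • A⁻¹ ^ j).mulVec v) atTop (𝓝 (R.mulVec v)) := by
        have : Continuous fun M : Matrix (Fin 2) (Fin 2) ℂ => M.mulVec v :=
          Continuous.matrix_mulVec continuous_id continuous_const
        exact (this.tendsto R).comp hlim
      refine h1.congr' ?_
      filter_upwards [hc] with j hj
      simp only [w, dif_pos hj]
      rw [Matrix.smul_mulVec]
    have := (P1mk_quot.continuous.tendsto _).comp hw
    refine this.congr' ?_
    filter_upwards [hc] with j hj
    simp only [Function.comp, w, dif_pos hj]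
    rw [P1mk_eq_iff]
    simp [wdg]; ring
  · rw [Ne, P1mk_eq_iff]
    simp only [pow_zero, Matrix.one_mulVec]
    intro h
    apply hv
    unfold wdg at h ⊢
    linear_combination -h

theorem mulVec_bound (M : Matrix (Fin 2) (Fin 2) ℂ) (x : Fin 2 → ℂ) :
    ‖M.mulVec x‖ ≤ (‖M 0 0‖ + ‖M 0 1‖ + ‖M 1 0‖ + ‖M 1 1‖) * ‖x‖ := by
  have h0 := norm_le_pi_norm x 0
  have h1 := norm_le_pi_norm x 1
  rw [pi_norm_le_iff_of_nonneg (by positivity)]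
  intro i
  have : ‖M.mulVec x i‖ ≤ ‖M i 0‖ * ‖x‖ + ‖M i 1‖ * ‖x‖ := by
    simp only [Matrix.mulVec, dotProduct, Fin.sum_univ_two]
    refine (norm_add_le _ _).trans ?_
    rw [norm_mul, norm_mul]
    gcongr
  refine this.trans ?_
  have p := norm_nonneg x
  have a := mul_nonneg (norm_nonneg (M 0 0)) p
  have b := mul_nonneg (norm_nonneg (M 0 1)) p
  have c := mul_nonneg (norm_nonneg (M 1 0)) p
  have d := mul_nonneg (norm_nonneg (M 1 1)) p
  fin_cases i <;> simp <;> nlinarith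

theorem wdg_bound (x y : Fin 2 → ℂ) : ‖wdg x y‖ ≤ 2 * ‖x‖ * ‖y‖ := by
  have h0 := norm_le_pi_norm x 0
  have h1 := norm_le_pi_norm x 1
  have k0 := norm_le_pi_norm y 0
  have k1 := norm_le_pi_norm y 1
  unfold wdg
  refine (norm_sub_le _ _).trans ?_
  rw [norm_mul, norm_mul]
  have a : ‖x 0‖ * ‖y 1‖ ≤ ‖x‖ * ‖y‖ := by gcongr
  have b : ‖x 1‖ * ‖y 0‖ ≤ ‖x‖ * ‖y‖ := by gcongr
  linarith

theorem upper_bound (A : Matrix (Fin 2) (Fin 2) ℂ) (hA : A.det ≠ 0) (h : RankOneLimit A) :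
    ∃ p q : P1, ∀ U ∈ 𝓝 p, ∀ V ∈ 𝓝 q, ∃ N : ℕ, ∀ j ≥ N, ∀ x ∉ V, (projAction A)^[j] x ∈ U := by
  obtain ⟨c, R, hR, hd, hc, hlim⟩ := h
  obtain ⟨v, hv⟩ := exists_gen R hR hd
  have hRv : R.mulVec v ≠ 0 := by intro h; rw [h] at hv; simp [wdg] at hv
  obtain ⟨u, hu0, hu⟩ := Matrix.exists_mulVec_eq_zero_iff.2 hd
  refine ⟨P1mk ⟨R.mulVec v, hRv⟩, P1mk ⟨u, hu0⟩, ?_⟩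
  intro U hU V hV
  set p := R.mulVec v with hp
  obtain ⟨g1, hg1, hg1'⟩ := exists_desc (fun x => ‖wdg x p‖) (by unfold wdg; fun_prop) (by
    intro c x
    have := wdg_smul c 1 x p
    rw [one_smul, mul_one] at this
    rw [this, norm_mul])
  obtain ⟨g2, hg2, hg2'⟩ := exists_desc (fun x => ‖R.mulVec x‖)
    (Continuous.matrix_mulVec continuous_const continuous_id).norm (by
      intro c x
      rw [Matrix.mulVec_smul, norm_smul])
  obtain ⟨δ, hδ, hδU⟩ := nhds_crit g1 hg1 (P1mk ⟨p, hRv⟩) (by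
    intro x hx
    obtain ⟨x, rfl⟩ := P1mk_surj x
    rw [Ne, P1mk_eq_iff] at hx
    rw [hg1']
    exact div_pos (norm_pos_iff.2 hx) (norm_pos_iff.2 x.2)) U hU
  obtain ⟨η, hη, hηV⟩ := nhds_crit g2 hg2 (P1mk ⟨u, hu0⟩) (by
    intro x hx
    obtain ⟨x, rfl⟩ := P1mk_surj x
    rw [Ne, P1mk_eq_iff] at hx
    rw [hg2']
    refine div_pos (norm_pos_iff.2 ?_) (norm_pos_iff.2 x.2)
    intro hz
    apply hR
    simp only [wdg] at hx
    have hz' : ∀ i, R i 0 * x.1 0 + R i 1 * x.1 1 = 0 := fun i => by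
      have := congrFun hz i
      simpa [Matrix.mulVec, dotProduct, Fin.sum_univ_two] using this
    have hu' : ∀ i, R i 0 * u 0 + R i 1 * u 1 = 0 := fun i => by
      have := congrFun hu i
      simpa [Matrix.mulVec, dotProduct, Fin.sum_univ_two] using this
    have e0 : ∀ i, R i 0 = 0 := fun i => by
      have : R i 0 * (x.1 0 * u 1 - x.1 1 * u 0) = 0 := by
        linear_combination u 1 * hz' i - x.1 1 * hu' i
      exact (mul_eq_zero.1 this).resolve_right hx
    have e1 : ∀ i, R i 1 = 0 := fun i => by
      have : R i 1 * (x.1 0 * u 1 - x.1 1 * u 0) = 0 := by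
        linear_combination x.1 0 * hu' i - u 0 * hz' i
      exact (mul_eq_zero.1 this).resolve_right hx
    ext i j; fin_cases j
    · exact e0 i
    · exact e1 i) V hV
  let E : Matrix (Fin 2) (Fin 2) ℂ → ℝ := fun M => ‖M 0 0‖ + ‖M 0 1‖ + ‖M 1 0‖ + ‖M 1 1‖
  have hE : Tendsto (fun j => E (c j • A ^ j - R)) atTop (𝓝 0) := by
    have hcont : Continuous fun M => E (M - R) := by
      have : ∀ i j, Continuous fun M : Matrix (Fin 2) (Fin 2) ℂ => (M - R) i j := fun i j =>
        (continuous_id.sub continuous_const).matrix_elem i j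
      exact ((((this 0 0).norm.add (this 0 1).norm).add (this 1 0).norm).add (this 1 1).norm)
    have := (hcont.tendsto R).comp hlim
    have hz : E (R - R) = 0 := by simp [E]
    rw [hz] at this
    exact this
  have hE2 : Tendsto (fun j => 2 * E (c j • A ^ j - R) * ‖p‖ - δ * (η - E (c j • A ^ j - R))) atTop
      (𝓝 (2 * 0 * ‖p‖ - δ * (η - 0))) :=
    ((hE.const_mul 2).mul_const _).sub ((hE.const_sub η).const_mul δ)
  have hneg : 2 * 0 * ‖p‖ - δ * (η - 0) < 0 := by nlinarith [mul_pos hδ hη]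
  obtain ⟨N, hN⟩ := eventually_atTop.1 ((hE2.eventually (gt_mem_nhds hneg)).and hc)
  refine ⟨N, fun j hj x hx => ?_⟩
  obtain ⟨h1, hcj⟩ := hN j hj
  obtain ⟨x, rfl⟩ := P1mk_surj x
  have hx2 : η ≤ g2 (P1mk x) := by
    by_contra! hlt
    exact hx (hηV _ hlt)
  rw [hg2', le_div_iff₀ (norm_pos_iff.2 x.2)] at hx2
  apply hδU
  have hne := mulVec_ne (det_pow_ne hA j) x.2
  have heq : (projAction A)^[j] (P1mk x) = P1mk ⟨c j • (A ^ j).mulVec x.1, smul_ne_zero hcj hne⟩ := by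
    rw [projAction_iter hA, P1mk_eq_iff]
    simp [wdg]; ring
  rw [heq, hg1', div_lt_iff₀ (norm_pos_iff.2 (smul_ne_zero hcj hne))]
  simp only
  rw [← Matrix.smul_mulVec]
  set M := c j • A ^ j
  have hb := mulVec_bound (M - R) x.1
  change _ ≤ E (M - R) * _ at hb
  have hxp := norm_pos_iff.2 x.2
  have hw : wdg (M.mulVec x.1) p = wdg ((M - R).mulVec x.1) p := by
    have h2 : wdg (R.mulVec x.1) p = 0 := by rw [hp, wdg_mulVec, hd, zero_mul]
    rw [Matrix.sub_mulVec]
    unfold wdg at h2 ⊢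
    simp only [Pi.sub_apply]
    linear_combination h2
  have hlow : ‖R.mulVec x.1‖ - ‖(M - R).mulVec x.1‖ ≤ ‖M.mulVec x.1‖ := by
    have : R.mulVec x.1 = M.mulVec x.1 - (M - R).mulVec x.1 := by
      rw [Matrix.sub_mulVec]; abel
    have h3 := norm_sub_le (M.mulVec x.1) ((M - R).mulVec x.1)
    rw [← this] at h3
    linarith
  rw [hw]
  calc _ ≤ 2 * ‖(M - R).mulVec x.1‖ * ‖p‖ := wdg_bound _ _
    _ ≤ 2 * (E (M - R) * ‖x.1‖) * ‖p‖ := by gcongr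
    _ = (2 * E (M - R) * ‖p‖) * ‖x.1‖ := by ring
    _ < (δ * (η - E (M - R))) * ‖x.1‖ := by
      apply mul_lt_mul_of_pos_right _ hxp
      linarith
    _ = δ * (η * ‖x.1‖ - E (M - R) * ‖x.1‖) := by ring
    _ ≤ δ * ‖M.mulVec x.1‖ := by
      apply mul_le_mul_of_nonneg_left _ hδ.le
      linarith


theorem hpol_eq_one_of (A : Matrix (Fin 2) (Fin 2) ℂ) (hA : A.det ≠ 0) (h : RankOneLimit A)
    (h' : RankOneLimit A⁻¹) (dm : MetricSpace (Projectivization ℂ (Fin 2 → ℂ)))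
    (hdm : dm.toUniformSpace.toTopologicalSpace =
      inferInstanceAs (TopologicalSpace (Projectivization ℂ (Fin 2 → ℂ)))) :
    @hpol _ dm.toPseudoMetricSpace (projAction A) = 1 := by
  obtain ⟨p, q, hpq⟩ := upper_bound A hA h
  obtain ⟨y, r, h1, h2, h3⟩ := lower_bound A hA h'
  apply le_antisymm
  · exact @hpol_le_one _ _ P1_compact dm hdm _ (projAction_cont hA) p q hpq
  · exact @one_le_hpol _ _ P1_compact dm hdm _ (projAction_cont hA) (projAction_inj hA) y h1 r h2 h3

/-- invariant function -/
theorem exists_tau (A C : Matrix (Fin 2) (Fin 2) ℂ) (hA : A.det ≠ 0) (c : ℂ) (hc : c ≠ 0)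
    (hC : C.det ≠ 0) (hU : C⁻¹ * (c • A) * C ∈ Matrix.unitaryGroup (Fin 2) ℂ) :
    ∃ τ : P1 → P1 → ℝ, Continuous (Function.uncurry τ) ∧ (∀ x, τ x x = 0) ∧
      (∀ x y, x ≠ y → 0 < τ x y) ∧ (∀ x y, τ (projAction A x) (projAction A y) = τ x y) := by
  have hCu : IsUnit C.det := isUnit_iff_ne_zero.2 hC
  set U := C⁻¹ * (c • A) * C with hUdef
  let N : (Fin 2 → ℂ) → ℝ := fun x => ‖WithLp.toLp 2 (C⁻¹.mulVec x)‖
  have hNc : Continuous N := by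
    have : Continuous fun x : Fin 2 → ℂ => C⁻¹.mulVec x :=
      Continuous.matrix_mulVec continuous_const continuous_id
    exact ((PiLp.continuous_toLp 2 _).comp this).norm
  have hNs : ∀ (a : ℂ) x, N (a • x) = ‖a‖ * N x := by
    intro a x
    simp only [N, Matrix.mulVec_smul, WithLp.toLp_smul, norm_smul]
  have hNp : ∀ x, x ≠ 0 → 0 < N x := by
    intro x hx
    apply norm_pos_iff.2
    have : C⁻¹.mulVec x ≠ 0 := mulVec_ne (by rw [Matrix.det_nonsing_inv]; simpa using hC) hx
    simpa using this
  have hNU : ∀ z : Fin 2 → ℂ, ‖WithLp.toLp 2 (U.mulVec z)‖ = ‖WithLp.toLp 2 z‖ := by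
    intro z
    have h1 := Matrix.mem_unitaryGroup_iff'.1 hU
    have h2 : star (U.mulVec z) ⬝ᵥ (U.mulVec z) = star z ⬝ᵥ z := by
      rw [Matrix.star_mulVec, ← Matrix.dotProduct_mulVec, Matrix.mulVec_mulVec]
      rw [Matrix.star_eq_conjTranspose] at h1
      rw [h1, Matrix.one_mulVec]
    have h3 : ∀ z : Fin 2 → ℂ, ((‖WithLp.toLp 2 z‖ ^ 2 : ℝ) : ℂ) = star z ⬝ᵥ z := by
      intro z
      rw [EuclideanSpace.norm_sq_eq]
      simp [dotProduct, Complex.conj_mul']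
    have h4 : ‖WithLp.toLp 2 (U.mulVec z)‖ ^ 2 = ‖WithLp.toLp 2 z‖ ^ 2 := by
      have := (h3 (U.mulVec z)).trans (h2.trans (h3 z).symm)
      exact_mod_cast this
    exact (sq_eq_sq₀ (norm_nonneg _) (norm_nonneg _)).1 h4
  have hNA : ∀ x, ‖c‖ * N (A.mulVec x) = N x := by
    intro x
    rw [← hNs]
    have e : C⁻¹.mulVec (c • A.mulVec x) = U.mulVec (C⁻¹.mulVec x) := by
      rw [← Matrix.smul_mulVec, Matrix.mulVec_mulVec, Matrix.mulVec_mulVec, hUdef,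
        mul_assoc _ C, Matrix.mul_nonsing_inv _ hCu, mul_one]
    simp only [N]
    rw [e, hNU]
  have hdet : ‖c‖ ^ 2 * ‖A.det‖ = 1 := by
    have h1 : ‖U.det‖ = 1 := by
      have := Matrix.det_of_mem_unitary hU
      exact CStarRing.norm_of_mem_unitary this
    have h2 : U.det = c ^ 2 * A.det := by
      rw [hUdef, Matrix.det_mul, Matrix.det_mul, Matrix.det_smul, Matrix.det_nonsing_inv]
      simp
      field_simp
    rw [h2] at h1
    simpa using h1
  let τ : P1 → P1 → ℝ := fun x y => ‖wdg x.rep y.rep‖ / (N x.rep * N y.rep)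
  have hτ : ∀ v w : {v : Fin 2 → ℂ // v ≠ 0}, τ (P1mk v) (P1mk w) =
      ‖wdg v.1 w.1‖ / (N v.1 * N w.1) := by
    intro v w
    obtain ⟨a, ha⟩ := Projectivization.exists_smul_eq_mk_rep ℂ v.1 v.2
    obtain ⟨b, hb⟩ := Projectivization.exists_smul_eq_mk_rep ℂ w.1 w.2
    have e : (P1mk v).rep = (a : ℂ) • v.1 := ha.symm
    have e' : (P1mk w).rep = (b : ℂ) • w.1 := hb.symm
    have ha : ‖(a : ℂ)‖ ≠ 0 := norm_ne_zero_iff.2 a.ne_zero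
    have hb : ‖(b : ℂ)‖ ≠ 0 := norm_ne_zero_iff.2 b.ne_zero
    have := (hNp v.1 v.2).ne'
    have := (hNp w.1 w.2).ne'
    simp only [τ, e, e', hNs, wdg_smul, norm_mul]
    field_simp
  refine ⟨τ, ?_, ?_, ?_, ?_⟩
  · rw [(P1mk_open.prodMap P1mk_open).isQuotientMap.continuous_iff]
    have : Function.uncurry τ ∘ Prod.map P1mk P1mk = fun z =>
      ‖wdg z.1.1 z.2.1‖ / (N z.1.1 * N z.2.1) := funext fun z => hτ z.1 z.2
    rw [this]
    refine Continuous.div ?_ ?_ ?_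
    · have hw : Continuous fun z : (Fin 2 → ℂ) × (Fin 2 → ℂ) => ‖wdg z.1 z.2‖ := by
        unfold wdg; fun_prop
      exact hw.comp ((continuous_subtype_val.comp continuous_fst).prodMk
        (continuous_subtype_val.comp continuous_snd))
    · fun_prop
    · intro z
      exact (mul_pos (hNp _ z.1.2) (hNp _ z.2.2)).ne'
  · intro x
    have : wdg x.rep x.rep = 0 := by unfold wdg; ring
    simp [τ, this]
  · intro x y hxy
    obtain ⟨x, rfl⟩ := P1mk_surj x
    obtain ⟨y, rfl⟩ := P1mk_surj y
    rw [Ne, P1mk_eq_iff] at hxy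
    rw [hτ]
    exact div_pos (norm_pos_iff.2 hxy) (mul_pos (hNp _ x.2) (hNp _ y.2))
  · intro x y
    obtain ⟨x, rfl⟩ := P1mk_surj x
    obtain ⟨y, rfl⟩ := P1mk_surj y
    rw [projAction_mk hA, projAction_mk hA, hτ, hτ]
    simp only
    rw [wdg_mulVec, norm_mul, ← hNA x.1, ← hNA y.1]
    have h1 := (hNp _ (mulVec_ne hA x.2)).ne'
    have h2 := (hNp _ (mulVec_ne hA y.2)).ne'
    have h3 : ‖c‖ ≠ 0 := norm_ne_zero_iff.2 hc
    field_simp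
    linear_combination ‖wdg x.1 y.1‖ * hdet

theorem hpol_eq_zero_of_unitary (A : Matrix (Fin 2) (Fin 2) ℂ) (hA : A.det ≠ 0)
    (h : IsProjectivelyUnitary A) (dm : MetricSpace (Projectivization ℂ (Fin 2 → ℂ)))
    (hdm : dm.toUniformSpace.toTopologicalSpace =
      inferInstanceAs (TopologicalSpace (Projectivization ℂ (Fin 2 → ℂ)))) :
    @hpol _ dm.toPseudoMetricSpace (projAction A) = 0 := by
  obtain ⟨c, hc, C, hC, hU⟩ := h
  obtain ⟨τ, h1, h2, h3, h4⟩ := exists_tau A C hA c hc hC hU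
  exact @hpol_eq_zero _ _ P1_compact dm hdm _ τ h1 h2 h3 h4

theorem unitary_inv (A : Matrix (Fin 2) (Fin 2) ℂ) (hA : A.det ≠ 0)
    (h : IsProjectivelyUnitary A⁻¹) : IsProjectivelyUnitary A := by
  obtain ⟨c, hc, C, hC, hU⟩ := h
  refine ⟨c⁻¹, inv_ne_zero hc, C, hC, ?_⟩
  have hCu : IsUnit C.det := isUnit_iff_ne_zero.2 hC
  have hAu : IsUnit A.det := isUnit_iff_ne_zero.2 hA
  have e : (C⁻¹ * (c⁻¹ • A) * C) * (C⁻¹ * (c • A⁻¹) * C) = 1 := by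
    have : (C⁻¹ * (c⁻¹ • A) * C) * (C⁻¹ * (c • A⁻¹) * C) =
      C⁻¹ * ((c⁻¹ • A) * (C * C⁻¹) * (c • A⁻¹)) * C := by simp only [mul_assoc]
    rw [this, Matrix.mul_nonsing_inv _ hCu, mul_one, smul_mul_smul_comm,
      Matrix.mul_nonsing_inv _ hAu, inv_mul_cancel₀ hc, one_smul, mul_one,
      Matrix.nonsing_inv_mul _ hCu]
  have e2 : C⁻¹ * (c⁻¹ • A) * C = star (C⁻¹ * (c • A⁻¹) * C) := by
    have h1 := Matrix.mem_unitaryGroup_iff.1 hU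
    exact left_inv_eq_right_inv e h1
  rw [e2]
  exact Unitary.star_mem hU

theorem exists_triang (A : Matrix (Fin 2) (Fin 2) ℂ) : ∃ (C : Matrix (Fin 2) (Fin 2) ℂ) (a b d : ℂ),
    C.det ≠ 0 ∧ A * C = C * !![a, b; 0, d] := by
  by_cases hr : A 1 0 = 0
  · refine ⟨1, A 0 0, A 0 1, A 1 1, by simp, ?_⟩
    rw [mul_one, one_mul]
    conv_lhs => rw [Matrix.eta_fin_two A, hr]
  · obtain ⟨s, hs⟩ := IsAlgClosed.exists_pow_nat_eq
      ((A 0 0 - A 1 1) ^ 2 + 4 * A 0 1 * A 1 0) (n := 2) (by norm_num)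
    let a := (A 0 0 + A 1 1 + s) / 2
    have ha : a * (a - A 1 1) = A 0 0 * (a - A 1 1) + A 0 1 * A 1 0 := by
      simp only [a]; linear_combination hs / 4
    refine ⟨!![a - A 1 1, 1; A 1 0, 0], a, 1, A 0 0 + A 1 1 - a, by simpa using hr, ?_⟩
    rw [Matrix.eta_fin_two A]
    ext i j; fin_cases i <;> fin_cases j <;> simp
    · linear_combination -ha
    · ring

theorem triang_pow (a b d : ℂ) (j : ℕ) : !![a, b; 0, d] ^ j =
    !![a ^ j, b * ∑ i ∈ Finset.range j, a ^ i * d ^ (j - 1 - i); 0, d ^ j] := by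
  induction j with
  | zero => simp [Matrix.one_fin_two]
  | succ j ih =>
    rw [pow_succ, ih]
    ext i k; fin_cases i <;> fin_cases k <;> simp [pow_succ]
    rw [Finset.sum_range_succ]
    have : ∀ i ∈ Finset.range j, a ^ i * d ^ (j - i) = a ^ i * d ^ (j - 1 - i) * d := by
      intro i hi
      rw [Finset.mem_range] at hi
      have : j - i = (j - 1 - i) + 1 := by omega
      rw [this, pow_succ]; ring
    rw [Finset.sum_congr rfl this, ← Finset.sum_mul]
    simp; ring

theorem rankOne_conj (A J C : Matrix (Fin 2) (Fin 2) ℂ) (hC : C.det ≠ 0) (h : A * C = C * J)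
    (hJ : RankOneLimit J) : RankOneLimit A := by
  obtain ⟨c, R, hR, hd, hc, hlim⟩ := hJ
  have hCu : IsUnit C.det := isUnit_iff_ne_zero.2 hC
  have hp : ∀ j, A ^ j = C * J ^ j * C⁻¹ := by
    intro j
    have : A ^ j * C = C * J ^ j := by
      have hs : SemiconjBy C J A := h.symm
      exact (hs.pow_right j).symm
    rw [← this, mul_assoc, Matrix.mul_nonsing_inv _ hCu, mul_one]
  refine ⟨c, C * R * C⁻¹, ?_, ?_, hc, ?_⟩
  · intro h0
    apply hR
    have : C⁻¹ * (C * R * C⁻¹) * C = (C⁻¹ * C) * R * (C⁻¹ * C) := by simp only [mul_assoc]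
    rw [h0, Matrix.nonsing_inv_mul _ hCu] at this
    simpa using this.symm
  · simp [Matrix.det_mul, hd]
  · have hcont : Continuous fun M : Matrix (Fin 2) (Fin 2) ℂ => C * M * C⁻¹ := by fun_prop
    have := (hcont.tendsto R).comp hlim
    refine this.congr fun j => ?_
    simp [hp]

theorem tendsto_mat {M : ℕ → Matrix (Fin 2) (Fin 2) ℂ} {x y z w : ℂ}
    (h00 : Tendsto (fun j => M j 0 0) atTop (𝓝 x)) (h01 : Tendsto (fun j => M j 0 1) atTop (𝓝 y))
    (h10 : Tendsto (fun j => M j 1 0) atTop (𝓝 z)) (h11 : Tendsto (fun j => M j 1 1) atTop (𝓝 w)) :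
    Tendsto M atTop (𝓝 !![x, y; z, w]) := by
  refine tendsto_pi_nhds.2 fun i => tendsto_pi_nhds.2 fun k => ?_
  fin_cases i <;> fin_cases k <;> simpa

theorem geom_aux {a d : ℂ} (h : a ≠ d) (j : ℕ) :
    ∑ i ∈ Finset.range j, a ^ i * d ^ (j - 1 - i) = (a ^ j - d ^ j) / (a - d) := by
  rw [eq_div_iff (sub_ne_zero.2 h)]
  exact Commute.geom_sum₂_mul (Commute.all a d) j

theorem ratio_tendsto {a d : ℂ} (h : ‖d‖ < ‖a‖) :
    Tendsto (fun j : ℕ => (a ^ j)⁻¹ * d ^ j) atTop (𝓝 0) := by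
  have ha : 0 < ‖a‖ := (norm_nonneg d).trans_lt h
  have : Tendsto (fun j : ℕ => (d / a) ^ j) atTop (𝓝 0) := by
    apply tendsto_pow_atTop_nhds_zero_of_norm_lt_one
    rw [norm_div, div_lt_one ha]; exact h
  refine this.congr fun j => ?_
  rw [div_pow, div_eq_inv_mul]

theorem triang_cases (a b d : ℂ) (ha : a ≠ 0) (hd : d ≠ 0) (h : ‖a‖ ≠ ‖d‖ ∨ (a = d ∧ b ≠ 0)) :
    RankOneLimit !![a, b; 0, d] := by
  rcases h with h | ⟨rfl, hb⟩
  · have had : a ≠ d := by rintro rfl; exact h rfl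
    have had' := sub_ne_zero.2 had
    rcases lt_or_gt_of_ne h with h | h
    · have hr := ratio_tendsto h
      refine ⟨fun j => (d ^ j)⁻¹, !![0, b * ((0 - 1) / (a - d)); 0, 1], ?_, ?_, ?_, ?_⟩
      · intro h0
        have := congrFun (congrFun h0 1) 1
        simp at this
      · simp
      · exact Eventually.of_forall fun j => inv_ne_zero (pow_ne_zero _ hd)
      · apply tendsto_mat
        · simpa [triang_pow] using hr
        · refine (((hr.sub_const 1).div_const (a - d)).const_mul b).congr fun j => ?_
          have := pow_ne_zero j hd
          simp [triang_pow, geom_aux had]; field_simp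
        · simp [triang_pow]
        · refine tendsto_const_nhds.congr fun j => ?_
          have := pow_ne_zero j hd
          simp [triang_pow, this]
    · have hr := ratio_tendsto h
      refine ⟨fun j => (a ^ j)⁻¹, !![1, b * ((1 - 0) / (a - d)); 0, 0], ?_, ?_, ?_, ?_⟩
      · intro h0
        have := congrFun (congrFun h0 0) 0
        simp at this
      · simp
      · exact Eventually.of_forall fun j => inv_ne_zero (pow_ne_zero _ ha)
      · apply tendsto_mat
        · refine tendsto_const_nhds.congr fun j => ?_
          have := pow_ne_zero j ha
          simp [triang_pow, this]
        · refine (((hr.const_sub 1).div_const (a - d)).const_mul b).congr fun j => ?_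
          have := pow_ne_zero j ha
          simp [triang_pow, geom_aux had]; field_simp
        · simp [triang_pow]
        · simpa [triang_pow] using hr
  · have hj : Tendsto (fun j : ℕ => (j : ℂ)⁻¹) atTop (𝓝 0) := tendsto_inv_atTop_nhds_zero_nat
    have hs : ∀ j : ℕ, ∑ i ∈ Finset.range j, a ^ i * a ^ (j - 1 - i) = j * (a ^ j / a) := by
      intro j
      have : ∀ i ∈ Finset.range j, a ^ i * a ^ (j - 1 - i) = a ^ j / a := by
        intro i hi
        rw [Finset.mem_range] at hi
        rw [← pow_add, eq_div_iff ha, ← pow_succ]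
        congr 1; omega
      rw [Finset.sum_congr rfl this]; simp
    refine ⟨fun j => (j : ℂ)⁻¹ * (a ^ j)⁻¹, !![0, b / a; 0, 0], ?_, ?_, ?_, ?_⟩
    · intro h0
      have := congrFun (congrFun h0 0) 1
      simp [ha, hb] at this
    · simp
    · filter_upwards [eventually_ge_atTop 1] with j hj
      have : (j : ℂ) ≠ 0 := by exact_mod_cast (by omega : j ≠ 0)
      exact mul_ne_zero (inv_ne_zero this) (inv_ne_zero (pow_ne_zero _ ha))
    · apply tendsto_mat
      · refine hj.congr fun j => ?_
        have := pow_ne_zero j ha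
        simp [triang_pow, mul_assoc, this]
      · refine tendsto_const_nhds.congr' ?_
        filter_upwards [eventually_ge_atTop 1] with j hj
        have h1 : (j : ℂ) ≠ 0 := by exact_mod_cast (by omega : j ≠ 0)
        have := pow_ne_zero j ha
        simp [triang_pow, hs]; field_simp
      · simp [triang_pow]
      · refine hj.congr fun j => ?_
        have := pow_ne_zero j ha
        simp [triang_pow, mul_assoc, this]

theorem diag_unitary (A C : Matrix (Fin 2) (Fin 2) ℂ) (a d : ℂ) (hC : C.det ≠ 0) (ha : a ≠ 0)
    (h : A * C = C * !![a, 0; 0, d]) (had : ‖a‖ = ‖d‖) : IsProjectivelyUnitary A := by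
  have hCu : IsUnit C.det := isUnit_iff_ne_zero.2 hC
  have hna : ‖a‖ ≠ 0 := norm_ne_zero_iff.2 ha
  refine ⟨a⁻¹, inv_ne_zero ha, C, hC, ?_⟩
  have e : C⁻¹ * (a⁻¹ • A) * C = !![1, 0; 0, a⁻¹ * d] := by
    rw [mul_assoc, Matrix.smul_mul, h, Matrix.mul_smul, ← mul_assoc, Matrix.nonsing_inv_mul _ hCu,
      one_mul]
    ext i j; fin_cases i <;> fin_cases j <;> simp [ha]
  rw [e, Matrix.mem_unitaryGroup_iff]
  have hn : (a⁻¹ * d) * (starRingEnd ℂ) (a⁻¹ * d) = 1 := by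
    rw [Complex.mul_conj', norm_mul, norm_inv, ← had, inv_mul_cancel₀ hna]; simp
  rw [map_mul, map_inv₀] at hn
  ext i j; fin_cases i <;> fin_cases j <;>
    simp [Matrix.mul_apply, Fin.sum_univ_two, Matrix.star_apply, Matrix.one_apply]
  linear_combination hn

theorem rankOne_of_not_unitary (A : Matrix (Fin 2) (Fin 2) ℂ) (hA : A.det ≠ 0)
    (h : ¬ IsProjectivelyUnitary A) : RankOneLimit A := by
  obtain ⟨C, a, b, d, hC, hAC⟩ := exists_triang A
  have hdet : a * d ≠ 0 := by
    have h1 := congrArg Matrix.det hAC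
    rw [Matrix.det_mul, Matrix.det_mul, Matrix.det_fin_two_of] at h1
    intro h0
    rw [h0] at h1
    simp [hA, hC] at h1
  obtain ⟨ha, hd⟩ := mul_ne_zero_iff.1 hdet
  by_cases hc : ‖a‖ ≠ ‖d‖ ∨ (a = d ∧ b ≠ 0)
  · exact rankOne_conj A _ C hC hAC (triang_cases a b d ha hd hc)
  · exfalso
    apply h
    push Not at hc
    obtain ⟨h1, h2⟩ := hc
    by_cases had : a = d
    · have := h2 had
      subst this
      exact diag_unitary A C a d hC ha hAC h1
    · have had' : d - a ≠ 0 := sub_ne_zero.2 (Ne.symm had)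
      refine diag_unitary A (C * !![1, b / (d - a); 0, 1]) a d ?_ ha ?_ h1
      · simpa using hC
      · rw [← mul_assoc, hAC, mul_assoc, mul_assoc]
        congr 1
        ext i j; fin_cases i <;> fin_cases j <;> simp
        field_simp; ring

/-- Let `g ∈ PGL₂(ℂ)` act on `ℙ¹(ℂ)` and let `d` be any metric on `ℙ¹(ℂ)` inducing its
topology.  If `g` is represented by a matrix conjugate to a unitary matrix then
`hpol g = 0`; otherwise `hpol g = 1`.  In particular `hpol g ∈ {0,1}`. -/
theorem hpol_PGL2 (A : Matrix (Fin 2) (Fin 2) ℂ) (hA : A.det ≠ 0)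
    (dm : MetricSpace (Projectivization ℂ (Fin 2 → ℂ)))
    (hdm : dm.toUniformSpace.toTopologicalSpace =
      inferInstanceAs (TopologicalSpace (Projectivization ℂ (Fin 2 → ℂ)))) :
    (IsProjectivelyUnitary A → @hpol _ dm.toPseudoMetricSpace (projAction A) = 0) ∧
    (¬ IsProjectivelyUnitary A → @hpol _ dm.toPseudoMetricSpace (projAction A) = 1) ∧
    (@hpol _ dm.toPseudoMetricSpace (projAction A) = 0 ∨
      @hpol _ dm.toPseudoMetricSpace (projAction A) = 1) := by
  have h0 := fun h => hpol_eq_zero_of_unitary A hA h dm hdm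
  have h1 : ¬ IsProjectivelyUnitary A →
      @hpol _ dm.toPseudoMetricSpace (projAction A) = 1 := fun h =>
    hpol_eq_one_of A hA (rankOne_of_not_unitary A hA h)
      (rankOne_of_not_unitary A⁻¹ (by rw [Matrix.det_nonsing_inv]; simpa using hA)
        (fun h' => h (unitary_inv A hA h'))) dm hdm
  refine ⟨h0, h1, ?_⟩
  by_cases h : IsProjectivelyUnitary A
  · exact Or.inl (h0 h)
  · exact Or.inr (h1 h)
end

section
/- Let g be an element of PGL₃(ℂ), acting on the complex projective plane ℙ²(ℂ), and let d be any metric on ℙ²(ℂ) inducing its topology. Then hpol(g) ∈ {0, 1, 2}. -/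
open Filter Topology Metric
open scoped ENNReal

variable {X : Type*}

theorem hp_covNum_le [PseudoMetricSpace X] {f : X → X} {ε : ℝ} {n : ℕ} (S : Finset X)
    (hS : ∀ x : X, ∃ s ∈ S, ∀ j < n, dist (f^[j] x) (f^[j] s) < ε) :
    covNum f ε n ≤ S.card :=
  Nat.sInf_le ⟨S, rfl, hS⟩

def hpUB [PseudoMetricSpace X] (f : X → X) (k : ℕ) : Prop :=
  ∀ ε > 0, ∃ C : ℝ, ∃ m : ℕ, ∀ n : ℕ, 1 ≤ n → ∃ S : Finset X,
    (S.card : ℝ) ≤ C * (n : ℝ) ^ k * (1 + Real.log n) ^ m ∧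
    ∀ x : X, ∃ s ∈ S, ∀ j < n, dist (f^[j] x) (f^[j] s) < ε

theorem hp_le [PseudoMetricSpace X] {f : X → X} {k : ℕ} (h : hpUB f k) : hpol f ≤ k := by
  refine iSup₂_le fun ε hε => ?_
  obtain ⟨C, m, h⟩ := h ε hε
  set C' := max C 1 with hC'
  have hC1 : 1 ≤ C' := le_max_right _ _
  let u : ℕ → ℝ := fun n => (Real.log C' + m * Real.log 2) / Real.log n + k
    + m * (Real.log (Real.log n) / Real.log n)
  have hlog : Tendsto (fun n : ℕ => Real.log n) atTop atTop :=
    Real.tendsto_log_atTop.comp tendsto_natCast_atTop_atTop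
  have hu : Tendsto u atTop (𝓝 (0 + k + m * 0)) := by
    refine ((Tendsto.const_div_atTop hlog _).add tendsto_const_nhds).add (Tendsto.const_mul _ ?_)
    exact (Real.isLittleO_log_id_atTop.tendsto_div_nhds_zero).comp hlog
  have hu' : Tendsto (fun n => ENNReal.ofReal (u n)) atTop (𝓝 (k : ℝ≥0∞)) := by
    have := (ENNReal.continuous_ofReal.tendsto _).comp hu
    simpa [Function.comp_def] using this
  rw [← hu'.limsup_eq]
  refine limsup_le_limsup ?_
  filter_upwards [eventually_ge_atTop 1, hlog.eventually_ge_atTop 1] with n hn hl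
  apply ENNReal.ofReal_le_ofReal
  obtain ⟨S, hS, hc⟩ := h n hn
  have h1 : (covNum f ε n : ℝ) ≤ C' * (n : ℝ) ^ k * (2 * Real.log n) ^ m := by
    calc (covNum f ε n : ℝ) ≤ S.card := by exact_mod_cast hp_covNum_le S hc
      _ ≤ _ := hS
      _ ≤ _ := by
        gcongr
        · exact le_max_left _ _
        · linarith
  have hl0 : 0 < Real.log n := by linarith
  have hn0 : (0:ℝ) < n := by exact_mod_cast hn
  have h2 : Real.log (covNum f ε n) ≤ Real.log C' + k * Real.log n + m * (Real.log 2 + Real.log (Real.log n)) := by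
    rcases Nat.eq_zero_or_pos (covNum f ε n) with h0 | h0
    · rw [h0]
      have := Real.log_nonneg hC1
      have := Real.log_nonneg hl
      have : 0 ≤ Real.log 2 := Real.log_nonneg (by norm_num)
      simp only [Nat.cast_zero, Real.log_zero]
      positivity
    · refine (Real.log_le_log (by exact_mod_cast h0) h1).trans ?_
      rw [Real.log_mul (by positivity) (by positivity), Real.log_mul (by positivity) (by positivity),
        Real.log_pow, Real.log_pow, Real.log_mul (by positivity) (by positivity)]
  show _ ≤ (Real.log C' + m * Real.log 2) / Real.log n + k
    + m * (Real.log (Real.log n) / Real.log n)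
  rw [div_le_iff₀ hl0]
  refine h2.trans (le_of_eq ?_)
  field_simp
  ring

theorem hp_ge [PseudoMetricSpace X] {f : X → X} {k : ℕ} {l : ℕ} (hub : hpUB f l)
    (K : ℕ) (hK : 1 ≤ K) (ε : ℝ) (hε : 0 < ε)
    (h : ∀ m : ℕ, 1 ≤ m → ∃ (ι : Type) (_ : Fintype ι) (x : ι → X), m ^ k ≤ Fintype.card ι ∧
      ∀ i j, i ≠ j → ∃ t < K * m, ε ≤ dist (f^[t] (x i)) (f^[t] (x j))) :
    (k : ℝ≥0∞) ≤ hpol f := by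
  have key : ∀ m : ℕ, 1 ≤ m → m ^ k ≤ covNum f (ε/2) (K * m) := by
    intro m hm
    obtain ⟨ι, _, x, hx, hsep⟩ := h m hm
    obtain ⟨C, q, hh⟩ := hub (ε/2) (by positivity)
    obtain ⟨S, -, hc⟩ := hh (K * m) (Nat.mul_pos hK hm)
    have hne : {m' : ℕ | ∃ S : Finset X, S.card = m' ∧
      ∀ x : X, ∃ s ∈ S, ∀ j < K * m, dist (f^[j] x) (f^[j] s) < ε/2}.Nonempty := ⟨_, S, rfl, hc⟩
    obtain ⟨S', hS', hc'⟩ := Nat.sInf_mem hne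
    change S'.card = covNum f (ε/2) (K*m) at hS'
    rw [← hS']
    choose g hg hg' using fun i => hc' (x i)
    refine hx.trans ?_
    rw [← Finset.card_univ]
    refine Finset.card_le_card_of_injOn g (fun i _ => hg i) ?_
    intro i _ j _ hij
    by_contra hne
    obtain ⟨t, ht, htt⟩ := hsep i j hne
    have h1 := hg' i t ht
    have h2 := hg' j t ht
    rw [← hij] at h2
    have := dist_triangle_right (f^[t] (x i)) (f^[t] (x j)) (f^[t] (g i))
    linarith
  refine le_trans ?_ (le_iSup₂ (f := fun (ε : ℝ) (_ : 0 < ε) => Filter.atTop.limsup fun n : ℕ =>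
      ENNReal.ofReal (Real.log (covNum f ε n) / Real.log n)) (ε/2) (by positivity))
  have hT : Tendsto (fun m : ℕ => K * m) atTop atTop := tendsto_id.const_mul_atTop' (by omega)
  refine le_trans ?_ (limsup_le_limsup_of_le hT)
  have hlog : Tendsto (fun n : ℕ => Real.log n) atTop atTop :=
    Real.tendsto_log_atTop.comp tendsto_natCast_atTop_atTop
  let u : ℕ → ℝ := fun m => k / (Real.log K / Real.log m + 1)
  have hu : Tendsto u atTop (𝓝 (k / (0 + 1))) := by
    refine Tendsto.div tendsto_const_nhds ((Tendsto.const_div_atTop hlog _).add tendsto_const_nhds) (by norm_num)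
  have hu' : Tendsto (fun n => ENNReal.ofReal (u n)) atTop (𝓝 (k : ℝ≥0∞)) := by
    have := (ENNReal.continuous_ofReal.tendsto _).comp hu
    simpa [Function.comp_def] using this
  rw [← hu'.limsup_eq]
  refine limsup_le_limsup (v := _) ?_
  filter_upwards [eventually_ge_atTop 1, hlog.eventually_ge_atTop 1] with m hm hl
  apply ENNReal.ofReal_le_ofReal
  have hm0 : (0:ℝ) < m := by exact_mod_cast hm
  have hK0 : (1:ℝ) ≤ K := by exact_mod_cast hK
  have hlK := Real.log_nonneg hK0
  have h1 : k * Real.log m ≤ Real.log (covNum f (ε/2) (K * m)) := by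
    rw [← Real.log_pow]
    exact Real.log_le_log (by positivity) (by exact_mod_cast key m hm)
  have hl0 : 0 < Real.log m := by linarith
  have h3 : Real.log ((K * m : ℕ) : ℝ) = Real.log K + Real.log m := by
    push_cast
    rw [Real.log_mul (by positivity) (by positivity)]
  show k / (Real.log K / Real.log m + 1) ≤ Real.log (covNum f (ε/2) (K*m)) / Real.log ((K * m : ℕ) : ℝ)
  rw [h3]
  have : (k : ℝ) / (Real.log K / Real.log m + 1) = k * Real.log m / (Real.log K + Real.log m) := by
    field_simp
  rw [this]
  gcongr


theorem hp_annulus (ε : ℝ) (hε : 0 < ε) : ∃ C : ℝ, 0 ≤ C ∧ ∀ R : ℝ, 1 ≤ R → ∃ T : Finset ℂ,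
    (T.card : ℝ) ≤ C * (1 + Real.log R) ∧
    ∀ t : ℂ, 1 / R ≤ ‖t‖ → ‖t‖ ≤ R → ∃ t' ∈ T, ‖t - t'‖ ≤ ε * ‖t‖ := by
  classical
  have hK : IsCompact (closedBall (0:ℂ) (Real.exp 1)) := isCompact_closedBall _ _
  obtain ⟨F, -, hFfin, hF⟩ := hK.finite_cover_balls hε
  lift F to Finset ℂ using hFfin
  refine ⟨5 * F.card, by positivity, fun R hR => ?_⟩
  have hlR := Real.log_nonneg hR
  set L : ℕ := ⌈Real.log R⌉₊ with hL
  have hL1 : Real.log R ≤ L := Nat.le_ceil _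
  have hL2 : (L : ℝ) < Real.log R + 1 := Nat.ceil_lt_add_one hlR
  refine ⟨(Finset.Icc (-(L:ℤ)) L ×ˢ F).image (fun p => ((Real.exp (p.1 : ℝ) : ℝ) : ℂ) * p.2), ?_, ?_⟩
  · have h1 : ((Finset.Icc (-(L:ℤ)) L).card : ℝ) = 2 * L + 1 := by
      rw [Int.card_Icc]
      have : ((L:ℤ) + 1 - -(L:ℤ)).toNat = 2 * L + 1 := by omega
      rw [this]; push_cast; ring
    calc _ ≤ (((Finset.Icc (-(L:ℤ)) L ×ˢ F).card : ℕ) : ℝ) := by exact_mod_cast Finset.card_image_le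
      _ = (2 * L + 1) * F.card := by rw [Finset.card_product]; push_cast; rw [h1]
      _ ≤ (5 * (1 + Real.log R)) * F.card := by gcongr; linarith
      _ = _ := by ring
  · intro t ht1 ht2
    have ht0 : 0 < ‖t‖ := lt_of_lt_of_le (by positivity) ht1
    set j : ℤ := ⌊Real.log ‖t‖⌋ with hj
    have hj1 : (j:ℝ) ≤ Real.log ‖t‖ := Int.floor_le _
    have hj2 : Real.log ‖t‖ < j + 1 := Int.lt_floor_add_one _
    have hl1 : Real.log ‖t‖ ≤ Real.log R := Real.log_le_log ht0 ht2
    have hl2 : -Real.log R ≤ Real.log ‖t‖ := by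
      rw [← Real.log_inv, ← one_div]; exact Real.log_le_log (by positivity) ht1
    set s : ℂ := t * ((Real.exp (-(j:ℝ)) : ℝ) : ℂ) with hs
    have hns : ‖s‖ = Real.exp (Real.log ‖t‖ - j) := by
      rw [hs, norm_mul, Complex.norm_real, Real.norm_eq_abs, abs_of_pos (Real.exp_pos _),
        sub_eq_add_neg, Real.exp_add, Real.exp_log ht0]
    have hsK : s ∈ closedBall (0:ℂ) (Real.exp 1) := by
      rw [mem_closedBall_zero_iff, hns]
      exact Real.exp_le_exp.2 (by linarith)
    have := hF hsK
    simp only [Set.mem_iUnion, mem_ball, exists_prop] at this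
    obtain ⟨x, hx, hxs⟩ := this
    refine ⟨_, Finset.mem_image_of_mem _ (Finset.mem_product.2 ⟨?_, hx⟩) (a := (j, x)), ?_⟩
    · rw [Finset.mem_Icc]
      constructor
      · rw [hj, Int.le_floor]; push_cast; linarith
      · have : (j:ℝ) ≤ (L:ℤ) := by push_cast; linarith
        exact_mod_cast this
    · have hts : t = ((Real.exp (j:ℝ) : ℝ) : ℂ) * s := by
        rw [hs, mul_left_comm, ← Complex.ofReal_mul, ← Real.exp_add]; simp
      have : t - ((Real.exp (j:ℝ) : ℝ) : ℂ) * x = ((Real.exp (j:ℝ) : ℝ) : ℂ) * (s - x) := by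
        rw [mul_sub, ← hts]
      show ‖t - ((Real.exp (j:ℝ) : ℝ) : ℂ) * x‖ ≤ _
      rw [this, norm_mul, Complex.norm_real, Real.norm_eq_abs, abs_of_pos (Real.exp_pos _)]
      rw [dist_eq_norm] at hxs
      have : Real.exp (j:ℝ) ≤ ‖t‖ := by
        rw [← Real.exp_log ht0]; exact Real.exp_le_exp.2 hj1
      rw [mul_comm ε]
      exact mul_le_mul this hxs.le (norm_nonneg _) ht0.le

section cover
variable {V : Type*} [NormedAddCommGroup V] [NormedSpace ℂ V]

def hpMC (B : Module.End ℂ V) (ε : ℝ) (n : ℕ) (N : ℝ) : Prop :=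
  ∃ S : Finset V, (S.card : ℝ) ≤ N ∧ (∀ s ∈ S, s ≠ 0) ∧
    ∀ v : V, v ≠ 0 → ∃ s ∈ S, ∃ c : ℂ, c ≠ 0 ∧ ∀ k < n, ‖(B ^ k) (v - c • s)‖ ≤ ε * ‖(B ^ k) v‖

theorem hp_MC_mono {B : Module.End ℂ V} {ε : ℝ} {n : ℕ} {N N' : ℝ} (h : hpMC B ε n N)
    (hN : N ≤ N') : hpMC B ε n N' := by
  obtain ⟨S, h1, h2⟩ := h
  exact ⟨S, h1.trans hN, h2⟩

theorem hp_MC_one (B : Module.End ℂ ℂ) {ε : ℝ} (hε : 0 ≤ ε) (n : ℕ) : hpMC B ε n 1 := by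
  refine ⟨{1}, by simp, by simp, fun v hv => ⟨1, by simp, v, hv, fun k _ => ?_⟩⟩
  simp only [smul_eq_mul, mul_one, sub_self, map_zero, norm_zero]
  positivity

/-- the block sum of `B` and the scalar `μ` -/
def hpBlk (B : Module.End ℂ V) (μ : ℂ) : Module.End ℂ (V × ℂ) :=
  B.prodMap (μ • (1 : Module.End ℂ ℂ))

theorem hp_Blk_pow (B : Module.End ℂ V) (μ : ℂ) (k : ℕ) (w : V × ℂ) :
    (hpBlk B μ ^ k) w = ((B ^ k) w.1, μ ^ k * w.2) := by
  induction k with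
  | zero => simp
  | succ k ih =>
    rw [pow_succ', Module.End.mul_apply, ih, pow_succ', Module.End.mul_apply]
    simp [hpBlk, pow_succ', mul_assoc]

theorem hp_MC_blk (ε : ℝ) (hε : 0 < ε) (hε2 : ε ≤ 1/2) : ∃ C : ℝ, 0 ≤ C ∧
    ∀ (B : Module.End ℂ V) (μ : ℂ) (n : ℕ) (N G : ℝ), 1 ≤ n → 1 ≤ G →
    (∀ k < n, ∀ v, ‖(B ^ k) v‖ ≤ G * ‖μ‖ ^ k * ‖v‖) →
    (∀ k < n, ∀ v, ‖μ‖ ^ k * ‖v‖ ≤ G * ‖(B ^ k) v‖) →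
    hpMC B ε n N → hpMC (hpBlk B μ) ε n (N + 1 + N * (C * (1 + Real.log (2 * G / ε)))) := by
  classical
  obtain ⟨C, hC, hT⟩ := hp_annulus ε hε
  refine ⟨C, hC, fun B μ n N G hn hG hG1 hG2 ⟨S, hSc, hS0, hS⟩ => ?_⟩
  have hR : 1 ≤ 2 * G / ε := by rw [le_div_iff₀ hε]; linarith
  obtain ⟨T, hTc, hT⟩ := hT _ hR
  refine ⟨(S.image (fun s => (s, (0:ℂ))) ∪ {(0, 1)}) ∪
    (S ×ˢ T).image (fun p => (p.1, p.2 * (‖p.1‖:ℂ))), ?_, ?_, ?_⟩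
  · have h1 := Finset.card_union_le (S.image (fun s => (s, (0:ℂ))) ∪ {(0, 1)})
      ((S ×ˢ T).image (fun p => (p.1, p.2 * (‖p.1‖:ℂ))))
    have h2 := Finset.card_union_le (S.image (fun s => (s, (0:ℂ)))) {(0, 1)}
    have h3 := Finset.card_image_le (s := S) (f := fun s => (s, (0:ℂ)))
    have h4 := Finset.card_image_le (s := S ×ˢ T) (f := fun p => (p.1, p.2 * (‖p.1‖:ℂ)))
    rw [Finset.card_product] at h4
    rw [Finset.card_singleton] at h2
    have h5 := (h1.trans (add_le_add (h2.trans (add_le_add_left h3 _)) h4))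
    calc _ ≤ ((S.card + 1 + S.card * T.card : ℕ) : ℝ) := by exact_mod_cast h5
      _ ≤ _ := by
        push_cast
        have : (0:ℝ) ≤ S.card := by positivity
        gcongr
        exact this.trans hSc
  · intro s hs
    simp only [Finset.mem_union, Finset.mem_image, Finset.mem_singleton, Finset.mem_product] at hs
    rcases hs with (⟨a, ha, rfl⟩ | rfl) | ⟨p, ⟨hp, -⟩, rfl⟩
    · intro h; exact hS0 a ha (congrArg Prod.fst h)
    · intro h; exact one_ne_zero (congrArg Prod.snd h)
    · intro h; exact hS0 p.1 hp (congrArg Prod.fst h)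
  · rintro ⟨v, z⟩ hv
    -- helper: choose (s,0)
    have caseA : v ≠ 0 → (∀ k < n, ‖μ‖ ^ k * ‖z‖ ≤ ε * ‖(B ^ k) v‖) →
        ∃ s ∈ (S.image (fun s => (s, (0:ℂ))) ∪ {(0, 1)}) ∪
          (S ×ˢ T).image (fun p => (p.1, p.2 * (‖p.1‖:ℂ))), ∃ c : ℂ, c ≠ 0 ∧
          ∀ k < n, ‖(hpBlk B μ ^ k) ((v, z) - c • s)‖ ≤ ε * ‖(hpBlk B μ ^ k) (v, z)‖ := by
      intro hv0 hz
      obtain ⟨s, hs, c, hc, hk⟩ := hS v hv0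
      refine ⟨(s, 0), ?_, c, hc, fun k hkn => ?_⟩
      · simp [hs]
      · have e : ε * ‖(B ^ k) v‖ ≤ ε * ‖(hpBlk B μ ^ k) (v, z)‖ := by
          gcongr; rw [hp_Blk_pow]; exact norm_fst_le ((B ^ k) v, μ ^ k * z)
        refine le_trans ?_ e
        rw [hp_Blk_pow]
        refine max_le ?_ ?_
        · simpa using hk k hkn
        · simpa using hz k hkn
    have caseB : z ≠ 0 → (∀ k < n, ‖(B ^ k) v‖ ≤ ε * (‖μ‖ ^ k * ‖z‖)) →
        ∃ s ∈ (S.image (fun s => (s, (0:ℂ))) ∪ {(0, 1)}) ∪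
          (S ×ˢ T).image (fun p => (p.1, p.2 * (‖p.1‖:ℂ))), ∃ c : ℂ, c ≠ 0 ∧
          ∀ k < n, ‖(hpBlk B μ ^ k) ((v, z) - c • s)‖ ≤ ε * ‖(hpBlk B μ ^ k) (v, z)‖ := by
      intro hz0 hz
      refine ⟨(0, 1), ?_, z, hz0, fun k hkn => ?_⟩
      · simp
      · have e : ε * (‖μ‖ ^ k * ‖z‖) ≤ ε * ‖(hpBlk B μ ^ k) (v, z)‖ := by
          gcongr; rw [hp_Blk_pow]
          have := norm_snd_le ((B ^ k) v, μ ^ k * z)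
          rwa [norm_mul, norm_pow] at this
        refine le_trans ?_ e
        rw [hp_Blk_pow]
        refine max_le ?_ ?_
        · simpa using hz k hkn
        · simp; positivity
    by_cases hv0 : v = 0
    · subst hv0
      refine caseB (fun h => hv (by simp [h])) (fun k _ => ?_)
      simp; positivity
    have hvp : 0 < ‖v‖ := norm_pos_iff.2 hv0
    have hG0 : 0 < G := by linarith
    by_cases h1 : ‖z‖ ≤ ε / G * ‖v‖
    · refine caseA hv0 fun k hk => ?_
      calc ‖μ‖ ^ k * ‖z‖ ≤ ‖μ‖ ^ k * (ε / G * ‖v‖) := by gcongr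
        _ = ε / G * (‖μ‖ ^ k * ‖v‖) := by ring
        _ ≤ ε / G * (G * ‖(B ^ k) v‖) := mul_le_mul_of_nonneg_left (hG2 k hk v) (by positivity)
        _ = _ := by field_simp
    push Not at h1
    have hzp : 0 < ‖z‖ := lt_trans (by positivity) h1
    by_cases h2 : ‖v‖ ≤ ε / G * ‖z‖
    · refine caseB (norm_pos_iff.1 hzp) fun k hk => ?_
      calc ‖(B ^ k) v‖ ≤ G * ‖μ‖ ^ k * ‖v‖ := hG1 k hk v
        _ ≤ G * ‖μ‖ ^ k * (ε / G * ‖z‖) := by gcongr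
        _ = _ := by field_simp
    push Not at h2
    obtain ⟨s, hs, c, hc, hk⟩ := hS v hv0
    have hsp : 0 < ‖s‖ := norm_pos_iff.2 (hS0 s hs)
    have hcp : 0 < ‖c‖ := norm_pos_iff.2 hc
    have hk0 := hk 0 (by omega)
    simp only [pow_zero, Module.End.one_apply] at hk0
    have hcs : ‖c • s‖ = ‖c‖ * ‖s‖ := norm_smul _ _
    have hb1 : ‖c‖ * ‖s‖ ≤ 2 * ‖v‖ := by
      have := norm_sub_norm_le (c • s) v
      rw [norm_sub_rev] at this
      nlinarith
    have hb2 : ‖v‖ ≤ 2 * (‖c‖ * ‖s‖) := by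
      have := norm_sub_norm_le v (c • s)
      nlinarith
    have hsC : (‖s‖ : ℂ) ≠ 0 := by exact_mod_cast hsp.ne'
    have hnt : ‖z / (c * (‖s‖:ℂ))‖ = ‖z‖ / (‖c‖ * ‖s‖) := by
      simp
    obtain ⟨t', ht', htt⟩ := hT (z / (c * (‖s‖:ℂ))) (by
        rw [hnt, one_div_div, div_le_div_iff₀ (by positivity) (by positivity)]
        have h1' : ε * ‖v‖ ≤ ‖z‖ * G := by
          have : ε / G * ‖v‖ * G = ε * ‖v‖ := by field_simp
          nlinarith
        nlinarith) (by
        rw [hnt, div_le_div_iff₀ (by positivity) (by positivity)]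
        have h2' : ε * ‖z‖ ≤ ‖v‖ * G := by
          have : ε / G * ‖z‖ * G = ε * ‖z‖ := by field_simp
          nlinarith
        nlinarith)
    refine ⟨(s, t' * (‖s‖:ℂ)), ?_, c, hc, fun k hkn => ?_⟩
    · refine Finset.mem_union_right _ ?_
      rw [Finset.mem_image]
      exact ⟨(s, t'), Finset.mem_product.2 ⟨hs, ht'⟩, rfl⟩
    · rw [hp_Blk_pow, hp_Blk_pow]
      refine max_le ?_ ?_
      · refine (hk k hkn).trans ?_
        gcongr
        exact norm_fst_le ((B ^ k) v, μ ^ k * z)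
      · have e1 : z - c * (t' * (‖s‖:ℂ)) = (z / (c * (‖s‖:ℂ)) - t') * (c * (‖s‖:ℂ)) := by
          field_simp
        have e2 : ‖z - c * (t' * (‖s‖:ℂ))‖ ≤ ε * ‖z‖ := by
          rw [e1, norm_mul]
          calc _ ≤ (ε * ‖z / (c * (‖s‖:ℂ))‖) * ‖c * (‖s‖:ℂ)‖ := by gcongr
            _ = _ := by
              rw [mul_assoc, ← norm_mul, div_mul_cancel₀]
              exact mul_ne_zero hc hsC
        have e3 : ‖μ ^ k * z‖ ≤ ‖((B ^ k) v, μ ^ k * z)‖ := norm_snd_le ((B ^ k) v, μ ^ k * z)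
        calc ‖μ ^ k * (z - c * (t' * (‖s‖:ℂ)))‖ = ‖μ ^ k‖ * ‖z - c * (t' * (‖s‖:ℂ))‖ := norm_mul _ _
          _ ≤ ‖μ ^ k‖ * (ε * ‖z‖) := by gcongr
          _ = ε * ‖μ ^ k * z‖ := by rw [norm_mul]; ring
          _ ≤ _ := by gcongr

/-- asymptotic bound -/
def hpPB (B : Module.End ℂ V) (d : ℕ) : Prop :=
  ∀ ε : ℝ, 0 < ε → ε ≤ 1/2 → ∃ C : ℝ, ∃ m : ℕ, ∀ n : ℕ, 1 ≤ n →
    hpMC B ε n (C * (n:ℝ) ^ d * (1 + Real.log n) ^ m)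

theorem hp_PB_one (B : Module.End ℂ ℂ) : hpPB B 0 := by
  intro ε hε _
  refine ⟨1, 0, fun n _ => ?_⟩
  simpa using hp_MC_one B hε.le n

theorem hp_PB_blk {B : Module.End ℂ V} {d : ℕ} (h : hpPB B d) (μ : ℂ) (e : ℕ) (G : ℕ → ℝ) (C' : ℝ)
    (hG : ∀ n, 1 ≤ n → 1 ≤ G n)
    (hG1 : ∀ n, 1 ≤ n → ∀ k < n, ∀ v, ‖(B ^ k) v‖ ≤ G n * ‖μ‖ ^ k * ‖v‖)
    (hG2 : ∀ n, 1 ≤ n → ∀ k < n, ∀ v, ‖μ‖ ^ k * ‖v‖ ≤ G n * ‖(B ^ k) v‖)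
    (hGl : ∀ n, 1 ≤ n → Real.log (G n) ≤ C' * (n:ℝ) ^ e * (1 + Real.log n)) :
    hpPB (hpBlk B μ) (d + e) := by
  intro ε hε hε2
  obtain ⟨C0, m, h⟩ := h ε hε hε2
  obtain ⟨C, hC, hb⟩ := hp_MC_blk (V := V) ε hε hε2
  set C1 := max C0 1
  have hC1 : 1 ≤ C1 := le_max_right _ _
  have hl2 : 0 ≤ Real.log (2 / ε) := Real.log_nonneg (by rw [le_div_iff₀ hε]; linarith)
  refine ⟨C1 * (2 + C * (1 + Real.log (2/ε) + |C'|)), m + 1, fun n hn => ?_⟩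
  have hn1 : (1:ℝ) ≤ n := by exact_mod_cast hn
  have hL : 1 ≤ 1 + Real.log n := by linarith [Real.log_nonneg hn1]
  set L := 1 + Real.log n
  set N := C1 * (n:ℝ) ^ d * L ^ m with hN
  have hN1 : 1 ≤ N := by
    have h1 := one_le_pow₀ hn1 (n := d)
    have h2 := one_le_pow₀ hL (n := m)
    calc (1:ℝ) = 1 * 1 * 1 := by norm_num
      _ ≤ _ := by rw [hN]; gcongr
  have hMC : hpMC B ε n N := hp_MC_mono (h n hn) (by
    rw [hN]; gcongr; exact le_max_left _ _)
  refine hp_MC_mono (hb B μ n N (G n) hn (hG n hn) (hG1 n hn) (hG2 n hn) hMC) ?_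
  have hg0 : 0 < G n := by linarith [hG n hn]
  have hlog : Real.log (2 * G n / ε) = Real.log (2/ε) + Real.log (G n) := by
    rw [← Real.log_mul (by positivity) (by positivity)]; congr 1; ring
  rw [hlog]
  have hE : 1 ≤ (n:ℝ)^e * L := by
    have h1 := one_le_pow₀ hn1 (n := e)
    calc (1:ℝ) = 1 * 1 := by norm_num
      _ ≤ _ := by gcongr
  have hl3 : Real.log (G n) ≤ |C'| * ((n:ℝ)^e * L) := by
    refine (hGl n hn).trans ?_
    rw [mul_assoc]
    gcongr
    exact le_abs_self _
  have hq : 1 + (Real.log (2/ε) + Real.log (G n)) ≤ (1 + Real.log (2/ε) + |C'|) * ((n:ℝ)^e * L) := by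
    nlinarith
  calc N + 1 + N * (C * (1 + (Real.log (2/ε) + Real.log (G n))))
      ≤ N + N + N * (C * ((1 + Real.log (2/ε) + |C'|) * ((n:ℝ)^e * L))) := by gcongr
    _ = N * (2 * 1 + C * ((1 + Real.log (2/ε) + |C'|) * ((n:ℝ)^e * L))) := by ring
    _ ≤ N * (2 * ((n:ℝ)^e * L) + C * ((1 + Real.log (2/ε) + |C'|) * ((n:ℝ)^e * L))) := by gcongr
    _ = _ := by rw [hN]; ring
end cover


def hpJ2 : Module.End ℂ (ℂ × ℂ) where
  toFun w := (w.1 + w.2, w.2)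
  map_add' a b := by ext <;> simp; ring
  map_smul' c a := by ext <;> simp; ring

theorem hp_J2_pow (k : ℕ) (w : ℂ × ℂ) : (hpJ2 ^ k) w = (w.1 + k * w.2, w.2) := by
  induction k with
  | zero => simp
  | succ k ih =>
    rw [pow_succ', Module.End.mul_apply, ih]
    simp only [hpJ2, LinearMap.coe_mk, AddHom.coe_mk]
    push_cast; ext
    · simp; ring
    · simp

theorem hp_PB_J2 : hpPB hpJ2 1 := by
  classical
  intro ε hε hε2
  obtain ⟨C, hC, hT⟩ := hp_annulus ε hε
  have hl2 : 0 ≤ Real.log (3 / ε) := Real.log_nonneg (by rw [le_div_iff₀ hε]; linarith)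
  refine ⟨2 + C * (2 + Real.log (3/ε)), 1, fun n hn => ?_⟩
  have hn1 : (1:ℝ) ≤ n := by exact_mod_cast hn
  have hln := Real.log_nonneg hn1
  have hR : 1 ≤ 3 * n / ε := by rw [le_div_iff₀ hε]; linarith
  obtain ⟨T, hTc, hT⟩ := hT _ hR
  refine ⟨{((1:ℂ), (0:ℂ))} ∪ (Finset.range n ×ˢ insert 0 T).image (fun p => (p.2 - (p.1:ℂ), (1:ℂ))),
    ?_, ?_, ?_⟩
  · have h1 := Finset.card_union_le {((1:ℂ), (0:ℂ))}
      ((Finset.range n ×ˢ insert 0 T).image (fun p => (p.2 - (p.1:ℂ), (1:ℂ))))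
    have h4 := Finset.card_image_le (s := Finset.range n ×ˢ insert 0 T)
      (f := fun p => (p.2 - (p.1:ℂ), (1:ℂ)))
    rw [Finset.card_product, Finset.card_range] at h4
    have h5 := Finset.card_insert_le 0 T
    have h6 := h1.trans (add_le_add (Finset.card_singleton _).le
      (h4.trans (Nat.mul_le_mul_left n h5)))
    calc _ ≤ ((1 + n * (T.card + 1) : ℕ) : ℝ) := by exact_mod_cast h6
      _ = 1 + n * (T.card + 1) := by push_cast; ring
      _ ≤ n + n * (C * (1 + Real.log (3 * n / ε)) + 1) := by gcongr
      _ = n * (2 * 1 + C * (1 + Real.log (3/ε) + Real.log n)) := by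
        have : Real.log (3 * n / ε) = Real.log (3/ε) + Real.log n := by
          rw [← Real.log_mul (by positivity) (by positivity)]; congr 1; ring
        rw [this]; ring
      _ ≤ n * (2 * (1 + Real.log n) + C * ((2 + Real.log (3/ε)) * (1 + Real.log n))) := by
        gcongr
        · linarith
        · nlinarith
      _ = _ := by ring
  · intro s hs
    simp only [Finset.mem_union, Finset.mem_image, Finset.mem_singleton] at hs
    rcases hs with rfl | ⟨p, -, rfl⟩
    · intro h; exact one_ne_zero (congrArg Prod.fst h)
    · intro h; exact one_ne_zero (congrArg Prod.snd h)
  · rintro ⟨x, y⟩ hv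
    by_cases hxy : n * ‖y‖ * (2/ε) ≤ ‖x‖
    · refine ⟨(1, 0), by simp, x, ?_, fun k hk => ?_⟩
      · rintro rfl
        have : ‖y‖ = 0 := by
          by_contra hy
          have : 0 < n * ‖y‖ * (2/ε) := by
            have := (norm_nonneg y).lt_of_ne' hy
            positivity
          simp at hxy; linarith
        apply hv; simp at this; simp [this]
      · rw [hp_J2_pow, hp_J2_pow]
        have hkn : (k:ℝ) ≤ n := by exact_mod_cast hk.le
        have hny : n * ‖y‖ ≤ ε * ‖x + k * y‖ := by
          have h1 : ‖x‖ - k * ‖y‖ ≤ ‖x + k * y‖ := by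
            have := norm_sub_norm_le x (-(k * y))
            simpa using this
          have h2 : ‖x‖ - n * ‖y‖ ≤ ‖x + k * y‖ := by nlinarith [norm_nonneg y]
          have h3 : n * ‖y‖ * 2 ≤ ε * ‖x‖ := by
            have : n * ‖y‖ * (2/ε) * ε = n * ‖y‖ * 2 := by field_simp
            nlinarith
          have h4 : 0 ≤ n * ‖y‖ := by positivity
          nlinarith
        have hle : ε * ‖x + k * y‖ ≤ ε * ‖(x + k * y, y)‖ := by
          gcongr; exact norm_fst_le (x + k * y, y)
        refine le_trans (max_le ?_ ?_) (hny.trans hle)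
        · simp; gcongr
        · simp; nlinarith [norm_nonneg y]
    · push Not at hxy
      have hy0 : y ≠ 0 := by
        rintro rfl
        simp at hxy; linarith [norm_nonneg x]
      have hyp : 0 < ‖y‖ := norm_pos_iff.2 hy0
      set r := x / y with hr
      have hrn : ‖r‖ ≤ 2 * n / ε := by
        rw [hr, norm_div, div_le_iff₀ hyp]
        refine hxy.le.trans (le_of_eq (by ring))
      obtain ⟨m, hm, hmin⟩ := Finset.exists_min_image (Finset.range n) (fun m : ℕ => ‖r + m‖)
        ⟨0, by simp; omega⟩
      have key : ∃ s' ∈ insert 0 T, ∀ k < n, ‖r + m - s'‖ ≤ ε * max ‖r + k‖ 1 := by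
        by_cases hs : ‖r + m‖ ≤ ε
        · refine ⟨0, by simp, fun k _ => ?_⟩
          rw [sub_zero]
          have := le_max_right ‖r + k‖ 1
          nlinarith
        · push Not at hs
          obtain ⟨t', ht', htt⟩ := hT (r + m) (by
              refine le_trans ?_ hs.le
              rw [one_div_div, div_le_iff₀ (by positivity)]
              nlinarith) (by
              have hmn : (m:ℝ) ≤ n := by
                have := Finset.mem_range.1 hm
                exact_mod_cast this.le
              have h1 : ‖r + m‖ ≤ ‖r‖ + m := by simpa using norm_add_le r (m:ℂ)
              have h2 : (n:ℝ) ≤ n / ε := by rw [le_div_iff₀ hε]; nlinarith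
              have h3 : 3 * n / ε = 2 * n / ε + n / ε := by ring
              linarith)
          refine ⟨t', by simp [ht'], fun k hk => htt.trans ?_⟩
          gcongr
          exact (hmin k (Finset.mem_range.2 hk)).trans (le_max_left _ _)
      obtain ⟨s', hs', hss⟩ := key
      refine ⟨(s' - m, 1), ?_, y, hy0, fun k hk => ?_⟩
      · refine Finset.mem_union_right _ (Finset.mem_image.2 ⟨(m, s'), ?_, rfl⟩)
        exact Finset.mem_product.2 ⟨hm, hs'⟩
      · have hx : x = y * r := by rw [hr]; field_simp
        have e1 : (hpJ2 ^ k) ((x, y) - y • (s' - (m:ℂ), (1:ℂ))) = (y * (r + m - s'), 0) := by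
          rw [hp_J2_pow]
          ext
          · simp [hx]; ring
          · simp
        have e2 : (hpJ2 ^ k) (x, y) = y • (r + k, (1:ℂ)) := by
          rw [hp_J2_pow]
          ext
          · simp [hx]; ring
          · simp
        rw [e1, e2, norm_smul]
        have e3 : ‖(r + (k:ℂ), (1:ℂ))‖ = max ‖r + k‖ 1 := by simp [Prod.norm_def]
        have e4 : ‖(y * (r + m - s'), (0:ℂ))‖ = ‖y‖ * ‖r + m - s'‖ := by
          simp [Prod.norm_def]; positivity
        rw [e3, e4]
        have := hss k hk
        nlinarith

def hpJ3 : Module.End ℂ ((ℂ × ℂ) × ℂ) where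
  toFun w := ((w.1.1 + w.1.2 + w.2, w.1.2 + 2 * w.2), w.2)
  map_add' a b := by ext <;> simp <;> ring
  map_smul' c a := by ext <;> simp <;> ring

theorem hp_J3_pow (k : ℕ) (w : (ℂ × ℂ) × ℂ) :
    (hpJ3 ^ k) w = ((w.1.1 + k * w.1.2 + k ^ 2 * w.2, w.1.2 + 2 * k * w.2), w.2) := by
  induction k with
  | zero => simp
  | succ k ih =>
    rw [pow_succ', Module.End.mul_apply, ih]
    simp only [hpJ3, LinearMap.coe_mk, AddHom.coe_mk]
    push_cast; ext
    · simp; ring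
    · simp; ring
    · simp

/-- product of linear polynomials -/
def hpMul (a b : ℂ × ℂ) : (ℂ × ℂ) × ℂ := ((a.1 * b.1, a.1 * b.2 + a.2 * b.1), a.2 * b.2)

theorem hp_J3_mul (k : ℕ) (a b : ℂ × ℂ) :
    (hpJ3 ^ k) (hpMul a b) = hpMul ((hpJ2 ^ k) a) ((hpJ2 ^ k) b) := by
  rw [hp_J3_pow, hp_J2_pow, hp_J2_pow]
  ext <;> simp [hpMul] <;> ring

theorem hp_mul_le (a b : ℂ × ℂ) : ‖hpMul a b‖ ≤ 2 * (‖a‖ * ‖b‖) := by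
  have a1 := norm_fst_le a
  have a2 := norm_snd_le a
  have b1 := norm_fst_le b
  have b2 := norm_snd_le b
  have h (p q : ℂ) (hp : ‖p‖ ≤ ‖a‖) (hq : ‖q‖ ≤ ‖b‖) : ‖p * q‖ ≤ ‖a‖ * ‖b‖ := by
    rw [norm_mul]; gcongr
  have h0 : 0 ≤ ‖a‖ * ‖b‖ := by positivity
  refine max_le (max_le ?_ ?_) ?_
  · have := h _ _ a1 b1; simp only [hpMul]; linarith
  · have := h _ _ a1 b2
    have := h _ _ a2 b1
    have := norm_add_le (a.1 * b.2) (a.2 * b.1)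
    simp only [hpMul]; linarith
  · have := h _ _ a2 b2; simp only [hpMul]; linarith

theorem hp_le_mul (a b : ℂ × ℂ) : ‖a‖ * ‖b‖ ≤ 2 * ‖hpMul a b‖ := by
  have m1 : ‖a.1‖ * ‖b.1‖ ≤ ‖hpMul a b‖ := by
    rw [← norm_mul]
    exact (norm_fst_le (hpMul a b).1).trans (norm_fst_le (hpMul a b))
  have m2 : ‖a.1 * b.2 + a.2 * b.1‖ ≤ ‖hpMul a b‖ :=
    (norm_snd_le (hpMul a b).1).trans (norm_fst_le (hpMul a b))
  have m3 : ‖a.2‖ * ‖b.2‖ ≤ ‖hpMul a b‖ := by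
    rw [← norm_mul]
    exact norm_snd_le (hpMul a b)
  have m4 : ‖a.1‖ * ‖b.2‖ - ‖a.2‖ * ‖b.1‖ ≤ ‖hpMul a b‖ := by
    have := norm_sub_le (a.1 * b.2 + a.2 * b.1) (a.2 * b.1)
    rw [add_sub_cancel_right, norm_mul, norm_mul] at this
    linarith
  have m5 : ‖a.2‖ * ‖b.1‖ - ‖a.1‖ * ‖b.2‖ ≤ ‖hpMul a b‖ := by
    have := norm_sub_le (a.1 * b.2 + a.2 * b.1) (a.1 * b.2)
    rw [add_sub_cancel_left, norm_mul, norm_mul] at this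
    linarith
  rw [Prod.norm_def a, Prod.norm_def b]
  have p1 := norm_nonneg a.1
  have p2 := norm_nonneg a.2
  have p3 := norm_nonneg b.1
  have p4 := norm_nonneg b.2
  have pM := norm_nonneg (hpMul a b)
  generalize ‖a.1‖ = A1 at *
  generalize ‖a.2‖ = A2 at *
  generalize ‖b.1‖ = B1 at *
  generalize ‖b.2‖ = B2 at *
  generalize ‖hpMul a b‖ = M at *
  rcases le_total A1 A2 with hA | hA <;> rcases le_total B1 B2 with hB | hB
  · rw [max_eq_right hA, max_eq_right hB]; linarith
  · rw [max_eq_right hA, max_eq_left hB]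
    by_contra hcon
    push Not at hcon
    have q1 : M < A1 * B2 := by linarith
    have q2 : A1 * B2 ≤ A1 * B1 := by gcongr
    linarith
  · rw [max_eq_left hA, max_eq_right hB]
    by_contra hcon
    push Not at hcon
    have q1 : M < A2 * B1 := by linarith
    have q2 : A2 * B1 ≤ A1 * B1 := by gcongr
    linarith
  · rw [max_eq_left hA, max_eq_left hB]; linarith

theorem hp_mul_ne {a b : ℂ × ℂ} (ha : a ≠ 0) (hb : b ≠ 0) : hpMul a b ≠ 0 := by
  intro h
  have := hp_le_mul a b
  rw [h, norm_zero, mul_zero] at this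
  have h1 := norm_pos_iff.2 ha
  have h2 := norm_pos_iff.2 hb
  have := mul_pos h1 h2
  linarith

theorem hp_mul_surj (w : (ℂ × ℂ) × ℂ) (hw : w ≠ 0) : ∃ a b, a ≠ 0 ∧ b ≠ 0 ∧ hpMul a b = w := by
  obtain ⟨⟨x, y⟩, z⟩ := w
  have main : ∃ a b, hpMul a b = ((x, y), z) := by
    by_cases hz : z = 0
    · exact ⟨(x, y), (1, 0), by simp [hpMul, hz]⟩
    · obtain ⟨s, hs⟩ := IsAlgClosed.exists_eq_mul_self (y ^ 2 - 4 * x * z)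
      refine ⟨((y + s) / 2, z), ((y - s) / (2 * z), 1), ?_⟩
      have h1 : (y + s) / 2 * ((y - s) / (2 * z)) = x := by
        field_simp
        linear_combination hs
      have h2 : (y + s) / 2 * 1 + z * ((y - s) / (2 * z)) = y := by
        field_simp; ring
      simp only [mul_one] at h2
      simp only [hpMul, h1, mul_one, h2]
  obtain ⟨a, b, h⟩ := main
  refine ⟨a, b, ?_, ?_, h⟩
  · rintro rfl; apply hw; rw [← h]; simp [hpMul]
  · rintro rfl; apply hw; rw [← h]; simp [hpMul]

theorem hp_PB_J3 : hpPB hpJ3 2 := by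
  classical
  intro ε hε hε2
  obtain ⟨C, m, h⟩ := hp_PB_J2 (ε / 12) (by positivity) (by linarith)
  refine ⟨C ^ 2, m * 2, fun n hn => ?_⟩
  obtain ⟨S, hSc, hS0, hS⟩ := h n hn
  refine ⟨(S ×ˢ S).image (fun p => hpMul p.1 p.2), ?_, ?_, ?_⟩
  · calc _ ≤ (((S ×ˢ S).card : ℕ) : ℝ) := by exact_mod_cast Finset.card_image_le
      _ = (S.card : ℝ) ^ 2 := by rw [Finset.card_product]; push_cast; ring
      _ ≤ (C * (n:ℝ) ^ 1 * (1 + Real.log n) ^ m) ^ 2 := by gcongr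
      _ = _ := by rw [pow_mul]; ring
  · intro s hs
    simp only [Finset.mem_image, Finset.mem_product] at hs
    obtain ⟨p, ⟨h1, h2⟩, rfl⟩ := hs
    exact hp_mul_ne (hS0 _ h1) (hS0 _ h2)
  · intro w hw
    obtain ⟨a, b, ha, hb, rfl⟩ := hp_mul_surj w hw
    obtain ⟨s, hs, c, hc, hk⟩ := hS a ha
    obtain ⟨s', hs', c', hc', hk'⟩ := hS b hb
    refine ⟨hpMul s s', Finset.mem_image.2 ⟨(s, s'), Finset.mem_product.2 ⟨hs, hs'⟩, rfl⟩,
      c * c', mul_ne_zero hc hc', fun k hkn => ?_⟩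
    have e0 : hpMul a b - (c * c') • hpMul s s' = hpMul (a - c • s) b + hpMul (c • s) (b - c' • s') := by
      ext <;> simp [hpMul] <;> ring
    rw [e0, map_add, hp_J3_mul, hp_J3_mul, hp_J3_mul]
    have h1 := hk k hkn
    have h2 := hk' k hkn
    have h3 : ‖(hpJ2 ^ k) (c • s)‖ ≤ 2 * ‖(hpJ2 ^ k) a‖ := by
      have : (hpJ2 ^ k) (c • s) = (hpJ2 ^ k) a - (hpJ2 ^ k) (a - c • s) := by
        rw [← map_sub, sub_sub_cancel]
      rw [this]
      refine (norm_sub_le _ _).trans ?_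
      nlinarith [norm_nonneg ((hpJ2 ^ k) a)]
    set u := (hpJ2 ^ k) a
    set v := (hpJ2 ^ k) b
    set p := (hpJ2 ^ k) (a - c • s)
    set q := (hpJ2 ^ k) (b - c' • s')
    set r := (hpJ2 ^ k) (c • s)
    calc ‖hpMul p v + hpMul r q‖ ≤ ‖hpMul p v‖ + ‖hpMul r q‖ := norm_add_le _ _
      _ ≤ 2 * (‖p‖ * ‖v‖) + 2 * (‖r‖ * ‖q‖) := add_le_add (hp_mul_le _ _) (hp_mul_le _ _)
      _ ≤ 2 * ((ε/12 * ‖u‖) * ‖v‖) + 2 * ((2 * ‖u‖) * (ε/12 * ‖v‖)) := by gcongr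
      _ = ε/2 * (‖u‖ * ‖v‖) := by ring
      _ ≤ ε/2 * (2 * ‖hpMul u v‖) := mul_le_mul_of_nonneg_left (hp_le_mul u v) (by positivity)
      _ = _ := by ring


section growth
variable {V : Type*} [NormedAddCommGroup V] [NormedSpace ℂ V]

def hpGr (B : Module.End ℂ V) (μ : ℂ) (M : ℝ) : Prop :=
  ∀ (k : ℕ) (v : V), ‖(B ^ k) v‖ ≤ (k + 1) * M ^ k * ‖μ‖ ^ k * ‖v‖ ∧
    ‖μ‖ ^ k * ‖v‖ ≤ (k + 1) * M ^ k * ‖(B ^ k) v‖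

theorem hp_PB_gr {B : Module.End ℂ V} {d : ℕ} (h : hpPB B d) {μ : ℂ} {M : ℝ} (hM : 1 ≤ M)
    (hg : hpGr B μ M) (e : ℕ) (he : e = 1 ∨ M = 1) : hpPB (hpBlk B μ) (d + e) := by
  have aux : ∀ n k : ℕ, k < n → ((k:ℝ) + 1) * M ^ k ≤ n * M ^ n := by
    intro n k hk
    have h1 : (k:ℝ) + 1 ≤ n := by exact_mod_cast hk
    have h2 : M ^ k ≤ M ^ n := pow_le_pow_right₀ hM hk.le
    gcongr
  refine hp_PB_blk h μ e (fun n => n * M ^ n) (1 + Real.log M) ?_ ?_ ?_ ?_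
  · intro n hn
    have h1 : (1:ℝ) ≤ n := by exact_mod_cast hn
    have h2 : 1 ≤ M ^ n := one_le_pow₀ hM
    show 1 ≤ n * M ^ n
    nlinarith
  · intro n _ k hk v
    refine (hg k v).1.trans ?_
    have := aux n k hk
    gcongr
  · intro n _ k hk v
    refine (hg k v).2.trans ?_
    have := aux n k hk
    gcongr
  · intro n hn
    have h1 : (1:ℝ) ≤ n := by exact_mod_cast hn
    have hln := Real.log_nonneg h1
    have hlM := Real.log_nonneg hM
    rw [Real.log_mul (by positivity) (by positivity), Real.log_pow]
    rcases he with rfl | rfl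
    · rw [pow_one]
      nlinarith [mul_nonneg hlM hln, mul_nonneg (mul_nonneg hlM hln) (by linarith : (0:ℝ) ≤ n)]
    · have := one_le_pow₀ h1 (n := e)
      simp only [Real.log_one, mul_zero, add_zero, one_mul]
      nlinarith

theorem hp_Gr_blk {B : Module.End ℂ V} {b μ : ℂ} {M : ℝ} (hM : 1 ≤ M) (h : hpGr B μ M)
    (h1 : ‖b‖ ≤ M * ‖μ‖) (h2 : ‖μ‖ ≤ M * ‖b‖) : hpGr (hpBlk B b) μ M := by
  rintro k ⟨v, z⟩
  rw [hp_Blk_pow]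
  have hk1 : (0:ℝ) ≤ k := by positivity
  have e1 : ‖b‖ ^ k ≤ M ^ k * ‖μ‖ ^ k := by rw [← mul_pow]; gcongr
  have e2 : ‖μ‖ ^ k ≤ M ^ k * ‖b‖ ^ k := by rw [← mul_pow]; gcongr
  have hMk : 0 ≤ M ^ k := by positivity
  constructor
  · refine max_le ?_ ?_
    · refine (h k v).1.trans ?_
      gcongr
      exact norm_fst_le (v, z)
    · have h3 : ‖z‖ ≤ ‖(v, z)‖ := norm_snd_le (v, z)
      show ‖b ^ k * z‖ ≤ _
      rw [norm_mul, norm_pow]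
      calc ‖b‖ ^ k * ‖z‖ ≤ (M ^ k * ‖μ‖ ^ k) * ‖(v, z)‖ := by gcongr
        _ = 1 * M ^ k * ‖μ‖ ^ k * ‖(v, z)‖ := by ring
        _ ≤ _ := by gcongr; linarith
  · have h3 : ‖(B ^ k) v‖ ≤ ‖((B ^ k) v, b ^ k * z)‖ := norm_fst_le ((B ^ k) v, b ^ k * z)
    have h4 : ‖b ^ k * z‖ ≤ ‖((B ^ k) v, b ^ k * z)‖ := norm_snd_le ((B ^ k) v, b ^ k * z)
    rw [norm_mul, norm_pow] at h4
    rw [Prod.norm_mk v z, mul_max_of_nonneg _ _ (by positivity)]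
    refine max_le ?_ ?_
    · refine (h k v).2.trans ?_
      gcongr
    · calc ‖μ‖ ^ k * ‖z‖ ≤ (M ^ k * ‖b‖ ^ k) * ‖z‖ := by gcongr
        _ = 1 * M ^ k * (‖b‖ ^ k * ‖z‖) := by ring
        _ ≤ _ := by gcongr; linarith

theorem hp_sc_pow (a : ℂ) (k : ℕ) (v : ℂ) : ((a • (1 : Module.End ℂ ℂ)) ^ k) v = a ^ k * v := by
  rw [smul_pow, one_pow]; simp

theorem hp_Gr_sc {a μ : ℂ} {M : ℝ} (hM : 1 ≤ M)
    (h1 : ‖a‖ ≤ M * ‖μ‖) (h2 : ‖μ‖ ≤ M * ‖a‖) : hpGr (a • (1 : Module.End ℂ ℂ)) μ M := by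
  intro k v
  rw [hp_sc_pow, norm_mul, norm_pow]
  have hk1 : (0:ℝ) ≤ k := by positivity
  have e1 : ‖a‖ ^ k ≤ M ^ k * ‖μ‖ ^ k := by rw [← mul_pow]; gcongr
  have e2 : ‖μ‖ ^ k ≤ M ^ k * ‖a‖ ^ k := by rw [← mul_pow]; gcongr
  constructor
  · calc ‖a‖ ^ k * ‖v‖ ≤ (M ^ k * ‖μ‖ ^ k) * ‖v‖ := by gcongr
      _ = 1 * M ^ k * ‖μ‖ ^ k * ‖v‖ := by ring
      _ ≤ _ := by gcongr; linarith
  · calc ‖μ‖ ^ k * ‖v‖ ≤ (M ^ k * ‖a‖ ^ k) * ‖v‖ := by gcongr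
      _ = 1 * M ^ k * (‖a‖ ^ k * ‖v‖) := by ring
      _ ≤ _ := by gcongr; linarith

theorem hp_Gr_J2 {μ : ℂ} {M : ℝ} (hM : 1 ≤ M)
    (h1 : 1 ≤ M * ‖μ‖) (h2 : ‖μ‖ ≤ M) : hpGr hpJ2 μ M := by
  have aux : ∀ (k : ℕ) (x y z : ℂ), ‖z‖ = k * ‖y‖ → ‖(x + z, y)‖ ≤ (k + 1) * ‖(x, y)‖ := by
    intro k x y z hz
    have p1 : ‖x‖ ≤ ‖(x, y)‖ := norm_fst_le (x, y)
    have p2 : ‖y‖ ≤ ‖(x, y)‖ := norm_snd_le (x, y)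
    have hk : (0:ℝ) ≤ k := by positivity
    refine max_le ?_ ?_
    · refine (norm_add_le _ _).trans ?_
      show ‖x‖ + ‖z‖ ≤ _
      rw [hz]; nlinarith
    · show ‖y‖ ≤ _
      nlinarith [norm_nonneg y]
  rintro k ⟨x, y⟩
  rw [hp_J2_pow]
  have e1 : 1 ≤ M ^ k * ‖μ‖ ^ k := by rw [← mul_pow]; exact one_le_pow₀ h1
  have e2 : ‖μ‖ ^ k ≤ M ^ k := by gcongr
  constructor
  · refine (aux k x y (k * y) (by simp)).trans ?_
    calc (k + 1) * ‖(x, y)‖ = (k + 1) * 1 * ‖(x, y)‖ := by ring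
      _ ≤ (k + 1) * (M ^ k * ‖μ‖ ^ k) * ‖(x, y)‖ := by gcongr
      _ = _ := by ring
  · have := aux k (x + k * y) y (-(k * y)) (by simp)
    rw [add_neg_cancel_right] at this
    calc ‖μ‖ ^ k * ‖(x, y)‖ ≤ M ^ k * ((k + 1) * ‖(x + k * y, y)‖) := by gcongr
      _ = _ := by ring

end growth

abbrev hpW := (ℂ × ℂ) × ℂ

noncomputable def hpDiag (a b c : ℂ) : Module.End ℂ hpW := hpBlk (hpBlk (a • (1 : Module.End ℂ ℂ)) b) c

theorem hp_diag_pow (a b c : ℂ) (k : ℕ) (w : hpW) :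
    (hpDiag a b c ^ k) w = ((a ^ k * w.1.1, b ^ k * w.1.2), c ^ k * w.2) := by
  rw [hpDiag, hp_Blk_pow, hp_Blk_pow, hp_sc_pow]

/-- existence of a ratio bound -/
theorem hp_ratio {a b : ℂ} (ha : a ≠ 0) (hb : b ≠ 0) : ∃ M : ℝ, 1 ≤ M ∧
    ∀ M', M ≤ M' → ‖a‖ ≤ M' * ‖b‖ ∧ ‖b‖ ≤ M' * ‖a‖ := by
  have ha' := norm_pos_iff.2 ha
  have hb' := norm_pos_iff.2 hb
  refine ⟨max 1 (max (‖a‖ / ‖b‖) (‖b‖ / ‖a‖)), le_max_left _ _, fun M' hM' => ⟨?_, ?_⟩⟩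
  · rw [← div_le_iff₀ hb']
    exact (le_max_left _ _).trans ((le_max_right _ _).trans hM')
  · rw [← div_le_iff₀ ha']
    exact (le_max_right _ _).trans ((le_max_right _ _).trans hM')

theorem hp_PB_diag0 {a b c : ℂ} (h1 : ‖a‖ = ‖b‖) (h2 : ‖b‖ = ‖c‖) : hpPB (hpDiag a b c) 0 := by
  have := hp_PB_gr (hp_PB_one (a • 1)) le_rfl
    (hp_Gr_sc (a := a) (μ := b) le_rfl (by linarith) (by linarith)) 0 (Or.inr rfl)
  exact hp_PB_gr this le_rfl (hp_Gr_blk le_rfl (hp_Gr_sc (a := a) (μ := c) le_rfl (by linarith)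
    (by linarith)) (by linarith) (by linarith)) 0 (Or.inr rfl)

theorem hp_PB_diag_last {a b c : ℂ} {d : ℕ} (ha : a ≠ 0) (hb : b ≠ 0) (hc : c ≠ 0)
    (h : hpPB (hpBlk (a • (1 : Module.End ℂ ℂ)) b) d) : hpPB (hpDiag a b c) (d + 1) := by
  obtain ⟨M, hM, hMM⟩ := hp_ratio ha hc
  obtain ⟨M', hM', hMM'⟩ := hp_ratio hb hc
  have hm : 1 ≤ max M M' := hM.trans (le_max_left _ _)
  obtain ⟨p1, p2⟩ := hMM _ (le_max_left M M')
  obtain ⟨p3, p4⟩ := hMM' _ (le_max_right M M')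
  exact hp_PB_gr h hm (hp_Gr_blk hm (hp_Gr_sc hm p1 p2) p3 p4) 1 (Or.inl rfl)

theorem hp_PB_diag1 {a b c : ℂ} (ha : a ≠ 0) (hb : b ≠ 0) (hc : c ≠ 0) (h1 : ‖a‖ = ‖b‖) :
    hpPB (hpDiag a b c) 1 :=
  hp_PB_diag_last (d := 0) ha hb hc (hp_PB_gr (hp_PB_one (a • 1)) le_rfl
    (hp_Gr_sc (a := a) (μ := b) le_rfl (by linarith) (by linarith)) 0 (Or.inr rfl))

theorem hp_PB_diag2 {a b c : ℂ} (ha : a ≠ 0) (hb : b ≠ 0) (hc : c ≠ 0) :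
    hpPB (hpDiag a b c) 2 := by
  obtain ⟨M, hM, hMM⟩ := hp_ratio ha hb
  obtain ⟨p1, p2⟩ := hMM _ le_rfl
  exact hp_PB_diag_last (d := 1) ha hb hc (hp_PB_gr (hp_PB_one (a • 1)) hM
    (hp_Gr_sc (a := a) (μ := b) hM p1 p2) 1 (Or.inl rfl))

theorem hp_PB_J21 {μ : ℂ} (h1 : ‖μ‖ = 1) : hpPB (hpBlk hpJ2 μ) 1 :=
  hp_PB_gr hp_PB_J2 le_rfl (hp_Gr_J2 le_rfl (by linarith) (by linarith)) 0 (Or.inr rfl)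

theorem hp_PB_J22 {μ : ℂ} (h1 : μ ≠ 0) : hpPB (hpBlk hpJ2 μ) 2 := by
  obtain ⟨M, hM, hMM⟩ := hp_ratio one_ne_zero h1
  obtain ⟨p1, p2⟩ := hMM _ le_rfl
  rw [norm_one] at p1 p2
  exact hp_PB_gr hp_PB_J2 hM (hp_Gr_J2 hM p1 (by linarith)) 1 (Or.inl rfl)


noncomputable def hpPsi (w : hpW) : (ℝ × ℝ) × ℝ := ((‖w.1.1‖ / ‖w‖, ‖w.1.2‖ / ‖w‖), ‖w.2‖ / ‖w‖)

def hpModel [MetricSpace X] (f : X → X) (B : Module.End ℂ hpW) : Prop :=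
  Function.Injective B ∧ ∃ π : hpW → X,
    (∀ x, ∃ w, w ≠ 0 ∧ π w = x) ∧
    (∀ (c : ℂ) (w : hpW), c ≠ 0 → w ≠ 0 → π (c • w) = π w) ∧
    (∀ w, w ≠ 0 → f (π w) = π (B w)) ∧
    (∀ ε : ℝ, 0 < ε → ∃ δ : ℝ, 0 < δ ∧ ∀ w w' : hpW, w ≠ 0 → w' ≠ 0 → ‖w - w'‖ ≤ δ * ‖w‖ →
      dist (π w) (π w') < ε) ∧
    (∀ δ : ℝ, 0 < δ → ∃ ε : ℝ, 0 < ε ∧ ∀ w w' : hpW, w ≠ 0 → w' ≠ 0 → dist (π w) (π w') < ε →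
      dist (hpPsi w) (hpPsi w') < δ)

theorem hp_pow_ne {B : Module.End ℂ hpW} (hB : Function.Injective B) (k : ℕ) {w : hpW} (hw : w ≠ 0) :
    (B ^ k) w ≠ 0 := by
  induction k with
  | zero => simpa
  | succ k ih =>
    rw [pow_succ', Module.End.mul_apply]
    intro h
    exact ih (hB (by rw [h, map_zero]))

theorem hp_iter {f : X → X} {B : Module.End ℂ hpW} (hB : Function.Injective B) {π : hpW → X}
    (h : ∀ w, w ≠ 0 → f (π w) = π (B w)) (k : ℕ) {w : hpW} (hw : w ≠ 0) :
    f^[k] (π w) = π ((B ^ k) w) := by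
  induction k with
  | zero => simp
  | succ k ih =>
    rw [Function.iterate_succ_apply', ih, h _ (hp_pow_ne hB k hw), pow_succ', Module.End.mul_apply]

theorem hp_UB_of_PB [MetricSpace X] {f : X → X} {B : Module.End ℂ hpW} (hm : hpModel f B) {d : ℕ}
    (h : hpPB B d) : hpUB f d := by
  classical
  obtain ⟨hB, π, h1, h2, h3, h4, -⟩ := hm
  intro ε hε
  obtain ⟨δ, hδ, h4⟩ := h4 ε hε
  obtain ⟨C, m, h⟩ := h (min δ (1/2)) (by positivity) (min_le_right _ _)
  refine ⟨C, m, fun n hn => ?_⟩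
  obtain ⟨S, hSc, hS0, hS⟩ := h n hn
  refine ⟨S.image π, le_trans (by exact_mod_cast Finset.card_image_le) hSc, fun x => ?_⟩
  obtain ⟨w, hw, rfl⟩ := h1 x
  obtain ⟨s, hs, c, hc, hk⟩ := hS w hw
  refine ⟨π s, Finset.mem_image_of_mem _ hs, fun j hj => ?_⟩
  have hcs : c • s ≠ 0 := smul_ne_zero hc (hS0 s hs)
  rw [← h2 c s hc (hS0 s hs), hp_iter hB h3 j hw, hp_iter hB h3 j hcs]
  refine h4 _ _ (hp_pow_ne hB j hw) (hp_pow_ne hB j hcs) ?_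
  rw [← map_sub]
  refine (hk j hj).trans ?_
  gcongr
  exact min_le_left _ _

theorem hp_low [MetricSpace X] {f : X → X} {B : Module.End ℂ hpW} (hm : hpModel f B) {l k : ℕ}
    (hub : hpUB f l) (δ : ℝ) (hδ : 0 < δ) (K : ℕ) (hK : 1 ≤ K)
    (h : ∀ m : ℕ, 1 ≤ m → ∃ (ι : Type) (_ : Fintype ι) (w : ι → hpW), m ^ k ≤ Fintype.card ι ∧
      (∀ i, w i ≠ 0) ∧
      ∀ i j, i ≠ j → ∃ t < K * m, δ ≤ dist (hpPsi ((B ^ t) (w i))) (hpPsi ((B ^ t) (w j)))) :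
    (k : ℝ≥0∞) ≤ hpol f := by
  obtain ⟨hB, π, h1, h2, h3, -, h5⟩ := hm
  obtain ⟨ε, hε, h5⟩ := h5 δ hδ
  refine hp_ge hub K hK ε hε fun m hm => ?_
  obtain ⟨ι, hι, w, hc, hw, hs⟩ := h m hm
  refine ⟨ι, hι, fun i => π (w i), hc, fun i j hij => ?_⟩
  obtain ⟨t, ht, htt⟩ := hs i j hij
  refine ⟨t, ht, ?_⟩
  by_contra hcon
  push Not at hcon
  rw [hp_iter hB h3 t (hw i), hp_iter hB h3 t (hw j)] at hcon
  have := h5 _ _ (hp_pow_ne hB t (hw i)) (hp_pow_ne hB t (hw j)) hcon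
  linarith

theorem hp_low1 [MetricSpace X] {f : X → X} {B : Module.End ℂ hpW} (hm : hpModel f B) {l : ℕ}
    (hub : hpUB f l) (δ : ℝ) (hδ : 0 < δ) (K : ℕ) (hK : 1 ≤ K) (w : ℕ → hpW) (hw : ∀ i, w i ≠ 0)
    (h : ∀ m p p' : ℕ, p < p' → p' < m →
       ∃ t < K * m, δ ≤ dist (hpPsi ((B ^ t) (w p))) (hpPsi ((B ^ t) (w p')))) :
    (1 : ℝ≥0∞) ≤ hpol f := by
  have := hp_low (k := 1) hm hub δ hδ K hK (fun m hm => ⟨Fin m, inferInstance, fun i => w i, by simp,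
    fun i => hw i, fun i j hij => ?_⟩)
  · simpa using this
  · rcases lt_or_gt_of_ne hij with hlt | hlt
    · exact h m i j hlt j.2
    · obtain ⟨t, ht, htt⟩ := h m j i hlt i.2
      exact ⟨t, ht, by rwa [dist_comm]⟩

theorem hp_low2 [MetricSpace X] {f : X → X} {B : Module.End ℂ hpW} (hm : hpModel f B) {l : ℕ}
    (hub : hpUB f l) (δ : ℝ) (hδ : 0 < δ) (K : ℕ) (hK : 1 ≤ K) (w : ℕ → ℕ → ℕ → hpW)
    (hw : ∀ m i j, w m i j ≠ 0)
    (h1 : ∀ m p p' q q' : ℕ, p < p' → p' < m → q < m → q' < m →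
       ∃ t < K * m, δ ≤ dist (hpPsi ((B ^ t) (w m p q))) (hpPsi ((B ^ t) (w m p' q'))))
    (h2 : ∀ m p q q' : ℕ, p < m → q < q' → q' < m →
       ∃ t < K * m, δ ≤ dist (hpPsi ((B ^ t) (w m p q))) (hpPsi ((B ^ t) (w m p q')))) :
    (2 : ℝ≥0∞) ≤ hpol f := by
  have := hp_low (k := 2) hm hub δ hδ K hK (fun m hm => ⟨Fin m × Fin m, inferInstance,
    fun i => w m i.1 i.2, by simp [sq], fun i => hw _ _ _, ?_⟩)
  · simpa using this
  · rintro ⟨p, q⟩ ⟨p', q'⟩ hne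
    by_cases hp : p = p'
    · subst hp
      have hq : q ≠ q' := fun h => hne (by rw [h])
      rcases lt_or_gt_of_ne hq with hlt | hlt
      · exact h2 m p q q' p.2 hlt q'.2
      · obtain ⟨t, ht, htt⟩ := h2 m p q' q p.2 hlt q.2
        exact ⟨t, ht, by rwa [dist_comm]⟩
    · rcases lt_or_gt_of_ne hp with hlt | hlt
      · exact h1 m p p' q q' hlt p'.2 q.2 q'.2
      · obtain ⟨t, ht, htt⟩ := h1 m p' p q' q hlt p.2 q'.2 q.2
        exact ⟨t, ht, by rwa [dist_comm]⟩

theorem hp_aux_div {a b c d α β : ℝ} (hb : 0 < b) (hd : 0 < d) (h : α * b ≤ a) (h' : c ≤ β * d) :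
    α - β ≤ |a / b - c / d| := by
  have h1 : α ≤ a / b := by rwa [le_div_iff₀ hb]
  have h2 : c / d ≤ β := by rwa [div_le_iff₀ hd]
  have := le_abs_self (a / b - c / d)
  linarith

theorem hp_dist0 {w w' : hpW} {α β : ℝ} (hw : w ≠ 0) (hw' : w' ≠ 0) (h : α * ‖w‖ ≤ ‖w.1.1‖)
    (h' : ‖w'.1.1‖ ≤ β * ‖w'‖) : α - β ≤ dist (hpPsi w) (hpPsi w') :=
  (hp_aux_div (norm_pos_iff.2 hw) (norm_pos_iff.2 hw') h h').trans
    ((le_max_left _ _).trans (le_max_left _ _))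

theorem hp_dist1 {w w' : hpW} {α β : ℝ} (hw : w ≠ 0) (hw' : w' ≠ 0) (h : α * ‖w‖ ≤ ‖w.1.2‖)
    (h' : ‖w'.1.2‖ ≤ β * ‖w'‖) : α - β ≤ dist (hpPsi w) (hpPsi w') :=
  (hp_aux_div (norm_pos_iff.2 hw) (norm_pos_iff.2 hw') h h').trans
    ((le_max_right _ _).trans (le_max_left _ _))

theorem hp_dist2 {w w' : hpW} {α β : ℝ} (hw : w ≠ 0) (hw' : w' ≠ 0) (h : α * ‖w‖ ≤ ‖w.2‖)
    (h' : ‖w'.2‖ ≤ β * ‖w'‖) : α - β ≤ dist (hpPsi w) (hpPsi w') :=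
  (hp_aux_div (norm_pos_iff.2 hw) (norm_pos_iff.2 hw') h h').trans (le_max_right _ _)

theorem hp_norm_le {w : hpW} {r : ℝ} (h1 : ‖w.1.1‖ ≤ r) (h2 : ‖w.1.2‖ ≤ r) (h3 : ‖w.2‖ ≤ r) :
    ‖w‖ ≤ r := max_le (max_le h1 h2) h3
theorem hp_norm0 (w : hpW) : ‖w.1.1‖ ≤ ‖w‖ := (norm_fst_le w.1).trans (norm_fst_le w)
theorem hp_norm1 (w : hpW) : ‖w.1.2‖ ≤ ‖w‖ := (norm_snd_le w.1).trans (norm_fst_le w)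

theorem hp_pow_ratio {a b : ℝ} (ha : 0 ≤ a) (hb : 0 < b) (hab : a < b) (d : ℕ) :
    a ^ (d + 1) ≤ a / b * b ^ (d + 1) := by
  have : a / b * b ^ (d + 1) = a * b ^ d := by field_simp; ring
  rw [this, pow_succ']
  gcongr

theorem hp_low_diag1 [MetricSpace X] {f : X → X} {a b c : ℂ} (ha : a ≠ 0) (hab : ‖a‖ < ‖b‖)
    (hm : hpModel f (hpDiag a b c)) {l : ℕ} (hub : hpUB f l) : (1 : ℝ≥0∞) ≤ hpol f := by
  have hb : 0 < ‖b‖ := (norm_nonneg a).trans_lt hab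
  have hb0 : b ≠ 0 := norm_pos_iff.1 hb
  have hw : ∀ p : ℕ, ((((a ^ p)⁻¹, (b ^ p)⁻¹), 0) : hpW) ≠ 0 := by
    intro p h
    have : (a ^ p)⁻¹ = 0 := congrArg (fun w : hpW => w.1.1) h
    simp [ha] at this
  refine hp_low1 hm hub (1 - ‖a‖ / ‖b‖) (by rw [sub_pos, div_lt_one hb]; exact hab) 1 le_rfl
    (fun p => (((a ^ p)⁻¹, (b ^ p)⁻¹), 0)) hw ?_
  intro m p p' hp hp'
  refine ⟨p', by omega, ?_⟩
  rw [dist_comm]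
  refine hp_dist0 (hp_pow_ne hm.1 _ (hw _)) (hp_pow_ne hm.1 _ (hw _)) ?_ ?_
  · rw [hp_diag_pow, one_mul]
    refine hp_norm_le ?_ ?_ ?_ <;> simp [ha, hb0]
  · rw [hp_diag_pow]
    refine le_trans ?_ (mul_le_mul_of_nonneg_left (hp_norm1 _) (by positivity))
    obtain ⟨d, rfl⟩ : ∃ d, p' = p + (d + 1) := ⟨p' - p - 1, by omega⟩
    have e : ∀ x : ℂ, x ≠ 0 → ‖x ^ (p + (d+1)) * (x ^ p)⁻¹‖ = ‖x‖ ^ (d+1) := by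
      intro x hx
      rw [pow_add, mul_comm (x ^ p), mul_assoc, mul_inv_cancel₀ (pow_ne_zero _ hx), mul_one, norm_pow]
    show ‖a ^ (p + (d+1)) * (a ^ p)⁻¹‖ ≤ _ * ‖b ^ (p + (d+1)) * (b ^ p)⁻¹‖
    rw [e a ha, e b hb0]
    exact hp_pow_ratio (norm_nonneg _) hb hab d

theorem hp_low_diag2 [MetricSpace X] {f : X → X} {a b c : ℂ} (ha : a ≠ 0) (hab : ‖a‖ < ‖b‖)
    (hbc : ‖b‖ < ‖c‖)
    (hm : hpModel f (hpDiag a b c)) {l : ℕ} (hub : hpUB f l) : (2 : ℝ≥0∞) ≤ hpol f := by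
  have hb : 0 < ‖b‖ := (norm_nonneg a).trans_lt hab
  have hb0 : b ≠ 0 := norm_pos_iff.1 hb
  have hc : 0 < ‖c‖ := (norm_nonneg b).trans_lt hbc
  have hc0 : c ≠ 0 := norm_pos_iff.1 hc
  have hw : ∀ m p q : ℕ, ((((a ^ p)⁻¹, (b ^ p)⁻¹), (b ^ p)⁻¹ * (b ^ (m + q) * (c ^ (m + q))⁻¹)) : hpW) ≠ 0 := by
    intro m p q h
    have : (a ^ p)⁻¹ = 0 := congrArg (fun w : hpW => w.1.1) h
    simp [ha] at this
  have d1 : 0 < 1 - ‖a‖ / ‖b‖ := by rw [sub_pos, div_lt_one hb]; exact hab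
  have d2 : 0 < 1 - ‖b‖ / ‖c‖ := by rw [sub_pos, div_lt_one hc]; exact hbc
  have e : ∀ (p d : ℕ) (x : ℂ), x ≠ 0 → x ^ (p + d) * (x ^ p)⁻¹ = x ^ d := by
    intro p d x hx
    rw [pow_add, mul_comm (x ^ p), mul_assoc, mul_inv_cancel₀ (pow_ne_zero _ hx), mul_one]
  refine hp_low2 hm hub (min (1 - ‖a‖ / ‖b‖) (1 - ‖b‖ / ‖c‖)) (lt_min d1 d2) 2 (by norm_num)
    (fun m p q => (((a ^ p)⁻¹, (b ^ p)⁻¹), (b ^ p)⁻¹ * (b ^ (m + q) * (c ^ (m + q))⁻¹))) hw ?_ ?_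
  · intro m p p' q q' hp hp' hq hq'
    refine ⟨p', by omega, (min_le_left _ _).trans ?_⟩
    rw [dist_comm]
    refine hp_dist0 (hp_pow_ne hm.1 _ (hw _ _ _)) (hp_pow_ne hm.1 _ (hw _ _ _)) ?_ ?_
    · rw [hp_diag_pow, one_mul]
      obtain ⟨d, hd⟩ : ∃ d, m + q' = p' + d := ⟨m + q' - p', by omega⟩
      simp only [hd]
      refine hp_norm_le le_rfl ?_ ?_
      · simp [ha, hb0]
      · have : c ^ p' * ((b ^ p')⁻¹ * (b ^ (p' + d) * (c ^ (p' + d))⁻¹)) = (b / c) ^ d := by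
          rw [pow_add, pow_add, div_pow]
          field_simp
        show ‖c ^ p' * ((b ^ p')⁻¹ * (b ^ (p' + d) * (c ^ (p' + d))⁻¹))‖ ≤ ‖a ^ p' * (a ^ p')⁻¹‖
        rw [this, mul_inv_cancel₀ (pow_ne_zero _ ha), norm_one, norm_pow, norm_div]
        exact pow_le_one₀ (by positivity) (by rw [div_le_one hc]; exact hbc.le)
    · rw [hp_diag_pow]
      refine le_trans ?_ (mul_le_mul_of_nonneg_left (hp_norm1 _) (by positivity))
      obtain ⟨d, rfl⟩ : ∃ d, p' = p + (d + 1) := ⟨p' - p - 1, by omega⟩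
      show ‖a ^ (p + (d+1)) * (a ^ p)⁻¹‖ ≤ _ * ‖b ^ (p + (d+1)) * (b ^ p)⁻¹‖
      rw [e _ _ a ha, e _ _ b hb0, norm_pow, norm_pow]
      exact hp_pow_ratio (norm_nonneg _) hb hab d
  · intro m p q q' hp hq hq'
    refine ⟨m + q, by omega, (min_le_right _ _).trans ?_⟩
    obtain ⟨d, hd⟩ : ∃ d, m + q = p + d := ⟨m + q - p, by omega⟩
    obtain ⟨d', hd'⟩ : ∃ d', m + q' = m + q + (d' + 1) := ⟨q' - q - 1, by omega⟩
    refine hp_dist2 (hp_pow_ne hm.1 _ (hw _ _ _)) (hp_pow_ne hm.1 _ (hw _ _ _)) ?_ ?_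
    · rw [hp_diag_pow, one_mul]
      have e3 : c ^ (m + q) * ((b ^ p)⁻¹ * (b ^ (m + q) * (c ^ (m + q))⁻¹)) = b ^ d := by
        rw [hd, ← e p d b hb0]
        field_simp
      have e2 : b ^ (m + q) * (b ^ p)⁻¹ = b ^ d := by rw [hd, e _ _ b hb0]
      have e1 : a ^ (m + q) * (a ^ p)⁻¹ = a ^ d := by rw [hd, e _ _ a ha]
      simp only [e1, e2, e3]
      refine hp_norm_le ?_ le_rfl le_rfl
      simp only [norm_pow]
      gcongr
    · rw [hp_diag_pow]
      refine le_trans ?_ (mul_le_mul_of_nonneg_left (hp_norm1 _) (by positivity))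
      simp only [hd']
      have e3 : c ^ (m + q) * ((b ^ p)⁻¹ * (b ^ (m + q + (d'+1)) * (c ^ (m + q + (d'+1)))⁻¹))
        = (b ^ (m + q) * (b ^ p)⁻¹) * (b / c) ^ (d' + 1) := by
        rw [pow_add _ (m+q) (d'+1), pow_add _ (m+q) (d'+1), div_pow]
        field_simp
      rw [e3, norm_mul, mul_comm, norm_pow, norm_div]
      gcongr
      rw [pow_succ]
      have : (‖b‖ / ‖c‖) ^ d' ≤ 1 := pow_le_one₀ (by positivity) (by rw [div_le_one hc]; exact hbc.le)
      have h0 : 0 ≤ ‖b‖ / ‖c‖ := by positivity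
      nlinarith


theorem hp_one_le_sub {s t : ℕ} (h : s ≠ t) : 1 ≤ ‖(s:ℂ) - t‖ := by
  have : (s:ℂ) - t = (((s:ℤ) - t : ℤ) : ℂ) := by push_cast; rfl
  rw [this, Complex.norm_intCast]
  have h1 : (1:ℤ) ≤ |(s:ℤ) - t| := Int.one_le_abs (by omega)
  exact_mod_cast h1

theorem hp_low_J3 [MetricSpace X] {f : X → X} (hm : hpModel f hpJ3) {l : ℕ} (hub : hpUB f l) :
    (2 : ℝ≥0∞) ≤ hpol f := by
  have hw : ∀ m p q : ℕ, ((((p:ℂ) * (m + q : ℕ), -((p:ℂ) + (m + q : ℕ))), 1) : hpW) ≠ 0 := by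
    intro m p q h
    exact one_ne_zero (congrArg Prod.snd h)
  have hpw : ∀ t i j : ℕ, (hpJ3 ^ t) (((i:ℂ) * j, -((i:ℂ) + j)), 1)
      = ((((t:ℂ) - i) * (t - j), ((t:ℂ) - i) + (t - j)), 1) := by
    intro t i j
    rw [hp_J3_pow]
    ext <;> simp <;> ring
  have key : ∀ t i j : ℕ, t ≠ i → t ≠ j →
      1/2 * ‖((((t:ℂ) - i) * (t - j), ((t:ℂ) - i) + (t - j)), (1:ℂ))‖ ≤ ‖((t:ℂ) - i) * (t - j)‖ := by
    intro t i j hi hj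
    have h1 := hp_one_le_sub hi
    have h2 := hp_one_le_sub hj
    have h3 := norm_add_le ((t:ℂ) - i) (t - j)
    have : ‖((((t:ℂ) - i) * (t - j), ((t:ℂ) - i) + (t - j)), (1:ℂ))‖ ≤ 2 * ‖((t:ℂ) - i) * (t - j)‖ := by
      refine hp_norm_le ?_ ?_ ?_
      · have := norm_nonneg (((t:ℂ) - i) * (t - j))
        simp only; linarith
      · rw [norm_mul]; simp only; nlinarith
      · rw [norm_mul]; simp only [norm_one]; nlinarith
    linarith
  have fin : ∀ m p q p' q' t : ℕ, (t = p ∨ t = m + q) → t ≠ p' → t ≠ m + q' →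
      1/2 ≤ dist (hpPsi ((hpJ3 ^ t) (((p:ℂ) * (m + q : ℕ), -((p:ℂ) + (m + q : ℕ))), 1)))
        (hpPsi ((hpJ3 ^ t) (((p':ℂ) * (m + q' : ℕ), -((p':ℂ) + (m + q' : ℕ))), 1))) := by
    intro m p q p' q' t h1 h2 h3
    rw [dist_comm]
    have := hp_dist0 (w := (hpJ3 ^ t) (((p':ℂ) * (m + q' : ℕ), -((p':ℂ) + (m + q' : ℕ))), 1))
      (w' := (hpJ3 ^ t) (((p:ℂ) * (m + q : ℕ), -((p:ℂ) + (m + q : ℕ))), 1)) (α := 1/2) (β := 0)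
      (hp_pow_ne hm.1 _ (hw _ _ _)) (hp_pow_ne hm.1 _ (hw _ _ _)) ?_ ?_
    · simpa using this
    · rw [hpw]; exact key _ _ _ h2 h3
    · rw [hpw, zero_mul]
      apply le_of_eq
      rw [norm_eq_zero]
      rcases h1 with h1 | h1
      · simp [h1]
      · simp [h1]
  refine hp_low2 hm hub (1/2) (by norm_num) 2 (by norm_num)
    (fun m p q => (((p:ℂ) * (m + q : ℕ), -((p:ℂ) + (m + q : ℕ))), 1)) hw ?_ ?_
  · intro m p p' q q' hp hp' hq hq'
    exact ⟨p, by omega, fin m p q p' q' p (Or.inl rfl) (by omega) (by omega)⟩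
  · intro m p q q' hp hq hq'
    exact ⟨m + q, by omega, fin m p q p q' (m + q) (Or.inr rfl) (by omega) (by omega)⟩

theorem hp_blkJ2_pow (μ : ℂ) (t : ℕ) (w : hpW) :
    (hpBlk hpJ2 μ ^ t) w = ((w.1.1 + t * w.1.2, w.1.2), μ ^ t * w.2) := by
  rw [hp_Blk_pow, hp_J2_pow]

theorem hp_low_J21 [MetricSpace X] {f : X → X} {μ : ℂ} (hm : hpModel f (hpBlk hpJ2 μ)) {l : ℕ}
    (hub : hpUB f l) : (1 : ℝ≥0∞) ≤ hpol f := by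
  have hw : ∀ p : ℕ, (((-(2 * p : ℂ), 1), 0) : hpW) ≠ 0 := by
    intro p h
    exact one_ne_zero (congrArg (fun w : hpW => w.1.2) h)
  refine hp_low1 hm hub (1/2) (by norm_num) 2 (by norm_num) (fun p => ((-(2 * p : ℂ), 1), 0)) hw ?_
  intro m p p' hp hp'
  refine ⟨2 * p, by omega, ?_⟩
  have := hp_dist1 (α := 1) (β := 1/2) (hp_pow_ne hm.1 (2*p) (hw p)) (hp_pow_ne hm.1 (2*p) (hw p')) ?_ ?_
  · norm_num at this ⊢; exact this
  · rw [hp_blkJ2_pow, one_mul]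
    refine hp_norm_le ?_ le_rfl ?_ <;> simp
  · rw [hp_blkJ2_pow]
    refine le_trans ?_ (mul_le_mul_of_nonneg_left (hp_norm0 _) (by positivity))
    have h1 := hp_one_le_sub (s := p) (t := p') (by omega)
    have h2 : -(2 * p' : ℂ) + ((2 * p : ℕ) : ℂ) * 1 = 2 * ((p:ℂ) - p') := by push_cast; ring
    simp only [h2, norm_mul]
    norm_num
    linarith

/-- generic separation for `J2 ⊕ μ` -/
theorem hp_exists_M {ρ : ℝ} (h0 : 0 ≤ ρ) (h1 : ρ < 1) : ∃ M : ℕ, 2 ≤ M ∧ ∀ e : ℕ, M ≤ e →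
    (1 + (e:ℝ)) * ρ ^ e ≤ 1/2 := by
  have t1 := tendsto_self_mul_const_pow_of_lt_one h0 h1
  have t2 := tendsto_pow_atTop_nhds_zero_of_lt_one h0 h1
  have t3 := t2.add t1
  rw [add_zero] at t3
  obtain ⟨M, hM⟩ := eventually_atTop.1 (t3.eventually_le_const (show (0:ℝ) < 1/2 by norm_num))
  refine ⟨max M 2, le_max_right _ _, fun e he => ?_⟩
  have := hM e ((le_max_left _ _).trans he)
  linarith

theorem hp_low_J22 [MetricSpace X] {f : X → X} {μ : ℂ} (hμ : μ ≠ 0) (hμ1 : ‖μ‖ ≠ 1)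
    (hm : hpModel f (hpBlk hpJ2 μ)) {l : ℕ}
    (hub : hpUB f l) : (2 : ℝ≥0∞) ≤ hpol f := by
  let v : ℕ → ℕ → hpW := fun i j => ((-(i:ℂ), 1), ((j:ℂ) - i) * (μ ^ j)⁻¹)
  have hv : ∀ i j, v i j ≠ 0 := by
    intro i j h
    exact one_ne_zero (congrArg (fun w : hpW => w.1.2) h)
  have hpw : ∀ t i j : ℕ, (hpBlk hpJ2 μ ^ t) (v i j) =
      (((t:ℂ) - i, 1), ((j:ℂ) - i) * (μ ^ t * (μ ^ j)⁻¹)) := by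
    intro t i j
    rw [hp_blkJ2_pow]
    ext
    · simp [v]; ring
    · simp [v]
    · simp [v]; ring
  -- first separation
  have S1 : ∀ i j i' j' : ℕ, ‖(j:ℂ) - i‖ * ‖μ ^ i * (μ ^ j)⁻¹‖ ≤ 1 → 2 ≤ ‖(i:ℂ) - i'‖ →
      1/2 ≤ dist (hpPsi ((hpBlk hpJ2 μ ^ i) (v i j))) (hpPsi ((hpBlk hpJ2 μ ^ i) (v i' j'))) := by
    intro i j i' j' h1 h2
    have := hp_dist1 (α := 1) (β := 1/2) (hp_pow_ne hm.1 i (hv i j)) (hp_pow_ne hm.1 i (hv i' j')) ?_ ?_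
    · norm_num at this ⊢; exact this
    · rw [hpw, one_mul]
      refine hp_norm_le ?_ le_rfl ?_
      · simp
      · rw [norm_mul]; simpa using h1
    · rw [hpw]
      refine le_trans ?_ (mul_le_mul_of_nonneg_left (hp_norm0 _) (by positivity))
      simp only [norm_one]; linarith
  have S2 : ∀ i j j' : ℕ, 1 ≤ ‖(j:ℂ) - i‖ → ‖(j':ℂ) - i‖ * ‖μ ^ j * (μ ^ j')⁻¹‖ ≤ 1/2 * ‖(j:ℂ) - i‖ →
      1/2 ≤ dist (hpPsi ((hpBlk hpJ2 μ ^ j) (v i j))) (hpPsi ((hpBlk hpJ2 μ ^ j) (v i j'))) := by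
    intro i j j' h1 h2
    have := hp_dist2 (α := 1) (β := 1/2) (hp_pow_ne hm.1 j (hv i j)) (hp_pow_ne hm.1 j (hv i j')) ?_ ?_
    · norm_num at this ⊢; exact this
    · rw [hpw, one_mul]
      have : ((j:ℂ) - i) * (μ ^ j * (μ ^ j)⁻¹) = (j:ℂ) - i := by
        rw [mul_inv_cancel₀ (pow_ne_zero _ hμ), mul_one]
      rw [this]
      refine hp_norm_le le_rfl ?_ le_rfl
      simpa using h1
    · rw [hpw]
      refine le_trans ?_ (mul_le_mul_of_nonneg_left (hp_norm0 _) (by positivity))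
      rw [norm_mul]; exact h2
  have nab : ∀ i d : ℕ, ‖((i + d : ℕ) : ℂ) - i‖ = d := by
    intro i d; push_cast; simp
  have nab' : ∀ i d : ℕ, ‖(i : ℂ) - (i + d : ℕ)‖ = d := by
    intro i d; rw [norm_sub_rev, nab]
  have arith : ∀ (ρ : ℝ) (d e : ℕ), 0 ≤ ρ → 1 ≤ d → (1 + (e:ℝ)) * ρ ^ e ≤ 1/2 →
      ((d + e : ℕ) : ℝ) * ρ ^ e ≤ 1/2 * d := by
    intro ρ d e hρ hd he
    have hd' : (1:ℝ) ≤ d := by exact_mod_cast hd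
    push_cast
    have h0 : 0 ≤ ρ ^ e := by positivity
    have he0 : (0:ℝ) ≤ e := by positivity
    calc (d + e : ℝ) * ρ ^ e ≤ (d * (1 + e)) * ρ ^ e := by gcongr; nlinarith
      _ = d * ((1 + e) * ρ ^ e) := by ring
      _ ≤ d * (1/2) := by gcongr
      _ = _ := by ring
  have arith1 : ∀ (ρ : ℝ) (e : ℕ), 0 ≤ ρ → (1 + (e:ℝ)) * ρ ^ e ≤ 1/2 → (e:ℝ) * ρ ^ e ≤ 1 := by
    intro ρ e hρ he
    have h0 : 0 ≤ ρ ^ e := by positivity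
    nlinarith
  have mulM : ∀ M p p' : ℕ, 2 ≤ M → p ≠ p' → 2 ≤ ‖((M * p : ℕ) : ℂ) - (M * p' : ℕ)‖ := by
    intro M p p' hM hp
    have h1 := hp_one_le_sub hp
    have : ((M * p : ℕ) : ℂ) - (M * p' : ℕ) = M * ((p:ℂ) - p') := by push_cast; ring
    rw [this, norm_mul, Complex.norm_natCast]
    have h2 : (2:ℝ) ≤ M := by exact_mod_cast hM
    nlinarith
  have pw1 : ∀ i d : ℕ, ‖μ ^ i * (μ ^ (i + d))⁻¹‖ = (‖μ‖⁻¹) ^ d := by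
    intro i d
    have : μ ^ i * (μ ^ (i + d))⁻¹ = (μ⁻¹) ^ d := by
      rw [pow_add, inv_pow]; have := pow_ne_zero i hμ; field_simp
    rw [this, norm_pow, norm_inv]
  have pw2 : ∀ i d : ℕ, ‖μ ^ (i + d) * (μ ^ i)⁻¹‖ = ‖μ‖ ^ d := by
    intro i d
    have : μ ^ (i + d) * (μ ^ i)⁻¹ = μ ^ d := by
      rw [pow_add]; have := pow_ne_zero i hμ; field_simp
    rw [this, norm_pow]
  have hμp : 0 < ‖μ‖ := norm_pos_iff.2 hμ
  rcases lt_or_gt_of_ne hμ1 with hlt | hgt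
  · obtain ⟨M, hM2, hM⟩ := hp_exists_M hμp.le hlt
    refine hp_low2 hm hub (1/2) (by norm_num) (3 * M) (by omega)
      (fun m p q => v (M * (m + p + 1)) (M * q)) (fun _ _ _ => hv _ _) ?_ ?_
    · intro m p p' q q' hp hp' hq hq'
      refine ⟨M * (m + p + 1), by nlinarith, S1 _ _ _ _ ?_ (mulM _ _ _ hM2 (by omega))⟩
      obtain ⟨d, hd⟩ : ∃ d, M * (m + p + 1) = M * q + M * (d + 1) :=
        ⟨m + p - q, by rw [← Nat.mul_add]; congr 1; omega⟩
      rw [hd, nab', pw2]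
      exact arith1 _ _ hμp.le (hM _ (Nat.le_mul_of_pos_right _ (by omega)))
    · intro m p q q' hp hq hq'
      refine ⟨M * q', by nlinarith, ?_⟩
      rw [dist_comm]
      obtain ⟨d, hd⟩ : ∃ d, M * (m + p + 1) = M * q' + M * (d + 1) :=
        ⟨m + p - q', by rw [← Nat.mul_add]; congr 1; omega⟩
      obtain ⟨e, he⟩ : ∃ e, M * q' = M * q + M * (e + 1) :=
        ⟨q' - q - 1, by rw [← Nat.mul_add]; congr 1; omega⟩
      have hpos : 1 ≤ M * (d + 1) := Nat.mul_pos (by omega) (by omega)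
      have n1 : ‖((M * q' : ℕ) : ℂ) - (M * (m + p + 1) : ℕ)‖ = (M * (d + 1) : ℕ) := by
        rw [hd, nab']
      have n2 : ‖((M * q : ℕ) : ℂ) - (M * (m + p + 1) : ℕ)‖ = (M * (d + 1) + M * (e + 1) : ℕ) := by
        rw [hd, he, add_assoc, nab', add_comm (M * (e+1))]
      refine S2 _ _ _ ?_ ?_
      · rw [n1]; exact_mod_cast hpos
      · rw [n1, n2, he, pw2]
        exact arith _ _ _ hμp.le hpos (hM _ (Nat.le_mul_of_pos_right _ (by omega)))
  · have hinv0 : 0 ≤ ‖μ‖⁻¹ := by positivity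
    obtain ⟨M, hM2, hM⟩ := hp_exists_M hinv0 (inv_lt_one_of_one_lt₀ hgt)
    refine hp_low2 hm hub (1/2) (by norm_num) (3 * M) (by omega)
      (fun m p q => v (M * p) (M * (m + q + 1))) (fun _ _ _ => hv _ _) ?_ ?_
    · intro m p p' q q' hp hp' hq hq'
      refine ⟨M * p, by nlinarith, S1 _ _ _ _ ?_ (mulM _ _ _ hM2 (by omega))⟩
      obtain ⟨d, hd⟩ : ∃ d, M * (m + q + 1) = M * p + M * (d + 1) :=
        ⟨m + q - p, by rw [← Nat.mul_add]; congr 1; omega⟩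
      rw [hd, nab, pw1]
      exact arith1 _ _ hinv0 (hM _ (Nat.le_mul_of_pos_right _ (by omega)))
    · intro m p q q' hp hq hq'
      refine ⟨M * (m + q + 1), by nlinarith, ?_⟩
      obtain ⟨d, hd⟩ : ∃ d, M * (m + q + 1) = M * p + M * (d + 1) :=
        ⟨m + q - p, by rw [← Nat.mul_add]; congr 1; omega⟩
      obtain ⟨e, he⟩ : ∃ e, M * (m + q' + 1) = M * (m + q + 1) + M * (e + 1) :=
        ⟨q' - q - 1, by rw [← Nat.mul_add]; congr 1; omega⟩
      have hpos : 1 ≤ M * (d + 1) := Nat.mul_pos (by omega) (by omega)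
      have n1 : ‖((M * (m + q + 1) : ℕ) : ℂ) - (M * p : ℕ)‖ = (M * (d + 1) : ℕ) := by
        rw [hd, nab]
      have n2 : ‖((M * (m + q' + 1) : ℕ) : ℂ) - (M * p : ℕ)‖ = (M * (d + 1) + M * (e + 1) : ℕ) := by
        rw [he, hd, add_assoc, nab]
      refine S2 _ _ _ ?_ ?_
      · rw [n1]; exact_mod_cast hpos
      · rw [n1, n2, he, pw1]
        exact arith _ _ _ hinv0 hpos (hM _ (Nat.le_mul_of_pos_right _ (by omega)))


theorem hp_li3 {E : Type*} [AddCommGroup E] [Module ℂ E] {v0 v1 v2 : E}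
    (h : ∀ x y z : ℂ, x • v0 + y • v1 + z • v2 = 0 → x = 0 ∧ y = 0 ∧ z = 0) :
    LinearIndependent ℂ ![v0, v1, v2] := by
  rw [Fintype.linearIndependent_iff]
  intro g hg i
  rw [Fin.sum_univ_three] at hg
  obtain ⟨h0, h1, h2⟩ := h _ _ _ hg
  fin_cases i
  · exact h0
  · exact h1
  · exact h2

/-- Jordan normal form in dimension three, up to scalars. -/
def hpJord {E : Type*} [AddCommGroup E] [Module ℂ E] (A : Module.End ℂ E) (v0 v1 v2 : E) : Prop :=
  (∃ a b c : ℂ, a ≠ 0 ∧ b ≠ 0 ∧ c ≠ 0 ∧ A v0 = a • v0 ∧ A v1 = b • v1 ∧ A v2 = c • v2) ∨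
  (∃ a μ : ℂ, a ≠ 0 ∧ μ ≠ 0 ∧ A v0 = a • v0 ∧ A v1 = a • (v0 + v1) ∧ A v2 = a • μ • v2) ∨
  (∃ a : ℂ, a ≠ 0 ∧ A v0 = a • v0 ∧ A v1 = a • (v0 + v1) ∧ A v2 = a • (v0 + (2:ℂ) • v1 + v2))

theorem hp_jordan {E : Type*} [AddCommGroup E] [Module ℂ E] [FiniteDimensional ℂ E]
    (hE : Module.finrank ℂ E = 3) (A : Module.End ℂ E) (hA : Function.Injective A) :
    ∃ v0 v1 v2 : E, LinearIndependent ℂ ![v0, v1, v2] ∧ hpJord A v0 v1 v2 := by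
  have hev : ∀ (a : ℂ) (v : E), v ≠ 0 → A v = a • v → a ≠ 0 := by
    rintro a v hv h rfl
    rw [zero_smul] at h
    exact hv (hA (by rw [h, map_zero]))
  let N : ℂ → Module.End ℂ E := fun a => A - a • 1
  have hN : ∀ a v, N a v = A v - a • v := fun a v => by simp [N]
  have hAN : ∀ a v, A v = N a v + a • v := fun a v => by rw [hN]; abel
  by_cases c1 : ∃ a w, N a (N a (N a w)) = 0 ∧ N a (N a w) ≠ 0
  · obtain ⟨a, w, h3, h2⟩ := c1
    have ha : a ≠ 0 := hev a _ h2 (by rw [hAN a, h3, zero_add])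
    set n1 := N a w with hn1
    set n2 := N a n1 with hn2
    have e0 : N a ((a⁻¹ * a⁻¹ * (1/2)) • n2) = 0 := by rw [map_smul, h3, smul_zero]
    refine ⟨(a⁻¹ * a⁻¹ * (1/2)) • n2, (1/2 : ℂ) • (a⁻¹ • n1 - (a⁻¹ * a⁻¹ * (1/2)) • n2), w, hp_li3 ?_,
      Or.inr (Or.inr ⟨a, ha, ?_, ?_, ?_⟩)⟩
    · intro x y z h
      have k1 := congrArg (fun v => N a (N a v)) h
      simp only [map_add, map_smul, map_sub, map_zero, ← hn1, ← hn2, h3, smul_zero, zero_add, sub_zero] at k1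
      have hz : z = 0 := (smul_eq_zero.1 k1).resolve_right h2
      subst hz
      have k2 := congrArg (fun v => N a v) h
      simp only [map_add, map_smul, map_sub, map_zero, ← hn1, ← hn2, h3, smul_zero, zero_add, sub_zero, zero_smul, add_zero] at k2
      have hy : y = 0 := by
        simpa [h2, ha] using k2
      subst hy
      refine ⟨?_, rfl, rfl⟩
      simpa [h2, ha] using h
    · rw [hAN a, e0, zero_add]
    · rw [hAN a]
      simp only [map_smul, map_sub, h3, ← hn2]
      match_scalars <;> field_simp <;> ring
    · rw [hAN a, ← hn1]
      match_scalars <;> field_simp <;> ring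
  push Not at c1
  by_cases c2 : ∃ a w, N a (N a w) = 0 ∧ N a w ≠ 0
  · obtain ⟨a, w, h2, h1⟩ := c2
    have ha : a ≠ 0 := hev a _ h1 (by rw [hAN a, h2, zero_add])
    have fin : ∀ v2 b, v2 ≠ 0 → A v2 = b • v2 → (b = a → ∀ c : ℂ, v2 ≠ c • N a w) →
        ∃ v0 v1 v2 : E, LinearIndependent ℂ ![v0, v1, v2] ∧ hpJord A v0 v1 v2 := by
      intro v2 b hv hb hab
      have hb0 : b ≠ 0 := hev b v2 hv hb
      have hNv : N a v2 = (b - a) • v2 := by rw [hN, hb, sub_smul]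
      refine ⟨a⁻¹ • N a w, w, v2, hp_li3 ?_, Or.inr (Or.inl ⟨a, b / a, ha, div_ne_zero hb0 ha, ?_, ?_, ?_⟩)⟩
      · intro x y z h
        have k2 := congrArg (fun v => N a (N a v)) h
        have k1 := congrArg (fun v => N a v) h
        simp only [map_add, map_smul, map_zero, h2, hNv, smul_zero, zero_add] at k1 k2
        by_cases hba : b = a
        · rw [hba, sub_self, zero_smul, smul_zero, add_zero] at k1
          have hy := (smul_eq_zero.1 k1).resolve_right h1
          subst hy
          have hz : z = 0 := by
            by_contra hz
            apply hab hba (-(z⁻¹ * x * a⁻¹))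
            have : z • v2 = -(x • a⁻¹ • N a w) := by
              rw [zero_smul, add_zero] at h
              exact eq_neg_of_add_eq_zero_right h
            have := congrArg (fun v => z⁻¹ • v) this
            simp only [smul_smul, inv_mul_cancel₀ hz, one_smul] at this
            rw [this]; module
          subst hz
          refine ⟨?_, rfl, rfl⟩
          simpa [h1, ha] using h
        · have hz : z = 0 := by
            have : b - a ≠ 0 := sub_ne_zero.2 hba
            simpa [hv, this] using k2
          subst hz
          rw [zero_smul, add_zero] at k1
          have hy := (smul_eq_zero.1 k1).resolve_right h1
          subst hy
          refine ⟨?_, rfl, rfl⟩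
          simpa [h1, ha] using h
      · rw [map_smul, hAN a (N a w), h2, zero_add, smul_comm]
      · rw [smul_add, smul_smul, mul_inv_cancel₀ ha, one_smul, ← hAN]
      · rw [hb, smul_smul, mul_div_cancel₀ _ ha]
    by_cases c3 : ∃ b v, b ≠ a ∧ v ≠ 0 ∧ A v = b • v
    · obtain ⟨b, v, hba, hv, hb⟩ := c3
      exact fin v b hv hb (fun h => absurd h hba)
    · push Not at c3
      have hker : ∀ b, b ≠ a → ∀ k v, (N b ^ k) v = 0 → v = 0 := by
        intro b hb k
        induction k with
        | zero => intro v hv; simpa using hv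
        | succ k ih =>
          intro v hv
          rw [pow_succ', Module.End.mul_apply] at hv
          apply ih
          by_contra h
          exact c3 b _ hb h (by rw [hAN b, hv, zero_add])
      have htop : A.maxGenEigenspace a = ⊤ := by
        rw [← top_le_iff, ← Module.End.iSup_maxGenEigenspace_eq_top A]
        refine iSup_le fun b => ?_
        by_cases hb : b = a
        · rw [hb]
        · intro v hv
          obtain ⟨k, hk⟩ := Module.End.mem_maxGenEigenspace _ _ _ |>.1 hv
          rw [hker b hb k v hk]
          exact zero_mem _
      have hsq : ∀ k v, (N a ^ k) v = 0 → N a (N a v) = 0 := by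
        intro k
        induction k with
        | zero => intro v hv; rw [show v = 0 by simpa using hv, map_zero, map_zero]
        | succ k ih =>
          intro v hv
          rw [pow_succ, Module.End.mul_apply] at hv
          exact c1 a v (ih _ hv)
      have hsq' : ∀ v, N a (N a v) = 0 := by
        intro v
        have hv : v ∈ A.maxGenEigenspace a := htop ▸ Submodule.mem_top
        obtain ⟨k, hk⟩ := Module.End.mem_maxGenEigenspace _ _ _ |>.1 hv
        exact hsq k v hk
      have hrk : LinearMap.range (N a) ≤ LinearMap.ker (N a) := by
        rintro _ ⟨v, rfl⟩
        exact hsq' v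
      have hd := LinearMap.finrank_range_add_finrank_ker (N a)
      have hd2 := Submodule.finrank_mono hrk
      have : ¬ LinearMap.ker (N a) ≤ Submodule.span ℂ {N a w} := by
        intro h
        have := Submodule.finrank_mono h
        rw [finrank_span_singleton h1] at this
        omega
      obtain ⟨v, hv, hv'⟩ := SetLike.not_le_iff_exists.1 this
      refine fin v a ?_ ?_ ?_
      · rintro rfl; exact hv' (zero_mem _)
      · rw [hAN a, LinearMap.mem_ker.1 hv, zero_add]
      · rintro - c rfl
        exact hv' (Submodule.smul_mem _ _ (Submodule.mem_span_singleton_self _))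
  push Not at c2
  have hsq : ∀ a k v, (N a ^ k) v = 0 → N a v = 0 := by
    intro a k
    induction k with
    | zero => intro v hv; rw [show v = 0 by simpa using hv, map_zero]
    | succ k ih =>
      intro v hv
      rw [pow_succ, Module.End.mul_apply] at hv
      exact c2 a v (ih _ hv)
  have hsp : Submodule.span ℂ {v | ∃ a : ℂ, A v = a • v} = ⊤ := by
    rw [← top_le_iff, ← Module.End.iSup_maxGenEigenspace_eq_top A]
    refine iSup_le fun b v hv => ?_
    obtain ⟨k, hk⟩ := Module.End.mem_maxGenEigenspace _ _ _ |>.1 hv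
    exact Submodule.subset_span ⟨b, by rw [hAN b, hsq b k v hk, zero_add]⟩
  obtain ⟨f, hf1, -, hf3⟩ := Submodule.exists_fun_fin_finrank_span_eq ℂ {v | ∃ a : ℂ, A v = a • v}
  have key : Module.finrank ℂ (Submodule.span ℂ {v | ∃ a : ℂ, A v = a • v}) = 3 := by
    rw [hsp, finrank_top, hE]
  let g : Fin 3 → E := fun i => f (finCongr key.symm i)
  have hg : LinearIndependent ℂ g := hf3.comp _ (finCongr key.symm).injective
  have hg1 : ∀ i, ∃ a : ℂ, a ≠ 0 ∧ A (g i) = a • g i := by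
    intro i
    obtain ⟨a, ha⟩ := hf1 (finCongr key.symm i)
    exact ⟨a, hev a (g i) (hg.ne_zero i) ha, ha⟩
  obtain ⟨a, ha, ha'⟩ := hg1 0
  obtain ⟨b, hb, hb'⟩ := hg1 1
  obtain ⟨c, hc, hc'⟩ := hg1 2
  refine ⟨g 0, g 1, g 2, ?_, Or.inl ⟨a, b, c, ha, hb, hc, ha', hb', hc'⟩⟩
  convert hg using 1
  ext i
  fin_cases i <;> rfl

theorem hp_iso (v : Fin 3 → (Fin 3 → ℂ)) (hv : LinearIndependent ℂ v) :
    ∃ P : hpW ≃ₗ[ℂ] (Fin 3 → ℂ), ∀ w : hpW, P w = w.1.1 • v 0 + w.1.2 • v 1 + w.2 • v 2 := by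
  let L : hpW →ₗ[ℂ] (Fin 3 → ℂ) :=
    { toFun := fun w => w.1.1 • v 0 + w.1.2 • v 1 + w.2 • v 2
      map_add' := fun a b => by simp only [Prod.fst_add, Prod.snd_add]; module
      map_smul' := fun c a => by simp only [Prod.smul_fst, Prod.smul_snd, RingHom.id_apply]; module }
  have hinj : Function.Injective L := by
    rw [injective_iff_map_eq_zero]
    intro w hw
    rw [Fintype.linearIndependent_iff] at hv
    have := hv ![w.1.1, w.1.2, w.2] (by rw [Fin.sum_univ_three]; exact hw)
    exact Prod.ext (Prod.ext (this 0) (this 1)) (this 2)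
  exact ⟨LinearEquiv.ofInjectiveOfFinrankEq L hinj (by simp), fun w => rfl⟩


theorem hp_model_abs [MetricSpace X] {f : X → X} {B : Module.End ℂ hpW} (hB : Function.Injective B)
    (q : {w : hpW // w ≠ 0} → X) (hq : Continuous q) (hs : Function.Surjective q)
    (hsc : ∀ (c : ℂ) (w w' : {w : hpW // w ≠ 0}), c ≠ 0 → (w' : hpW) = c • (w : hpW) → q w' = q w)
    (hf : ∀ w w' : {w : hpW // w ≠ 0}, (w' : hpW) = B w → f (q w) = q w')
    (ψ : X → (ℝ × ℝ) × ℝ) (hψ : Continuous ψ) (hψq : ∀ w, ψ (q w) = hpPsi w) : hpModel f B := by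
  classical
  let w1 : {w : hpW // w ≠ 0} := ⟨((1, 1), 1), by simp⟩
  let π : hpW → X := fun w => if h : w ≠ 0 then q ⟨w, h⟩ else q w1
  have hπ : ∀ w (h : w ≠ 0), π w = q ⟨w, h⟩ := fun w h => dif_pos h
  let K : Set hpW := Metric.closedBall 0 2 \ Metric.ball 0 (1/2)
  have hK : IsCompact K := (isCompact_closedBall _ _).diff Metric.isOpen_ball
  have hKm : ∀ w : hpW, 1/2 ≤ ‖w‖ → ‖w‖ ≤ 2 → w ∈ K := by
    intro w h1 h2
    refine ⟨by simpa using h2, by simpa using h1⟩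
  have hK0 : ∀ w ∈ K, w ≠ 0 := by
    rintro w ⟨-, h⟩ rfl
    exact h (by simp)
  have hc : ContinuousOn π {w | w ≠ 0} := by
    rw [continuousOn_iff_continuous_domRestrict]
    have : ({w : hpW | w ≠ 0}).domRestrict π = q := funext fun w => hπ w.1 w.2
    rw [this]
    exact hq
  have hcK : ContinuousOn π K := hc.mono hK0
  have hscal : ∀ (c : ℂ) (w : hpW), c ≠ 0 → w ≠ 0 → π (c • w) = π w := by
    intro c w hc hw
    rw [hπ _ (smul_ne_zero hc hw), hπ _ hw]
    exact hsc c _ _ hc rfl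
  have hsur : ∀ x, ∃ w, w ≠ 0 ∧ π w = x := by
    intro x
    obtain ⟨w, rfl⟩ := hs x
    exact ⟨w, w.2, hπ _ w.2⟩
  have hnorm : ∀ w : hpW, w ≠ 0 → ((‖w‖⁻¹ : ℝ) : ℂ) ≠ 0 := by
    intro w hw
    simpa using hw
  have hns : ∀ (r : ℝ) (w : hpW), 0 ≤ r → ‖(r : ℂ) • w‖ = r * ‖w‖ := by
    intro r w hr
    rw [norm_smul, Complex.norm_real, Real.norm_of_nonneg hr]
  have hcomp : CompactSpace X := by
    refine ⟨?_⟩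
    convert hK.image_of_continuousOn hcK
    refine (Set.eq_univ_of_forall fun x => ?_).symm
    obtain ⟨w, hw, rfl⟩ := hsur x
    refine ⟨((‖w‖⁻¹ : ℝ) : ℂ) • w, ?_, hscal _ _ (hnorm w hw) hw⟩
    have : ‖((‖w‖⁻¹ : ℝ) : ℂ) • w‖ = 1 := by
      rw [hns _ _ (by positivity)]
      exact inv_mul_cancel₀ (norm_ne_zero_iff.2 hw)
    apply hKm <;> rw [this] <;> norm_num
  refine ⟨hB, π, hsur, hscal, ?_, ?_, ?_⟩
  · intro w hw
    have hBw : B w ≠ 0 := fun h => hw (hB (by rw [h, map_zero]))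
    rw [hπ _ hw, hπ _ hBw]
    exact hf _ _ rfl
  · intro ε hε
    have hu := hK.uniformContinuousOn_of_continuous hcK
    obtain ⟨δ, hδ, hu⟩ := Metric.uniformContinuousOn_iff.1 hu ε hε
    refine ⟨min (δ/2) (1/2), by positivity, fun w w' hw hw' h => ?_⟩
    have hp : 0 < ‖w‖ := norm_pos_iff.2 hw
    rw [← hscal _ w (hnorm w hw) hw, ← hscal _ w' (hnorm w hw) hw']
    have e1 : ‖((‖w‖⁻¹ : ℝ) : ℂ) • w‖ = 1 := by
      rw [hns _ _ (by positivity)]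
      exact inv_mul_cancel₀ (norm_ne_zero_iff.2 hw)
    have e2 : ‖((‖w‖⁻¹ : ℝ) : ℂ) • w - ((‖w‖⁻¹ : ℝ) : ℂ) • w'‖ ≤ min (δ/2) (1/2) := by
      rw [← smul_sub, hns _ _ (by positivity), inv_mul_le_iff₀ hp, mul_comm]
      exact h
    have e3 := le_min_iff.1 e2
    have e4 := norm_sub_norm_le (((‖w‖⁻¹ : ℝ) : ℂ) • w) (((‖w‖⁻¹ : ℝ) : ℂ) • w')
    have e5 := norm_sub_norm_le (((‖w‖⁻¹ : ℝ) : ℂ) • w') (((‖w‖⁻¹ : ℝ) : ℂ) • w)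
    rw [norm_sub_rev (((‖w‖⁻¹ : ℝ) : ℂ) • w')] at e5
    apply hu
    · apply hKm <;> rw [e1] <;> norm_num
    · apply hKm <;> linarith [e3.2]
    · rw [dist_eq_norm]
      linarith [e3.1]
  · intro δ hδ
    obtain ⟨ε, hε, hu⟩ := Metric.uniformContinuous_iff.1
      (CompactSpace.uniformContinuous_of_continuous hψ) δ hδ
    refine ⟨ε, hε, fun w w' hw hw' h => ?_⟩
    have := hu h
    rwa [hπ _ hw, hπ _ hw', hψq, hψq] at this

theorem hp_Psi_smul (c : ℂ) (hc : c ≠ 0) (w : hpW) : hpPsi (c • w) = hpPsi w := by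
  have h : ‖c‖ ≠ 0 := norm_ne_zero_iff.2 hc
  simp only [hpPsi, norm_smul, Prod.smul_fst, Prod.smul_snd, mul_div_mul_left _ _ h]

theorem hp_model (A : Matrix (Fin 3) (Fin 3) ℂ) (hA : Function.Injective (Matrix.toLin' A))
    (dm : MetricSpace (Projectivization ℂ (Fin 3 → ℂ)))
    (hdm : dm.toUniformSpace.toTopologicalSpace =
      inferInstanceAs (TopologicalSpace (Projectivization ℂ (Fin 3 → ℂ))))
    (P : hpW ≃ₗ[ℂ] (Fin 3 → ℂ)) (c : ℂ) (hc : c ≠ 0) (B : Module.End ℂ hpW)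
    (h : ∀ w, Matrix.toLin' A (P w) = c • P (B w)) : @hpModel _ dm (projAction A) B := by
  have hB : Function.Injective B := by
    intro x y hxy
    apply P.injective
    apply hA
    rw [h, h, hxy]
  have hP0 : ∀ w : hpW, w ≠ 0 → P w ≠ 0 := fun w hw => by simpa using hw
  have hPs0 : ∀ v, v ≠ 0 → P.symm v ≠ 0 := fun w hw => by simpa using hw
  have hPc : Continuous P := P.toLinearMap.continuous_of_finiteDimensional
  have hPsc : Continuous P.symm := P.symm.toLinearMap.continuous_of_finiteDimensional
  let q : {w : hpW // w ≠ 0} → Projectivization ℂ (Fin 3 → ℂ) := fun w =>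
    Projectivization.mk ℂ (P w) (hP0 w w.2)
  have hψ0 : ∀ u v : {v : Fin 3 → ℂ // v ≠ 0}, (projectivizationSetoid ℂ (Fin 3 → ℂ)) u v →
      hpPsi (P.symm u) = hpPsi (P.symm v) := by
    rintro u v ⟨c, hc⟩
    have hc : (c : ℂ) • (v : Fin 3 → ℂ) = u := hc
    rw [← hc, map_smul, hp_Psi_smul _ c.ne_zero]
  let ψ : Projectivization ℂ (Fin 3 → ℂ) → (ℝ × ℝ) × ℝ := Quotient.lift _ hψ0
  have hq : @Continuous _ _ _ dm.toUniformSpace.toTopologicalSpace q := by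
    rw [hdm]
    have : Continuous fun w : {w : hpW // w ≠ 0} => (⟨P w, hP0 w w.2⟩ : {v : Fin 3 → ℂ // v ≠ 0}) :=
      (hPc.comp continuous_subtype_val).subtype_mk _
    exact continuous_quotient_mk'.comp this
  have hψ : @Continuous _ _ dm.toUniformSpace.toTopologicalSpace _ ψ := by
    rw [hdm]
    refine Continuous.quotient_lift ?_ hψ0
    have hn : Continuous fun v : {v : Fin 3 → ℂ // v ≠ 0} => P.symm v := hPsc.comp continuous_subtype_val
    have h0 : ∀ v : {v : Fin 3 → ℂ // v ≠ 0}, ‖P.symm v‖ ≠ 0 := fun v => norm_ne_zero_iff.2 (hPs0 v v.2)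
    unfold hpPsi
    exact ((hn.fst.fst.norm.div hn.norm h0).prodMk (hn.fst.snd.norm.div hn.norm h0)).prodMk
      (hn.snd.norm.div hn.norm h0)
  letI := dm
  refine hp_model_abs hB q hq ?_ ?_ ?_ ψ hψ ?_
  · intro x
    induction x using Projectivization.ind with
    | h v hv =>
      refine ⟨⟨P.symm v, hPs0 v hv⟩, ?_⟩
      simp [q]
  · intro c w w' hc hw
    refine (Projectivization.mk_eq_mk_iff' _ _ _ _ _).2 ⟨c, ?_⟩
    rw [hw, map_smul]
  · intro w w' hw
    simp only [projAction, dif_pos hA, q, Projectivization.map_mk]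
    refine (Projectivization.mk_eq_mk_iff' _ _ _ _ _).2 ⟨c, ?_⟩
    rw [hw, ← h]
  · intro w
    have : ψ (q w) = hpPsi (P.symm (P w)) := rfl
    rw [this, P.symm_apply_apply]

theorem hp_final_diag [MetricSpace X] {f : X → X} {a b c : ℂ} (ha : a ≠ 0) (hb : b ≠ 0) (hc : c ≠ 0)
    (hab : ‖a‖ ≤ ‖b‖) (hbc : ‖b‖ ≤ ‖c‖) (h1 : hpModel f (hpDiag a b c))
    (h2 : hpModel f (hpDiag b c a)) : hpol f = 0 ∨ hpol f = 1 ∨ hpol f = 2 := by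
  rcases hab.eq_or_lt with hab | hab
  · rcases hbc.eq_or_lt with hbc | hbc
    · left
      have := hp_le (hp_UB_of_PB h1 (hp_PB_diag0 hab hbc))
      simpa using this
    · right; left
      have hub := hp_UB_of_PB h1 (hp_PB_diag1 ha hb hc hab)
      exact le_antisymm (by simpa using hp_le hub) (hp_low_diag1 hb hbc h2 hub)
  · rcases hbc.eq_or_lt with hbc | hbc
    · right; left
      have hub := hp_UB_of_PB h2 (hp_PB_diag1 hb hc ha hbc)
      exact le_antisymm (by simpa using hp_le hub) (hp_low_diag1 ha hab h1 hub)
    · right; right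
      have hub := hp_UB_of_PB h1 (hp_PB_diag2 ha hb hc)
      exact le_antisymm (by simpa using hp_le hub) (hp_low_diag2 ha hab hbc h1 hub)

theorem hp_final_J2 [MetricSpace X] {f : X → X} {μ : ℂ} (hμ : μ ≠ 0)
    (h1 : hpModel f (hpBlk hpJ2 μ)) : hpol f = 0 ∨ hpol f = 1 ∨ hpol f = 2 := by
  right
  by_cases h : ‖μ‖ = 1
  · left
    have hub := hp_UB_of_PB h1 (hp_PB_J21 h)
    exact le_antisymm (by simpa using hp_le hub) (hp_low_J21 h1 hub)
  · right
    have hub := hp_UB_of_PB h1 (hp_PB_J22 hμ)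
    exact le_antisymm (by simpa using hp_le hub) (hp_low_J22 hμ h h1 hub)

theorem hp_final_J3 [MetricSpace X] {f : X → X}
    (h1 : hpModel f hpJ3) : hpol f = 0 ∨ hpol f = 1 ∨ hpol f = 2 := by
  right; right
  have hub := hp_UB_of_PB h1 hp_PB_J3
  exact le_antisymm (by simpa using hp_le hub) (hp_low_J3 h1 hub)

/-- Let `g ∈ PGL₃(ℂ)` (represented by an invertible matrix `A`) act on `ℙ²(ℂ)`, and let
`d` be any metric on `ℙ²(ℂ)` inducing its topology.  Then `hpol g ∈ {0, 1, 2}`. -/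
theorem hpol_PGL3_mem (A : Matrix (Fin 3) (Fin 3) ℂ) (hA : A.det ≠ 0)
    (dm : MetricSpace (Projectivization ℂ (Fin 3 → ℂ)))
    (hdm : dm.toUniformSpace.toTopologicalSpace =
      inferInstanceAs (TopologicalSpace (Projectivization ℂ (Fin 3 → ℂ)))) :
    @hpol _ dm.toPseudoMetricSpace (projAction A) = 0 ∨
      @hpol _ dm.toPseudoMetricSpace (projAction A) = 1 ∨
      @hpol _ dm.toPseudoMetricSpace (projAction A) = 2 := by
  have hinj : Function.Injective (Matrix.toLin' A) := by
    have : Function.Injective A.mulVec := Matrix.mulVec_injective_iff_isUnit.2 ((Matrix.isUnit_iff_isUnit_det A).2 hA.isUnit)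
    intro x y hxy
    exact this (by simpa using hxy)
  obtain ⟨v0, v1, v2, hli, hJ⟩ := hp_jordan (by simp) (Matrix.toLin' A) hinj
  rcases hJ with ⟨a, b, c, ha, hb, hc, ea, eb, ec⟩ | ⟨a, μ, ha, hμ, e0, e1, e2⟩ | ⟨a, ha, e0, e1, e2⟩
  · let v : Fin 3 → (Fin 3 → ℂ) := ![v0, v1, v2]
    let e : Fin 3 → ℂ := ![a, b, c]
    have he : ∀ i, Matrix.toLin' A (v i) = e i • v i := by
      intro i; fin_cases i
      · exact ea
      · exact eb
      · exact ec
    have he0 : ∀ i, e i ≠ 0 := by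
      intro i; fin_cases i
      · exact ha
      · exact hb
      · exact hc
    have hM : ∀ τ : Equiv.Perm (Fin 3), @hpModel _ dm (projAction A) (hpDiag (e (τ 0)) (e (τ 1)) (e (τ 2))) := by
      intro τ
      obtain ⟨P, hP⟩ := hp_iso (v ∘ τ) (hli.comp _ τ.injective)
      refine hp_model A hinj dm hdm P 1 one_ne_zero _ fun w => ?_
      have := hp_diag_pow (e (τ 0)) (e (τ 1)) (e (τ 2)) 1 w
      simp only [pow_one] at this
      rw [this, hP, hP]
      simp only [map_add, map_smul, Function.comp, he]
      module
    let σ := Tuple.sort (fun i => ‖e i‖)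
    have hσ : Monotone ((fun i => ‖e i‖) ∘ σ) := Tuple.monotone_sort _
    have m2 := hM ((finRotate 3).trans σ)
    exact @hp_final_diag _ dm _ _ _ _ (he0 (σ 0)) (he0 (σ 1)) (he0 (σ 2)) (hσ (by decide)) (hσ (by decide))
      (hM σ) m2
  · obtain ⟨P, hP⟩ := hp_iso _ hli
    refine @hp_final_J2 _ dm _ _ hμ (hp_model A hinj dm hdm P a ha _ fun w => ?_)
    have := hp_Blk_pow hpJ2 μ 1 w
    have t := hp_J2_pow 1 w.1
    simp only [pow_one] at this t
    rw [this, t, hP, hP]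
    simp only [Matrix.cons_val_zero, Matrix.cons_val_one, Matrix.cons_val]
    simp only [map_add, map_smul, e0, e1, e2, Nat.cast_one]
    module
  · obtain ⟨P, hP⟩ := hp_iso _ hli
    refine @hp_final_J3 _ dm _ (hp_model A hinj dm hdm P a ha _ fun w => ?_)
    have := hp_J3_pow 1 w
    simp only [pow_one] at this
    rw [this, hP, hP]
    simp only [Matrix.cons_val_zero, Matrix.cons_val_one, Matrix.cons_val]
    simp only [map_add, map_smul, e0, e1, e2, Nat.cast_one]
    module
end
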